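/- arXiv:math/0310498 — 4 statements merged into one kernel-verified Lean document; each statement's English description precedes it below -/
import Mathlib

section
/- Fix an integer n ≥ 2. Let F, G : ℝ → ℝ be C² bijections with everywhere-positive derivative satisfying F(x+1) = F(x)+1 and G(x+1) = G(x)+1 for all x (so F and G are lifts of orientation-preserving C² circle diffeomorphisms), and suppose there is an integer m with F ∘ G = G^[n] ∘ F + m (i.e. F(G(x)) = G^[n](F(x)) + m for all x), where G^[n] is the n-fold iterate of G. If the translation number τ(F) is irrational, then there exist an integer k with 1 ≤ k ≤ n+1 and an integer j such that G^[k](x) = x + j for all x ∈ ℝ (i.e. the circle map induced by G satisfies g^k = id). -/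
open Filter Set Topology

noncomputable section

/-- A closed nonempty set of reals invariant under integer translations has, around every point
of its complement, a complementary interval of length at most one. -/
theorem exists_complementary_interval {S : Set ℝ} (hclosed : IsClosed S) (hne : S.Nonempty)
    (hS : ∀ x ∈ S, ∀ j : ℤ, x + j ∈ S) {x₀ : ℝ} (hx₀ : x₀ ∉ S) :
    ∃ a ∈ S, ∃ b ∈ S, a < x₀ ∧ x₀ < b ∧ b ≤ a + 1 ∧ ∀ x ∈ Ioo a b, x ∉ S := by
  obtain ⟨p, hp⟩ := hne
  have hlow : (S ∩ Iic x₀).Nonempty := by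
    refine ⟨p + ⌊x₀ - p⌋, hS p hp _, ?_⟩
    have := Int.floor_le (x₀ - p)
    simp only [mem_Iic]
    linarith
  have hupp : (S ∩ Ici x₀).Nonempty := by
    refine ⟨p + ⌈x₀ - p⌉, hS p hp _, ?_⟩
    have := Int.le_ceil (x₀ - p)
    simp only [mem_Ici]
    linarith
  have hA : BddAbove (S ∩ Iic x₀) := ⟨x₀, fun x hx => hx.2⟩
  have hB : BddBelow (S ∩ Ici x₀) := ⟨x₀, fun x hx => hx.2⟩
  have ha := (hclosed.inter isClosed_Iic).csSup_mem hlow hA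
  have hb := (hclosed.inter isClosed_Ici).csInf_mem hupp hB
  set a := sSup (S ∩ Iic x₀)
  set b := sInf (S ∩ Ici x₀)
  refine ⟨a, ha.1, b, hb.1, lt_of_le_of_ne ha.2 fun h => hx₀ (h ▸ ha.1),
    lt_of_le_of_ne hb.2 fun h => hx₀ (h ▸ hb.1), ?_, ?_⟩
  · have h1 : a + 1 ∈ S := by simpa using hS a ha.1 1
    refine csInf_le hB ⟨h1, ?_⟩
    by_contra h
    have h2 : a + 1 ≤ x₀ := (not_le.1 h).le
    have : a + 1 ≤ a := le_csSup hA ⟨h1, h2⟩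
    linarith
  · intro x hx hxS
    rcases le_total x x₀ with h | h
    · exact absurd (le_csSup hA ⟨hxS, h⟩) (not_le.2 hx.1)
    · exact absurd (csInf_le hB ⟨hxS, h⟩) (not_le.2 hx.2)

/-- Complementary intervals of a set invariant under integer translations, pairwise distinct
modulo integer translations, have bounded total length. -/
theorem sum_length_complementary_intervals_le {S : Set ℝ} (hS : ∀ x ∈ S, ∀ j : ℤ, x + j ∈ S)
    {u v : ℕ → ℝ} {N : ℕ} (hu : ∀ k < N, u k ∈ S) (hv : ∀ k < N, v k ∈ S)
    (huv : ∀ k < N, u k ≤ v k) (hlen : ∀ k < N, v k ≤ u k + 1)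
    (hgap : ∀ k < N, ∀ x ∈ Ioo (u k) (v k), x ∉ S)
    (hdist : ∀ k < N, ∀ l < N, k < l → ∀ j : ℤ, u k ≠ u l + j) :
    ∑ k ∈ Finset.range N, (v k - u k) ≤ 2 := by
  set t : ℕ → ℝ := fun k => u k + (-⌊u k⌋ : ℤ) with ht
  set w : ℕ → ℝ := fun k => v k + (-⌊u k⌋ : ℤ) with hw
  have htS : ∀ k < N, t k ∈ S := fun k hk => hS _ (hu k hk) _
  have hwS : ∀ k < N, w k ∈ S := fun k hk => hS _ (hv k hk) _
  have hgap' : ∀ k < N, ∀ x ∈ Ioo (t k) (w k), x ∉ S := by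
    intro k hk x hx hxS
    simp only [ht, hw, mem_Ioo, Int.cast_neg] at hx
    exact hgap k hk (x + ⌊u k⌋) ⟨by linarith, by linarith⟩ (hS x hxS _)
  have hne : ∀ k < N, ∀ l < N, k < l → t k ≠ t l := by
    intro k hk l hl hkl h
    apply hdist k hk l hl hkl (⌊u k⌋ - ⌊u l⌋)
    simp only [ht, Int.cast_neg] at h
    push_cast
    linarith
  have hdisj : ∀ k < N, ∀ l < N, k < l → Disjoint (Ioo (t k) (w k)) (Ioo (t l) (w l)) := by
    intro k hk l hl hkl
    rw [Set.disjoint_left]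
    intro x hxk hxl
    rcases lt_trichotomy (t k) (t l) with h | h | h
    · exact hgap' k hk _ ⟨h, hxl.1.trans hxk.2⟩ (htS l hl)
    · exact hne k hk l hl hkl h
    · exact hgap' l hl _ ⟨h, hxk.1.trans hxl.2⟩ (htS k hk)
  have hpair : (↑(Finset.range N) : Set ℕ).PairwiseDisjoint fun k => Ioo (t k) (w k) := by
    intro k hk l hl hkl
    simp only [Finset.coe_range, mem_Iio] at hk hl
    rcases lt_or_gt_of_ne hkl with h | h
    · exact hdisj k hk l hl h
    · exact (hdisj l hl k hk h).symm
  have hmeas := MeasureTheory.measure_biUnion_finset (μ := MeasureTheory.volume) hpair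
    (fun _ _ => measurableSet_Ioo)
  have hsub : (⋃ k ∈ Finset.range N, Ioo (t k) (w k)) ⊆ Icc 0 2 := by
    intro x hx
    simp only [mem_iUnion, Finset.mem_range] at hx
    obtain ⟨k, hk, hx⟩ := hx
    simp only [ht, hw, mem_Ioo, Int.cast_neg] at hx
    have h1 := Int.floor_le (u k)
    have h2 := Int.lt_floor_add_one (u k)
    have h3 := hlen k hk
    exact ⟨by linarith, by linarith⟩
  have hle := MeasureTheory.measure_mono (μ := MeasureTheory.volume) hsub
  rw [hmeas] at hle
  simp only [Real.volume_Ioo, Real.volume_Icc, ht, hw, add_sub_add_right_eq_sub] at hle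
  rw [← ENNReal.ofReal_sum_of_nonneg] at hle
  · have := (ENNReal.ofReal_le_ofReal_iff (by norm_num)).1 hle
    linarith
  · intro k hk
    linarith [huv k (Finset.mem_range.1 hk)]

theorem Function.Periodic.exists_abs_le_of_continuous {f : ℝ → ℝ} {c : ℝ}
    (hper : Function.Periodic f c) (hc : 0 < c) (hf : Continuous f) : ∃ C, ∀ x, |f x| ≤ C := by
  obtain ⟨C, hC⟩ := isCompact_Icc.exists_bound_of_continuousOn (s := Icc 0 c) hf.continuousOn
  refine ⟨C, fun x => ?_⟩
  obtain ⟨y, hy, hxy⟩ := hper.exists_mem_Ico₀ hc x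
  rw [hxy]
  exact hC y (Ico_subset_Icc_self hy)

theorem Function.Periodic.deriv {f : ℝ → ℝ} {c : ℝ} (hper : Function.Periodic f c) :
    Function.Periodic (deriv f) c := by
  intro x
  rw [← deriv_comp_add_const]
  exact congrArg (fun g => _root_.deriv g x) (funext hper)

theorem periodic_deriv_of_map_add_one {F : ℝ → ℝ} (hper : ∀ x, F (x + 1) = F x + 1) :
    Function.Periodic (deriv F) 1 := by
  intro x
  rw [← deriv_comp_add_const]
  simp [hper]

/-- The logarithm of the derivative of a lift of a `C²` circle diffeomorphism is Lipschitz. -/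
theorem exists_abs_log_deriv_sub_le {F : ℝ → ℝ} (hF : ContDiff ℝ 2 F) (hF' : ∀ x, 0 < deriv F x)
    (hper : ∀ x, F (x + 1) = F x + 1) :
    ∃ L, 0 ≤ L ∧ ∀ x y, |Real.log (deriv F x) - Real.log (deriv F y)| ≤ L * |x - y| := by
  have hd : ContDiff ℝ 1 (deriv F) :=
    ContDiff.deriv' (n := 1) (by simpa [one_add_one_eq_two] using hF)
  have hl : ContDiff ℝ 1 fun x => Real.log (deriv F x) := hd.log fun x => (hF' x).ne'
  have hp : Function.Periodic (fun x => Real.log (deriv F x)) 1 := fun x => by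
    simp only [periodic_deriv_of_map_add_one hper x]
  obtain ⟨L, hL⟩ := hp.deriv.exists_abs_le_of_continuous one_pos (hl.continuous_deriv le_rfl)
  refine ⟨L, (abs_nonneg _).trans (hL 0), fun x y => ?_⟩
  exact convex_univ.norm_image_sub_le_of_norm_deriv_le
    (fun z _ => (hl.differentiable one_ne_zero) z) (fun z _ => hL z) (mem_univ y) (mem_univ x)

/-- A lift of a `C¹` circle diffeomorphism contracts distances at most by a constant factor. -/
theorem exists_pos_mul_sub_le_sub {G : ℝ → ℝ} (hG : ContDiff ℝ 1 G) (hG' : ∀ x, 0 < deriv G x)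
    (hper : ∀ x, G (x + 1) = G x + 1) :
    ∃ c, 0 < c ∧ ∀ x y, x ≤ y → c * (y - x) ≤ G y - G x := by
  have hl : Continuous fun x => Real.log (deriv G x) :=
    (hG.continuous_deriv le_rfl).log fun x => (hG' x).ne'
  have hp : Function.Periodic (fun x => Real.log (deriv G x)) 1 := fun x => by
    simp only [periodic_deriv_of_map_add_one hper x]
  obtain ⟨C, hC⟩ := hp.exists_abs_le_of_continuous one_pos hl
  refine ⟨Real.exp (-C), Real.exp_pos _, fun x y hxy =>
    mul_sub_le_image_sub_of_le_deriv (hG.differentiable one_ne_zero) (fun z => ?_) hxy⟩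
  rw [← Real.le_log_iff_exp_le (hG' z)]
  exact (abs_le.1 (hC z)).1

theorem pow_mul_sub_le_iterate_sub {G : ℝ → ℝ} (hG : Monotone G) {c : ℝ} (hc : 0 < c)
    (h : ∀ x y, x ≤ y → c * (y - x) ≤ G y - G x) (k : ℕ) :
    ∀ x y, x ≤ y → c ^ k * (y - x) ≤ G^[k] y - G^[k] x := by
  induction k with
  | zero => intro x y _; simp
  | succ k ih =>
    intro x y hxy
    simp only [Function.iterate_succ_apply]
    calc c ^ (k + 1) * (y - x) = c ^ k * (c * (y - x)) := by ring
      _ ≤ c ^ k * (G y - G x) := by gcongr; exact h x y hxy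
      _ ≤ _ := ih _ _ (hG hxy)

theorem hasDerivAt_iterate_prod {F : ℝ → ℝ} (hF : Differentiable ℝ F) (N : ℕ) (x : ℝ) :
    HasDerivAt F^[N] (∏ k ∈ Finset.range N, deriv F (F^[k] x)) x := by
  induction N with
  | zero => simpa using hasDerivAt_id x
  | succ N ih =>
    rw [Function.iterate_succ', Finset.prod_range_succ, mul_comm]
    exact (hF (F^[N] x)).hasDerivAt.comp x ih

/-- Bounded distortion of the derivatives of iterates on an interval whose forward images have
bounded total length. -/
theorem prod_deriv_le_exp_mul_prod_deriv {F : ℝ → ℝ} (hmono : Monotone F)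
    (hF' : ∀ x, 0 < deriv F x) {L : ℝ} (hL : 0 ≤ L)
    (hlip : ∀ x y, |Real.log (deriv F x) - Real.log (deriv F y)| ≤ L * |x - y|)
    {N : ℕ} {p q B : ℝ} (hsum : ∑ k ∈ Finset.range N, (F^[k] q - F^[k] p) ≤ B)
    {x y : ℝ} (hx : x ∈ Icc p q) (hy : y ∈ Icc p q) :
    ∏ k ∈ Finset.range N, deriv F (F^[k] x) ≤
      Real.exp (L * B) * ∏ k ∈ Finset.range N, deriv F (F^[k] y) := by
  have hpos : ∀ z, 0 < ∏ k ∈ Finset.range N, deriv F (F^[k] z) :=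
    fun z => Finset.prod_pos fun k _ => hF' _
  rw [← Real.log_le_log_iff (hpos x) (mul_pos (Real.exp_pos _) (hpos y)),
    Real.log_mul (Real.exp_pos _).ne' (hpos y).ne', Real.log_exp,
    Real.log_prod (fun k _ => (hF' _).ne'), Real.log_prod (fun k _ => (hF' _).ne'),
    ← sub_le_iff_le_add, ← Finset.sum_sub_distrib]
  calc _ ≤ ∑ k ∈ Finset.range N, L * (F^[k] q - F^[k] p) := by
        refine Finset.sum_le_sum fun k _ => (le_abs_self _).trans ((hlip _ _).trans ?_)
        gcongr
        have hk := hmono.iterate k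
        exact abs_sub_le_of_le_of_le (hk hx.1) (hk hx.2) (hk hy.1) (hk hy.2)
    _ = L * ∑ k ∈ Finset.range N, (F^[k] q - F^[k] p) := by rw [Finset.mul_sum]
    _ ≤ L * B := by gcongr

theorem exists_mem_abs_image_sub_eq {f f' : ℝ → ℝ} (hf : ∀ x, HasDerivAt f (f' x) x)
    (hf' : ∀ x, 0 < f' x) {p q x y : ℝ} (hx : x ∈ Icc p q) (hy : y ∈ Icc p q) :
    ∃ z ∈ Icc p q, |f x - f y| = f' z * |x - y| := by
  have hcont : Continuous f := continuous_iff_continuousAt.2 fun x => (hf x).continuousAt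
  wlog hxy : y < x generalizing x y
  · rcases (not_lt.1 hxy).eq_or_lt with rfl | h
    · exact ⟨x, hx, by simp⟩
    · rw [abs_sub_comm (f x), abs_sub_comm x]
      exact this hy hx h
  obtain ⟨z, hz, h⟩ := exists_hasDerivAt_eq_slope f f' hxy hcont.continuousOn fun z _ => hf z
  refine ⟨z, ⟨hy.1.trans hz.1.le, hz.2.le.trans hx.2⟩, ?_⟩
  have h' : f x - f y = f' z * (x - y) := by
    rw [h, div_mul_cancel₀ _ (sub_pos.2 hxy).ne']
  rw [h', abs_mul, abs_of_pos (hf' z)]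

theorem tendsto_iterate_succ_sub_iterate {H : ℝ → ℝ} (hH : Monotone H) {a b x : ℝ}
    (hab : ∀ k, H^[k] x ∈ Icc a b) :
    Tendsto (fun k => |H^[k] x - H^[k] (H x)|) atTop (𝓝 0) := by
  have hlim : ∃ l, Tendsto (fun k => H^[k] x) atTop (𝓝 l) := by
    rcases le_total x (H x) with h | h
    · exact ⟨_, tendsto_atTop_ciSup (hH.monotone_iterate_of_le_map h)
        ⟨b, forall_mem_range.2 fun k => (hab k).2⟩⟩
    · exact ⟨_, tendsto_atTop_ciInf (hH.antitone_iterate_of_map_le h)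
        ⟨a, forall_mem_range.2 fun k => (hab k).1⟩⟩
  obtain ⟨l, hl⟩ := hlim
  have h := (hl.sub (hl.comp (tendsto_add_atTop_nat 1))).abs
  simpa [Function.comp_def, Function.iterate_succ_apply] using h

namespace CircleDeg1Lift

theorem iterate_ne_iterate_add_int {f : CircleDeg1Lift} (hf : Irrational f.translationNumber)
    (x : ℝ) {k l : ℕ} (hkl : k < l) (j : ℤ) : f^[k] x ≠ f^[l] x + j := by
  intro h
  apply hf
  obtain ⟨d, rfl⟩ := Nat.exists_eq_add_of_lt hkl
  have h2 : (f ^ (d + 1)) (f^[k] x) = f^[k] x + (-j : ℤ) := by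
    rw [coe_pow, ← Function.iterate_add_apply, show d + 1 + k = k + d + 1 by ring]
    push_cast
    linarith
  rw [f.translationNumber_of_map_pow_eq_add_int h2 d.succ_pos]
  exact ⟨(-j : ℤ) / (d + 1 : ℕ), by push_cast; rfl⟩

theorem iterate_eq_self_iff (f : CircleDeg1Lift) {x : ℝ} {k : ℕ} (hk : 0 < k) :
    f^[k] x = x ↔ f x = x := by
  simpa using f.iterate_pos_eq_iff (x := x) (m := 0) hk

/-- If a `C²` circle diffeomorphism with irrational rotation number conjugates `H` to a proper
power of `H`, and `H` has a fixed point, then `H` is the identity. -/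
theorem eq_self_of_semiconj_iterate {F H : CircleDeg1Lift} {n : ℕ} (hn : 2 ≤ n)
    (hF : ContDiff ℝ 2 F) (hF' : ∀ x, 0 < deriv F x) (hFbij : Function.Bijective F)
    (hirr : Irrational F.translationNumber) (hH : Continuous H) {c : ℝ} (hc : 0 < c)
    (hexp : ∀ x y, x ≤ y → c * (y - x) ≤ H y - H x)
    (hrel : Function.Semiconj F H H^[n]) (hfix : ∃ x, H x = x) (x : ℝ) : H x = x := by
  by_contra hx
  set S : Set ℝ := {y | H y = y} with hSdef
  have hS : ∀ y ∈ S, ∀ j : ℤ, y + j ∈ S := by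
    intro y hy j
    rw [hSdef, mem_ofPred_eq, H.map_add_int, hy]
  obtain ⟨a, ha, b, hb, hax, hxb, hba, hgap⟩ :=
    exists_complementary_interval (isClosed_eq hH continuous_id) hfix hS (x₀ := x) hx
  obtain ⟨L, hL, hlip⟩ := exists_abs_log_deriv_sub_le hF hF' F.map_add_one
  have hFmono : StrictMono F := F.strictMono_iff_injective.2 hFbij.1
  have hsemi : ∀ N, Function.Semiconj F^[N] H H^[n ^ N] := by
    intro N
    induction N with
    | zero => simpa using Function.Semiconj.id_left
    | succ N ih =>
      rw [Function.iterate_succ', pow_succ', Function.iterate_mul]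
      exact Function.Semiconj.comp_left (hrel.iterate_right _) ih
  have hSiff : ∀ N y, F^[N] y ∈ S ↔ y ∈ S := by
    intro N y
    rw [hSdef, mem_ofPred_eq, mem_ofPred_eq, ← H.iterate_eq_self_iff (pow_pos (by omega : 0 < n) N),
      ← (hsemi N).eq, (hFbij.1.iterate N).eq_iff]
  have horbit : ∀ k, H^[k] x ∈ Icc a b := by
    intro k
    constructor
    · rw [← Function.iterate_fixed (show H a = a from ha) k]
      exact H.monotone.iterate k hax.le
    · rw [← Function.iterate_fixed (show H b = b from hb) k]
      exact H.monotone.iterate k hxb.le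
  have hbound : ∀ N, c * |x - H x| ≤
      Real.exp (L * 2) * |H^[n ^ N] x - H^[n ^ N] (H x)| := by
    intro N
    have hNmono : StrictMono F^[N] := hFmono.iterate N
    have hNsurj : Function.Surjective F^[N] := hFbij.2.iterate N
    obtain ⟨p, hp⟩ := hNsurj a
    obtain ⟨q, hq⟩ := hNsurj b
    obtain ⟨y, hy⟩ := hNsurj x
    obtain ⟨z, hz⟩ := hNsurj (H x)
    have hpS : p ∈ S := (hSiff N p).1 (hp ▸ ha)
    have hqS : q ∈ S := (hSiff N q).1 (hq ▸ hb)
    have hmem : ∀ w, F^[N] w ∈ Icc a b → w ∈ Icc p q := by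
      intro w hw
      rw [← hp, ← hq] at hw
      exact ⟨hNmono.le_iff_le.1 hw.1, hNmono.le_iff_le.1 hw.2⟩
    have hpq : p ≤ q := hNmono.le_iff_le.1 (by rw [hp, hq]; linarith)
    have hqp : q ≤ p + 1 := by
      refine hNmono.le_iff_le.1 ?_
      rw [← coe_pow, map_add_one, coe_pow, hp, hq]
      exact hba
    have hsum : ∑ k ∈ Finset.range N, (F^[k] q - F^[k] p) ≤ 2 := by
      refine sum_length_complementary_intervals_le hS (fun k _ => (hSiff k p).2 hpS)
        (fun k _ => (hSiff k q).2 hqS) (fun k _ => hFmono.monotone.iterate k hpq) ?_ ?_ ?_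
      · intro k _
        rw [← coe_pow, ← map_add_one]
        exact (F ^ k).monotone hqp
      · intro k hk w hw hwS
        refine hgap (F^[N - k] w) ?_ ((hSiff _ w).2 hwS)
        have hadd : ∀ w, F^[N] w = F^[N - k] (F^[k] w) := fun w => by
          rw [← Function.iterate_add_apply, Nat.sub_add_cancel hk.le]
        rw [← hp, ← hq, hadd, hadd]
        exact ⟨hFmono.iterate _ hw.1, hFmono.iterate _ hw.2⟩
      · exact fun k _ l _ hkl j => iterate_ne_iterate_add_int hirr p hkl j
    have hder := hasDerivAt_iterate_prod (hF.differentiable two_ne_zero) N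
    have hpos : ∀ z, 0 < ∏ k ∈ Finset.range N, deriv F (F^[k] z) :=
      fun z => Finset.prod_pos fun k _ => hF' _
    have hHy : F^[N] (H y) = H^[n ^ N] x := by rw [(hsemi N).eq, hy]
    have hHz : F^[N] (H z) = H^[n ^ N] (H x) := by rw [(hsemi N).eq, hz]
    obtain ⟨ξ, hξ, h1⟩ := exists_mem_abs_image_sub_eq hder hpos
      (hmem y (hy ▸ horbit 0)) (hmem z (hz ▸ horbit 1))
    obtain ⟨η, hη, h2⟩ := exists_mem_abs_image_sub_eq hder hpos
      (hmem (H y) (hHy ▸ horbit _)) (hmem (H z) (hHz ▸ horbit (n ^ N + 1)))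
    have h3 := prod_deriv_le_exp_mul_prod_deriv F.monotone hF' hL hlip hsum hξ hη
    have h4 : c * |y - z| ≤ |H y - H z| := by
      rcases le_total y z with h | h
      · rw [abs_sub_comm y, abs_sub_comm (H y), abs_of_nonneg (sub_nonneg.2 h),
          abs_of_nonneg (sub_nonneg.2 (H.monotone h))]
        exact hexp _ _ h
      · rw [abs_of_nonneg (sub_nonneg.2 h), abs_of_nonneg (sub_nonneg.2 (H.monotone h))]
        exact hexp _ _ h
    rw [hy, hz] at h1
    rw [hHy, hHz] at h2
    rw [h1, h2]
    set P := ∏ k ∈ Finset.range N, deriv F (F^[k] ξ)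
    set Q := ∏ k ∈ Finset.range N, deriv F (F^[k] η) with hQ
    calc c * (P * |y - z|) = P * (c * |y - z|) := by ring
      _ ≤ (Real.exp (L * 2) * Q) * |H y - H z| :=
        mul_le_mul h3 h4 (by positivity) (mul_pos (Real.exp_pos _) (hpos η)).le
      _ = _ := by ring
  have hlim := ((tendsto_iterate_succ_sub_iterate H.monotone horbit).comp
    (tendsto_pow_atTop_atTop_of_one_lt (show 1 < n by omega))).const_mul (Real.exp (L * 2))
  rw [mul_zero] at hlim
  have hle : c * |x - H x| ≤ 0 := ge_of_tendsto' hlim hbound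
  have : 0 < c * |x - H x| := mul_pos hc (abs_pos.2 (sub_ne_zero.2 (Ne.symm hx)))
  linarith

end CircleDeg1Lift

/-- If `F` and `G` are lifts of orientation-preserving `C²` circle diffeomorphisms
satisfying the Baumslag–Solitar relation `F ∘ G = G^[n] ∘ F + m`, and the translation
number of `F` is irrational, then the circle map induced by `G` has finite order at
most `n+1`. -/
theorem irrational_rotation_number_implies_b_finite_order
    (n : ℕ) (hn : 2 ≤ n) (F G : ℝ → ℝ)
    (hFdiff : ContDiff ℝ 2 F) (hGdiff : ContDiff ℝ 2 G)
    (hFbij : Function.Bijective F) (hGbij : Function.Bijective G)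
    (hF' : ∀ x : ℝ, 0 < deriv F x) (hG' : ∀ x : ℝ, 0 < deriv G x)
    (hFper : ∀ x : ℝ, F (x + 1) = F x + 1) (hGper : ∀ x : ℝ, G (x + 1) = G x + 1)
    (m : ℤ) (hrel : ∀ x : ℝ, F (G x) = G^[n] (F x) + m)
    (τ : ℝ) (hτ : Tendsto (fun k : ℕ => F^[k] 0 / (k : ℝ)) atTop (nhds τ))
    (hirr : Irrational τ) :
    ∃ k : ℕ, 1 ≤ k ∧ k ≤ n + 1 ∧ ∃ j : ℤ, ∀ x : ℝ, G^[k] x = x + (j : ℝ) := by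
  have hFmono : StrictMono F := strictMono_of_deriv_pos hF'
  have hGmono : StrictMono G := strictMono_of_deriv_pos hG'
  let f : CircleDeg1Lift := ⟨⟨F, hFmono.monotone⟩, hFper⟩
  let g : CircleDeg1Lift := ⟨⟨G, hGmono.monotone⟩, hGper⟩
  let t : CircleDeg1Lift := (CircleDeg1Lift.translate (Multiplicative.ofAdd (m : ℝ)))
  have hft : Commute f t := CircleDeg1Lift.ext fun x => by simp [t]
  have hgt : Commute g t := CircleDeg1Lift.ext fun x => by simp [t]
  have hfg : SemiconjBy f g (t * g ^ n) := CircleDeg1Lift.ext fun x => by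
    simpa [t, f, g, CircleDeg1Lift.coe_pow, add_comm] using hrel x
  have hτg : g.translationNumber = m + n * g.translationNumber := by
    conv_lhs => rw [CircleDeg1Lift.translationNumber_eq_of_semiconjBy hfg,
      CircleDeg1Lift.translationNumber_mul_of_commute (hgt.symm.pow_right n),
      CircleDeg1Lift.translationNumber_pow, CircleDeg1Lift.translationNumber_translate]
  obtain ⟨r, rfl⟩ : ∃ r, n = r + 1 := ⟨n - 1, by omega⟩
  set h : CircleDeg1Lift := t * g ^ r with hh
  have hτh : h.translationNumber = (0 : ℤ) := by
    rw [hh, CircleDeg1Lift.translationNumber_mul_of_commute (hgt.symm.pow_right r),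
      CircleDeg1Lift.translationNumber_pow, CircleDeg1Lift.translationNumber_translate]
    push_cast at hτg ⊢
    linarith
  have hfh : SemiconjBy f h (h ^ (r + 1)) := by
    have h1 := SemiconjBy.mul_right hft (hfg.pow_right r)
    have h2 : t * (t * g ^ (r + 1)) ^ r = h ^ (r + 1) := by
      rw [hh, (hgt.symm.pow_right (r + 1)).mul_pow, (hgt.symm.pow_right r).mul_pow, ← mul_assoc,
        ← pow_succ', ← pow_mul, ← pow_mul, mul_comm r]
    rwa [h2] at h1
  have happ : ∀ x, h x = m + G^[r] x := fun x => by
    simp [hh, t, CircleDeg1Lift.coe_pow, g]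
  have hcont : Continuous h := by
    rw [show (h : ℝ → ℝ) = fun x => m + G^[r] x from funext happ]
    exact continuous_const.add (hGdiff.continuous.iterate r)
  have hfix : ∃ x, h x = x := by
    simpa using (h.translationNumber_eq_int_iff hcont).1 hτh
  obtain ⟨c, hc, hexp⟩ := exists_pos_mul_sub_le_sub (hGdiff.of_le one_le_two) hG' hGper
  have hid := CircleDeg1Lift.eq_self_of_semiconj_iterate (F := f) (H := h) hn hFdiff hF' hFbij
    (by rwa [f.translationNumber_eq_of_tendsto₀ hτ]) hcont (pow_pos hc r)
    (fun x y hxy => by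
      have := pow_mul_sub_le_iterate_sub hGmono.monotone hc hexp r x y hxy
      rw [happ, happ]
      linarith)
    (by simpa [CircleDeg1Lift.coe_pow] using CircleDeg1Lift.semiconjBy_iff_semiconj.1 hfh) hfix
  refine ⟨r, by omega, by omega, -m, fun x => ?_⟩
  have := hid x
  rw [happ] at this
  push_cast
  linarith

end
end

section
/- Let r ≥ 2 and λ ≥ 2 be integers, let q < q₁ be reals, and let f, g be C^r diffeomorphisms of the half-open interval [q,q₁) fixing q, such that g has no fixed point in (q,q₁) and f ∘ g = g^[λ] ∘ f on [q,q₁). Then the first one-sided derivative of g at q equals 1, and either (1) the i-th one-sided derivative of g at q vanishes for every i with 2 ≤ i ≤ r, or (2) there exists an integer s with 1 ≤ s < r such that f′(q) = (1/λ)^{1/s}, the i-th one-sided derivative of g at q vanishes for all 2 ≤ i ≤ s, and the (s+1)-st one-sided derivative of g at q is nonzero. -/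
open Filter Set Topology
open scoped ContDiff

noncomputable section

/-- A `C^r` diffeomorphism of the half-open interval `[q, q₁)`: a bijection of `[q, q₁)`
onto itself which is `C^r` on `[q, q₁)` (derivatives one-sided at `q`) with strictly
positive derivative. -/
def IsCrDiffeoOnIco (r : WithTop ℕ∞) (f : ℝ → ℝ) (q q₁ : ℝ) : Prop :=
  Set.BijOn f (Set.Ico q q₁) (Set.Ico q q₁) ∧ ContDiffOn ℝ r f (Set.Ico q q₁) ∧
    ∀ x ∈ Set.Ico q q₁, 0 < derivWithin f (Set.Ico q q₁) x

/-- A function fixing `q` with positive right derivative there maps right neighbourhoods of `q`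
into right neighbourhoods of `q`. -/
theorem HasDerivWithinAt.tendsto_nhdsGT_of_pos {h : ℝ → ℝ} {c q : ℝ}
    (hh : HasDerivWithinAt h c (Ioi q) q) (hq : h q = q) (hc : 0 < c) :
    Tendsto h (𝓝[>] q) (𝓝[>] q) := by
  have hslope := (hasDerivWithinAt_iff_tendsto_slope' self_notMem_Ioi).1 hh
  refine tendsto_nhdsWithin_iff.2 ⟨by simpa [ContinuousWithinAt, hq] using hh.continuousWithinAt, ?_⟩
  filter_upwards [hslope.eventually (lt_mem_nhds hc), self_mem_nhdsWithin] with x hx hxq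
  rw [slope_def_field, hq] at hx
  have hxq' : 0 < x - q := sub_pos.2 hxq
  have := (div_pos_iff_of_pos_right hxq').1 hx
  exact sub_pos.1 this

theorem HasDerivWithinAt.tendsto_sub_div_sub {h : ℝ → ℝ} {c q : ℝ}
    (hh : HasDerivWithinAt h c (Ioi q) q) (hq : h q = q) :
    Tendsto (fun x => (h x - q) / (x - q)) (𝓝[>] q) (𝓝 c) := by
  have hslope := (hasDerivWithinAt_iff_tendsto_slope' self_notMem_Ioi).1 hh
  refine hslope.congr fun x => ?_
  rw [slope_def_field, hq]

/-- If `g x - x ~ a (x - q) ^ m` and `u` fixes `q` with right derivative `c > 0`, then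
`g (u x) - u x ~ a (c (x - q)) ^ m`. -/
theorem tendsto_displacement_comp {g u : ℝ → ℝ} {a c q : ℝ} {m : ℕ}
    (hg : Tendsto (fun x => (g x - x) / (x - q) ^ m) (𝓝[>] q) (𝓝 a))
    (hu : HasDerivWithinAt u c (Ioi q) q) (huq : u q = q) (hc : 0 < c) :
    Tendsto (fun x => (g (u x) - u x) / (x - q) ^ m) (𝓝[>] q) (𝓝 (a * c ^ m)) := by
  have hu' := hu.tendsto_nhdsGT_of_pos huq hc
  refine ((hg.comp hu').mul ((hu.tendsto_sub_div_sub huq).pow m)).congr' ?_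
  filter_upwards [hu'.eventually self_mem_nhdsWithin, self_mem_nhdsWithin] with x hux hx
  have h₁ : u x - q ≠ 0 := sub_ne_zero.2 (ne_of_gt hux)
  have h₂ : x - q ≠ 0 := sub_ne_zero.2 (ne_of_gt hx)
  simp only [Function.comp_apply]
  rw [div_pow]
  field_simp

/-- If `g x - x ~ a (x - q) ^ m` and `g` is tangent to the identity at `q`, then
`g^[n] x - x ~ n a (x - q) ^ m`. -/
theorem tendsto_displacement_iterate {g : ℝ → ℝ} {a q : ℝ} {m : ℕ}
    (hg : Tendsto (fun x => (g x - x) / (x - q) ^ m) (𝓝[>] q) (𝓝 a)) (hgq : g q = q)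
    (hiter : ∀ n : ℕ, HasDerivWithinAt g^[n] 1 (Ioi q) q) (n : ℕ) :
    Tendsto (fun x => (g^[n] x - x) / (x - q) ^ m) (𝓝[>] q) (𝓝 (n * a)) := by
  induction n with
  | zero => simp
  | succ n ih =>
    have h := (tendsto_displacement_comp hg (hiter n) (Function.iterate_fixed hgq n) one_pos).add ih
    convert h using 2 with x
    · rw [Function.iterate_succ_apply']
      ring
    · push_cast
      ring

/-- If `f` is `C^1` on `[q, q₁)` and `g x - x ~ b v x`, then `f (g x) - f x ~ f′(q) b v x`. -/
theorem tendsto_image_displacement {f g : ℝ → ℝ} {q q₁ b : ℝ} (hq : q < q₁)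
    {v : ℝ → ℝ} (hf : ContDiffOn ℝ 1 f (Ico q q₁)) (hg : Tendsto g (𝓝[>] q) (𝓝[>] q))
    (hb : Tendsto (fun x => (g x - x) / v x) (𝓝[>] q) (𝓝 b)) :
    Tendsto (fun x => (f (g x) - f x) / v x) (𝓝[>] q)
      (𝓝 (derivWithin f (Ico q q₁) q * b)) := by
  set S := Ico q q₁
  set c := derivWithin f S q
  have hqS : q ∈ S := ⟨le_rfl, hq⟩
  have hd : ∀ x ∈ S, HasDerivWithinAt f (derivWithin f S x) S x := fun x hx =>
    (hf.differentiableOn one_ne_zero x hx).hasDerivWithinAt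
  have hcont : ContinuousWithinAt (derivWithin f S) S q :=
    hf.continuousOn_derivWithin (uniqueDiffOn_Ico q q₁) le_rfl q hqS
  have hlittle : (fun x => f (g x) - f x - c * (g x - x)) =o[𝓝[>] q] fun x => g x - x := by
    refine Asymptotics.isLittleO_iff.2 fun ε hε => ?_
    obtain ⟨δ, hδ, hball⟩ := Metric.continuousWithinAt_iff.1 hcont ε hε
    have hmem : ∀ᶠ x in 𝓝[>] q, x ∈ S ∩ Metric.ball q δ := by
      filter_upwards [Ioo_mem_nhdsGT hq, nhdsWithin_le_nhds (Metric.ball_mem_nhds q hδ)] with x hx hx'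
      exact ⟨Ioo_subset_Ico_self hx, hx'⟩
    filter_upwards [hmem, hg.eventually hmem] with x hx hgx
    have key := Convex.norm_image_sub_le_of_norm_hasDerivWithin_le
      (f := fun x => f x - c * x) (f' := fun x => derivWithin f S x - c)
      (s := S ∩ Metric.ball q δ) (C := ε) (x := x) (y := g x)
      (fun y hy => by
        simpa only [mul_one] using! ((hd y hy.1).mono inter_subset_left).sub
          ((hasDerivWithinAt_id y (S ∩ Metric.ball q δ)).const_mul c))
      (fun y hy => by
        have := hball hy.1 hy.2
        rw [Real.dist_eq] at this
        exact this.le)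
      ((convex_Ico q q₁).inter (convex_ball q δ)) hx hgx
    rwa [show f (g x) - c * g x - (f x - c * x) = f (g x) - f x - c * (g x - x) by ring] at key
  have hO : (fun x => (f (g x) - f x - c * (g x - x)) / v x) =o[𝓝[>] q]
      fun x => (g x - x) / v x := by
    simpa only [div_eq_mul_inv] using hlittle.mul_isBigO (Asymptotics.isBigO_refl (fun x => (v x)⁻¹) _)
  have h0 : Tendsto (fun x => (f (g x) - f x - c * (g x - x)) / v x) (𝓝[>] q) (𝓝 0) :=
    (Asymptotics.isLittleO_one_iff ℝ).1 (hO.trans_isBigO (hb.isBigO_one ℝ))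
  convert h0.add (hb.const_mul c) using 2 with x
  · ring
  · ring

/-- First nonvanishing Taylor coefficient of the displacement of a germ tangent to the identity. -/
theorem tendsto_displacement_of_contDiffOn {g : ℝ → ℝ} {q q₁ : ℝ} (hq : q < q₁) {m : ℕ}
    (hm : 2 ≤ m) (hg : ContDiffOn ℝ m g (Ico q q₁)) (hgq : g q = q)
    (hg1 : derivWithin g (Ico q q₁) q = 1)
    (hvan : ∀ i : ℕ, 2 ≤ i → i < m → iteratedDerivWithin i g (Ico q q₁) q = 0) :
    Tendsto (fun x => (g x - x) / (x - q) ^ m) (𝓝[>] q)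
      (𝓝 (iteratedDerivWithin m g (Ico q q₁) q / m.factorial)) := by
  have htaylor : ∀ x, taylorWithinEval g m (Ico q q₁) q x =
      x + iteratedDerivWithin m g (Ico q q₁) q / m.factorial * (x - q) ^ m := fun x => by
    obtain ⟨k, rfl⟩ := Nat.exists_eq_add_of_le' hm
    rw [taylor_within_apply, Finset.sum_range_succ, Finset.sum_range_succ', Finset.sum_range_succ',
      Finset.sum_eq_zero]
    · simp [iteratedDerivWithin_one, hg1, hgq]
      ring
    · intro i hi
      rw [hvan (i + 1 + 1) (by omega) (by have := Finset.mem_range.1 hi; omega), smul_zero]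
  have hpeano := taylor_isLittleO (convex_Ico q q₁) (left_mem_Ico.2 hq) hg
  have hle : 𝓝[>] q ≤ 𝓝[Ico q q₁] q := by
    rw [← nhdsWithin_Ioo_eq_nhdsGT hq]
    exact nhdsWithin_mono q Ioo_subset_Ico_self
  have h0 := (hpeano.mono hle).tendsto_div_nhds_zero
  have h := h0.add_const (iteratedDerivWithin m g (Ico q q₁) q / m.factorial)
  rw [zero_add] at h
  refine h.congr' ?_
  filter_upwards [self_mem_nhdsWithin] with x hx
  have hx' : x - q ≠ 0 := sub_ne_zero.2 (ne_of_gt hx)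
  rw [htaylor]
  field_simp
  ring

/-- Derivative constraints at a common fixed point `q` of `C^r` diffeomorphisms `f, g`
of `[q, q₁)` satisfying `f ∘ g = g^λ ∘ f`, where `g` has no interior fixed point:
`g′(q) = 1`, and either `g` is `r`-flat at `q`, or `f′(q) = (1/λ)^(1/s)` for some
integer `1 ≤ s < r`, with `g^{(i)}(q) = 0` for `2 ≤ i ≤ s` and `g^{(s+1)}(q) ≠ 0`. -/
theorem deriv_constraints_at_fixed_point
    (r l : ℕ) (hr : 2 ≤ r) (hl : 2 ≤ l) (q q₁ : ℝ) (hq : q < q₁) (f g : ℝ → ℝ)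
    (hf : IsCrDiffeoOnIco r f q q₁) (hg : IsCrDiffeoOnIco r g q q₁)
    (hfq : f q = q) (hgq : g q = q)
    (hgfix : ∀ x ∈ Set.Ioo q q₁, g x ≠ x)
    (hrel : ∀ x ∈ Set.Ico q q₁, f (g x) = g^[l] (f x)) :
    derivWithin g (Set.Ico q q₁) q = 1 ∧
      ((∀ i : ℕ, 2 ≤ i → i ≤ r → iteratedDerivWithin i g (Set.Ico q q₁) q = 0) ∨
        (∃ s : ℕ, 1 ≤ s ∧ s < r ∧
          derivWithin f (Set.Ico q q₁) q = ((1 : ℝ) / l) ^ ((1 : ℝ) / s) ∧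
          (∀ i : ℕ, 2 ≤ i → i ≤ s → iteratedDerivWithin i g (Set.Ico q q₁) q = 0) ∧
          iteratedDerivWithin (s + 1) g (Set.Ico q q₁) q ≠ 0)) := by
  obtain ⟨hfb, hfc, hfpos⟩ := hf
  obtain ⟨hgb, hgc, hgpos⟩ := hg
  have hqS : q ∈ Ico q q₁ := left_mem_Ico.2 hq
  have hr1 : (1 : WithTop ℕ∞) ≤ (r : WithTop ℕ∞) := by exact_mod_cast one_le_two.trans hr
  have hr0 : (r : WithTop ℕ∞) ≠ 0 := by exact_mod_cast (by omega : r ≠ 0)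
  have hfd := (hfc.differentiableOn hr0 q hqS).hasDerivWithinAt
  have hgd := (hgc.differentiableOn hr0 q hqS).hasDerivWithinAt
  have hc := hfpos q hqS
  have hg1 : derivWithin g (Ico q q₁) q = 1 := by
    have h₁ : HasDerivWithinAt (f ∘ g) _ (Ico q q₁) q :=
      HasDerivWithinAt.comp q (by rwa [hgq]) hgd hgb.mapsTo
    have h₂ : HasDerivWithinAt (g^[l] ∘ f) _ (Ico q q₁) q :=
      HasDerivWithinAt.comp q (by rw [hfq]; exact hgd.iterate q hgq hgb.mapsTo l) hfd hfb.mapsTo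
    have heq := (uniqueDiffOn_Ico q q₁ q hqS).eq_deriv _ h₁
      (h₂.congr (fun x hx => hrel x hx) (hrel q hqS))
    have hpow : derivWithin g (Ico q q₁) q ^ (l - 1) = 1 := by
      obtain ⟨k, rfl⟩ := Nat.exists_eq_add_of_le' hl
      have hgp := hgpos q hqS
      rw [mul_comm, mul_left_inj' hc.ne', pow_succ] at heq
      exact (mul_right_cancel₀ hgp.ne' (by rw [one_mul]; exact heq)).symm
    exact (pow_eq_one_iff_of_nonneg (hgpos q hqS).le (by omega)).1 hpow
  refine ⟨hg1, or_iff_not_imp_left.2 fun hflat => ?_⟩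
  push Not at hflat
  classical
  obtain ⟨hm2, hmr, hma⟩ := Nat.find_spec hflat
  have hmin : ∀ i : ℕ, 2 ≤ i → i < Nat.find hflat →
      iteratedDerivWithin i g (Ico q q₁) q = 0 := fun i hi him => by
    by_contra hne
    exact Nat.find_min hflat him ⟨hi, by omega, hne⟩
  obtain ⟨s, hs⟩ := Nat.exists_eq_add_of_le' (one_le_two.trans hm2)
  rw [hs] at hm2 hmr hma hmin
  refine ⟨s, by omega, by omega, ?_, fun i hi his => hmin i hi (by omega), hma⟩
  have hnhds : Ico q q₁ ∈ 𝓝[>] q := Ico_mem_nhdsGT hq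
  have hiter : ∀ n : ℕ, HasDerivWithinAt g^[n] 1 (Ioi q) q := fun n => by
    have := (hgd.iterate q hgq hgb.mapsTo n).mono_of_mem_nhdsWithin hnhds
    rwa [hg1, one_pow] at this
  have hdisp := tendsto_displacement_of_contDiffOn hq hm2
    (hgc.of_le (by exact_mod_cast hmr)) hgq hg1 hmin
  have hleft := tendsto_image_displacement hq (hfc.of_le hr1)
    ((hiter 1).tendsto_nhdsGT_of_pos hgq one_pos) hdisp
  have hright := tendsto_displacement_comp (tendsto_displacement_iterate hdisp hgq hiter l)
    (hfd.mono_of_mem_nhdsWithin hnhds) hfq hc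
  have heq := tendsto_nhds_unique (hleft.congr' (by
    filter_upwards [hnhds] with x hx
    rw [Function.iterate_one, hrel x hx])) hright
  have ha : iteratedDerivWithin (s + 1) g (Ico q q₁) q / (s + 1).factorial ≠ 0 :=
    div_ne_zero hma (by positivity)
  have hl0 : (l : ℝ) ≠ 0 := by exact_mod_cast (by omega : l ≠ 0)
  have hpow : derivWithin f (Ico q q₁) q ^ s = 1 / l := by
    rw [eq_div_iff hl0]
    refine mul_right_cancel₀ (mul_ne_zero ha hc.ne') ?_
    rw [pow_succ] at heq
    linear_combination -heq
  rw [← hpow, one_div, Real.pow_rpow_inv_natCast hc.le (by omega)]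

end
end

section
/- Let λ ≥ 2 be an integer, let q < q₁ be reals, and let f, g be C^∞ diffeomorphisms of the half-open interval [q,q₁) fixing q, such that g has no fixed point in (q,q₁), f′(q) < 1, and f ∘ g = g^[λ] ∘ f on [q,q₁). Then there exists an integer s ≥ 1 with f′(q) = (1/λ)^{1/s}, and there exists a C^∞ diffeomorphism α from (q,q₁) onto ℝ (a smooth bijection with smooth inverse) such that α(g(p)) = α(p) + 1 and α(f(p)) = λ·α(p) for all p ∈ (q,q₁). -/
open Filter Set Topology
open scoped ContDiff

noncomputable section

/-- The `n`-th term of the Neumann series solving `ψ = c * ψ ∘ f + w`. -/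
def neumannTerm (f c w : ℝ → ℝ) : ℕ → ℝ → ℝ
  | 0 => w
  | n + 1 => fun x => c x * neumannTerm f c w n (f x)

lemma abs_neumannTerm_le {f c w : ℝ → ℝ} {K : Set ℝ} {ρ W : ℝ} (hfK : MapsTo f K K)
    (hc : ∀ x ∈ K, |c x| ≤ ρ) (hw : ∀ x ∈ K, |w x| ≤ W) (n : ℕ) :
    ∀ x ∈ K, |neumannTerm f c w n x| ≤ W * ρ ^ n := by
  induction n with
  | zero => simpa [neumannTerm] using hw
  | succ n ih =>
    intro x hx
    rw [neumannTerm, abs_mul, pow_succ]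
    calc |c x| * |neumannTerm f c w n (f x)| ≤ ρ * (W * ρ ^ n) :=
          mul_le_mul (hc x hx) (ih _ (hfK hx)) (abs_nonneg _) ((abs_nonneg _).trans (hc x hx))
      _ = W * (ρ ^ n * ρ) := by ring

lemma continuousOn_neumannTerm {f c w : ℝ → ℝ} {K : Set ℝ} (hfK : MapsTo f K K)
    (hf : ContinuousOn f K) (hc : ContinuousOn c K) (hw : ContinuousOn w K) (n : ℕ) :
    ContinuousOn (neumannTerm f c w n) K := by
  induction n with
  | zero => exact hw
  | succ n ih => exact hc.mul (ih.comp hf hfK)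

lemma contDiffOn_neumannTerm {f c w : ℝ → ℝ} {K : Set ℝ} {r : WithTop ℕ∞} (hfK : MapsTo f K K)
    (hf : ContDiffOn ℝ r f K) (hc : ContDiffOn ℝ r c K) (hw : ContDiffOn ℝ r w K) (n : ℕ) :
    ContDiffOn ℝ r (neumannTerm f c w n) K := by
  induction n with
  | zero => exact hw
  | succ n ih => exact hc.mul (ih.comp hf hfK)

lemma tsum_neumannTerm {f c w : ℝ → ℝ} {x : ℝ} (h : Summable fun n => neumannTerm f c w n x) :
    ∑' n, neumannTerm f c w n x = c x * (∑' n, neumannTerm f c w n (f x)) + w x := by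
  rw [h.tsum_eq_zero_add, ← tsum_mul_left, add_comm]
  rfl

/-- A bounded function multiplied by a uniform contraction along the orbits of `f` vanishes. -/
lemma eq_zero_of_eq_mul_comp {f c d : ℝ → ℝ} {K : Set ℝ} {ρ D : ℝ} (hfK : MapsTo f K K)
    (hρ : ρ < 1) (hc : ∀ x ∈ K, |c x| ≤ ρ) (hD : ∀ x ∈ K, |d x| ≤ D)
    (h : ∀ x ∈ K, d x = c x * d (f x)) {x : ℝ} (hx : x ∈ K) : d x = 0 := by
  have hρ0 : 0 ≤ ρ := (abs_nonneg _).trans (hc x hx)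
  have key : ∀ n : ℕ, ∀ x ∈ K, |d x| ≤ D * ρ ^ n := by
    intro n
    induction n with
    | zero => simpa using hD
    | succ n ih =>
      intro x hx
      rw [h x hx, abs_mul, pow_succ]
      calc |c x| * |d (f x)| ≤ ρ * (D * ρ ^ n) :=
            mul_le_mul (hc x hx) (ih _ (hfK hx)) (abs_nonneg _) hρ0
        _ = D * (ρ ^ n * ρ) := by ring
  have hlim : Tendsto (fun n : ℕ => D * ρ ^ n) atTop (𝓝 0) := by
    simpa using (tendsto_pow_atTop_nhds_zero_of_lt_one hρ0 hρ).const_mul D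
  exact abs_nonpos_iff.1 (ge_of_tendsto' hlim fun n => key n x hx)

lemma eqOn_of_cohomological_eq {f c w ψ₁ ψ₂ : ℝ → ℝ} {K : Set ℝ} {ρ D₁ D₂ : ℝ}
    (hfK : MapsTo f K K) (hρ : ρ < 1) (hc : ∀ x ∈ K, |c x| ≤ ρ)
    (hD₁ : ∀ x ∈ K, |ψ₁ x| ≤ D₁) (hD₂ : ∀ x ∈ K, |ψ₂ x| ≤ D₂)
    (h₁ : ∀ x ∈ K, ψ₁ x = c x * ψ₁ (f x) + w x)
    (h₂ : ∀ x ∈ K, ψ₂ x = c x * ψ₂ (f x) + w x) : EqOn ψ₁ ψ₂ K := by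
  intro x hx
  have := eq_zero_of_eq_mul_comp (d := fun x => ψ₁ x - ψ₂ x) (D := D₁ + D₂) hfK hρ hc
    (fun x hx => (abs_sub _ _).trans (add_le_add (hD₁ x hx) (hD₂ x hx)))
    (fun x hx => by rw [h₁ x hx, h₂ x hx]; ring) hx
  exact sub_eq_zero.1 this

lemma exists_abs_le_of_continuousOn {K : Set ℝ} (hK : IsCompact K) {u : ℝ → ℝ}
    (hu : ContinuousOn u K) : ∃ C, 0 ≤ C ∧ ∀ x ∈ K, |u x| ≤ C := by
  obtain ⟨C, hC⟩ := hK.exists_bound_of_continuousOn hu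
  exact ⟨max C 0, le_max_right _ _, fun x hx => (hC x hx).trans (le_max_left _ _)⟩

lemma exists_continuousOn_cohomological_eq {f c w : ℝ → ℝ} {K : Set ℝ} {ρ : ℝ}
    (hK : IsCompact K) (hfK : MapsTo f K K) (hρ0 : 0 ≤ ρ) (hρ : ρ < 1)
    (hcρ : ∀ x ∈ K, |c x| ≤ ρ)
    (hf : ContinuousOn f K) (hc : ContinuousOn c K) (hw : ContinuousOn w K) :
    ContinuousOn (fun x => ∑' n, neumannTerm f c w n x) K ∧
      ∀ x ∈ K, ∑' n, neumannTerm f c w n x = c x * (∑' n, neumannTerm f c w n (f x)) + w x := by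
  obtain ⟨W, -, hW⟩ := exists_abs_le_of_continuousOn hK hw
  have hs : Summable fun n : ℕ => W * ρ ^ n :=
    (summable_geometric_of_lt_one hρ0 hρ).mul_left W
  have hb := abs_neumannTerm_le hfK hcρ hW
  refine ⟨continuousOn_tsum (continuousOn_neumannTerm hfK hf hc hw) hs fun n x hx => hb n x hx,
    fun x hx => tsum_neumannTerm (Summable.of_norm_bounded hs fun n => hb n x hx)⟩

/-- Term-by-term differentiation of a series on a compact interval, one-sided at the ends. -/
lemma hasDerivWithinAt_tsum_Icc {a b : ℝ} (hab : a < b) {u u' : ℕ → ℝ → ℝ} {s : ℕ → ℝ}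
    (hs : Summable s) (hu : ∀ n, ∀ x ∈ Icc a b, HasDerivWithinAt (u n) (u' n x) (Icc a b) x)
    (hu' : ∀ n, ContinuousOn (u' n) (Icc a b)) (hus : ∀ n, ∀ x ∈ Icc a b, |u n x| ≤ s n)
    (hus' : ∀ n, ∀ x ∈ Icc a b, |u' n x| ≤ s n) {x : ℝ} (hx : x ∈ Icc a b) :
    HasDerivWithinAt (fun y => ∑' n, u n y) (∑' n, u' n x) (Icc a b) x := by
  have hsum : ∀ y ∈ Icc a b, Summable fun n => u n y :=
    fun y hy => Summable.of_norm_bounded hs fun n => hus n y hy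
  have hcont : ContinuousOn (fun y => ∑' n, u n y) (Icc a b) :=
    continuousOn_tsum (fun n y hy => (hu n y hy).continuousWithinAt) hs fun n y hy => hus n y hy
  have hcont' : ContinuousOn (fun y => ∑' n, u' n y) (Icc a b) :=
    continuousOn_tsum hu' hs fun n y hy => hus' n y hy
  have hint : ∀ y ∈ Ioo a b, HasDerivAt (fun y => ∑' n, u n y) (∑' n, u' n y) y := by
    intro y hy
    exact hasDerivAt_tsum_of_isPreconnected hs isOpen_Ioo isPreconnected_Ioo
      (fun n z hz => (hu n z (Ioo_subset_Icc_self hz)).hasDerivAt (Icc_mem_nhds hz.1 hz.2))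
      (fun n z hz => hus' n z (Ioo_subset_Icc_self hz)) hy (hsum y (Ioo_subset_Icc_self hy)) hy
  have hcl : closure (Ioo a b) = Icc a b := closure_Ioo hab.ne
  have := hasFDerivWithinAt_closure_of_tendsto_fderiv (f := fun y => ∑' n, u n y) (x := x)
    (f' := ContinuousLinearMap.toSpanSingleton ℝ (∑' n, u' n x))
    (fun y hy => (hint y hy).differentiableAt.differentiableWithinAt) (convex_Ioo a b) isOpen_Ioo
    (by rw [hcl]; exact fun y hy => (hcont y hy).mono Ioo_subset_Icc_self) ?_
  · rw [hcl] at this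
    exact this.hasDerivWithinAt.congr_deriv (by simp)
  · have h1 : Tendsto (fun y => ContinuousLinearMap.toSpanSingleton ℝ (∑' n, u' n y))
        (𝓝[Ioo a b] x) (𝓝 (ContinuousLinearMap.toSpanSingleton ℝ (∑' n, u' n x))) := by
      have h2 : Continuous fun y : ℝ => ContinuousLinearMap.toSpanSingleton ℝ y :=
        (ContinuousLinearMap.toSpanSingletonCLE (𝕜 := ℝ) (E := ℝ)).continuous
      exact (h2.tendsto _).comp ((hcont' x hx).mono Ioo_subset_Icc_self)
    refine h1.congr' ?_
    filter_upwards [self_mem_nhdsWithin] with y hy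
    exact (hint y hy).hasFDerivAt.fderiv.symm

lemma exists_differentiableOn_cohomological_eq {f c w : ℝ → ℝ} {a b ρ : ℝ} (hab : a < b)
    (hfK : MapsTo f (Icc a b) (Icc a b)) (hρ0 : 0 ≤ ρ) (hρ : ρ < 1)
    (hcρ : ∀ x ∈ Icc a b, |c x| ≤ ρ) (hf' : ∀ x ∈ Icc a b, |derivWithin f (Icc a b) x| ≤ 1)
    (hf : ContDiffOn ℝ 1 f (Icc a b)) (hc : ContDiffOn ℝ 1 c (Icc a b))
    (hw : ContDiffOn ℝ 1 w (Icc a b)) :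
    ∃ D, ∀ x ∈ Icc a b, ∃ d, |d| ≤ D ∧
      HasDerivWithinAt (fun y => ∑' n, neumannTerm f c w n y) d (Icc a b) x := by
  set K := Icc a b with hK
  have hKu : UniqueDiffOn ℝ K := uniqueDiffOn_Icc hab
  obtain ⟨W, hW0, hW⟩ := exists_abs_le_of_continuousOn isCompact_Icc hw.continuousOn
  obtain ⟨W', hW'0, hW'⟩ := exists_abs_le_of_continuousOn isCompact_Icc
    (hw.continuousOn_derivWithin hKu le_rfl)
  obtain ⟨M, hM0, hM⟩ := exists_abs_le_of_continuousOn isCompact_Icc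
    (hc.continuousOn_derivWithin hKu le_rfl)
  have ht := contDiffOn_neumannTerm hfK hf hc hw
  have htd : ∀ n, ∀ x ∈ K, HasDerivWithinAt (neumannTerm f c w n)
      (derivWithin (neumannTerm f c w n) K x) K x := fun n x hx =>
    ((ht n).differentiableOn one_ne_zero x hx).hasDerivWithinAt
  have hb := abs_neumannTerm_le hfK hcρ hW
  obtain ⟨σ, hρσ, hσ⟩ := exists_between hρ
  have hσ0 : 0 ≤ σ := hρ0.trans hρσ.le
  set A := max W (max W' (M * W / (σ - ρ))) with hA
  have hA1 : W ≤ A := le_max_left _ _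
  have hA2 : W' ≤ A := (le_max_left _ _).trans (le_max_right _ _)
  have hA3 : M * W ≤ A * (σ - ρ) :=
    (div_le_iff₀ (sub_pos.2 hρσ)).1 ((le_max_right _ _).trans (le_max_right _ _))
  have hA0 : 0 ≤ A := hW0.trans hA1
  have hb1 : ∀ n, ∀ x ∈ K, |neumannTerm f c w n x| ≤ A * σ ^ n := fun n x hx =>
    (hb n x hx).trans (mul_le_mul hA1 (pow_le_pow_left₀ hρ0 hρσ.le n) (by positivity) hA0)
  have hb2 : ∀ n, ∀ x ∈ K, |derivWithin (neumannTerm f c w n) K x| ≤ A * σ ^ n := by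
    intro n
    induction n with
    | zero => intro x hx; simpa [neumannTerm] using (hW' x hx).trans hA2
    | succ n ih =>
      intro x hx
      have hd : HasDerivWithinAt (neumannTerm f c w (n + 1))
          (derivWithin c K x * neumannTerm f c w n (f x) +
            c x * (derivWithin (neumannTerm f c w n) K (f x) * derivWithin f K x)) K x :=
        ((hc.differentiableOn one_ne_zero x hx).hasDerivWithinAt).mul
          ((htd n (f x) (hfK hx)).comp x
            (hf.differentiableOn one_ne_zero x hx).hasDerivWithinAt hfK)
      rw [hd.derivWithin (hKu x hx)]
      have e1 : |derivWithin c K x * neumannTerm f c w n (f x)| ≤ M * (W * σ ^ n) := by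
        rw [abs_mul]
        refine mul_le_mul (hM x hx) ((hb n _ (hfK hx)).trans ?_) (abs_nonneg _) hM0
        exact mul_le_mul_of_nonneg_left (pow_le_pow_left₀ hρ0 hρσ.le n) hW0
      have e2 : |c x * (derivWithin (neumannTerm f c w n) K (f x) * derivWithin f K x)|
          ≤ ρ * (A * σ ^ n * 1) := by
        rw [abs_mul, abs_mul]
        exact mul_le_mul (hcρ x hx) (mul_le_mul (ih _ (hfK hx)) (hf' x hx) (abs_nonneg _)
          (by positivity)) (by positivity) hρ0
      calc _ ≤ M * (W * σ ^ n) + ρ * (A * σ ^ n * 1) := (abs_add_le _ _).trans (add_le_add e1 e2)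
        _ = (M * W + ρ * A) * σ ^ n := by ring
        _ ≤ (A * σ) * σ ^ n := by
            refine mul_le_mul_of_nonneg_right ?_ (by positivity)
            linarith
        _ = A * σ ^ (n + 1) := by ring
  have hs : Summable fun n : ℕ => A * σ ^ n := (summable_geometric_of_lt_one hσ0 hσ).mul_left A
  refine ⟨∑' n, A * σ ^ n, fun x hx => ⟨∑' n, derivWithin (neumannTerm f c w n) K x, ?_, ?_⟩⟩
  · exact tsum_of_norm_bounded (f := fun n => derivWithin (neumannTerm f c w n) K x) hs.hasSum
      fun n => hb2 n x hx
  · exact hasDerivWithinAt_tsum_Icc hab hs htd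
      (fun n => (ht n).continuousOn_derivWithin hKu le_rfl) hb1 hb2 hx

/-- Bounded solutions of `ψ = c * ψ ∘ f + w` on a compact interval, where `f` is non-expanding and
`|c| ≤ ρ < 1`, are as smooth as the data. -/
lemma contDiffOn_of_cohomological_eq {f : ℝ → ℝ} {a b ρ : ℝ} (hab : a < b)
    (hfK : MapsTo f (Icc a b) (Icc a b)) (hρ0 : 0 ≤ ρ) (hρ : ρ < 1)
    (hf' : ∀ x ∈ Icc a b, |derivWithin f (Icc a b) x| ≤ 1)
    (hf : ContDiffOn ℝ ∞ f (Icc a b)) (k : ℕ) :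
    ∀ c w ψ : ℝ → ℝ, ∀ D : ℝ, (∀ x ∈ Icc a b, |c x| ≤ ρ) → ContDiffOn ℝ k c (Icc a b) →
      ContDiffOn ℝ k w (Icc a b) → (∀ x ∈ Icc a b, |ψ x| ≤ D) →
      (∀ x ∈ Icc a b, ψ x = c x * ψ (f x) + w x) → ContDiffOn ℝ k ψ (Icc a b) := by
  have hKu : UniqueDiffOn ℝ (Icc a b) := uniqueDiffOn_Icc hab
  induction k with
  | zero =>
    intro c w ψ D hcρ hc hw hD hψ
    obtain ⟨h1, h2⟩ := exists_continuousOn_cohomological_eq isCompact_Icc hfK hρ0 hρ hcρ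
      hf.continuousOn hc.continuousOn hw.continuousOn
    obtain ⟨D', -, hD'⟩ := exists_abs_le_of_continuousOn isCompact_Icc h1
    simpa [contDiffOn_zero] using
      h1.congr (eqOn_of_cohomological_eq hfK hρ hcρ hD hD' hψ h2)
  | succ k ih =>
    intro c w ψ D hcρ hc hw hD hψ
    have hk : ContDiffOn ℝ k ψ (Icc a b) := ih c w ψ D hcρ (hc.of_le (by simp))
      (hw.of_le (by simp)) hD hψ
    have h1k : (1 : WithTop ℕ∞) ≤ ((k + 1 : ℕ) : WithTop ℕ∞) := by simp
    obtain ⟨h1, h2⟩ := exists_continuousOn_cohomological_eq isCompact_Icc hfK hρ0 hρ hcρ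
      hf.continuousOn hc.continuousOn hw.continuousOn
    obtain ⟨D', -, hD'⟩ := exists_abs_le_of_continuousOn isCompact_Icc h1
    have heq := eqOn_of_cohomological_eq hfK hρ hcρ hD hD' hψ h2
    obtain ⟨E, hE⟩ := exists_differentiableOn_cohomological_eq hab hfK hρ0 hρ hcρ hf'
      (hf.of_le (by simp)) (hc.of_le h1k) (hw.of_le h1k)
    have hdiff : DifferentiableOn ℝ ψ (Icc a b) := fun x hx => by
      obtain ⟨d, -, hd⟩ := hE x hx
      exact (hd.congr_of_mem heq hx).differentiableWithinAt
    have hbd : ∀ x ∈ Icc a b, |derivWithin ψ (Icc a b) x| ≤ E := fun x hx => by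
      obtain ⟨d, hdE, hd⟩ := hE x hx
      rwa [(hd.congr_of_mem heq hx).derivWithin (hKu x hx)]
    have hcd := (contDiffOn_succ_iff_derivWithin (n := k) hKu).1 (by exact_mod_cast hc)
    have hwd := (contDiffOn_succ_iff_derivWithin (n := k) hKu).1 (by exact_mod_cast hw)
    have hfd := (contDiffOn_infty_iff_derivWithin hKu).1 hf
    have hk_le : (k : WithTop ℕ∞) ≤ ∞ := by exact_mod_cast le_top
    have key : ContDiffOn ℝ k (derivWithin ψ (Icc a b)) (Icc a b) := by
      refine ih (fun x => c x * derivWithin f (Icc a b) x)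
        (fun x => derivWithin c (Icc a b) x * ψ (f x) + derivWithin w (Icc a b) x) _ E
        (fun x hx => ?_) ((hc.of_le (by simp)).mul (hfd.2.of_le hk_le))
        ((hcd.2.2.mul (hk.comp (hf.of_le hk_le) hfK)).add hwd.2.2) hbd fun x hx => ?_
      · rw [abs_mul]
        simpa using mul_le_mul (hcρ x hx) (hf' x hx) (abs_nonneg _) hρ0
      · have hd : HasDerivWithinAt (fun y => c y * ψ (f y) + w y) _ (Icc a b) x :=
          ((hcd.1 x hx).hasDerivWithinAt.mul
          ((hdiff (f x) (hfK hx)).hasDerivWithinAt.comp x (hfd.1 x hx).hasDerivWithinAt hfK)).add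
          (hwd.1 x hx).hasDerivWithinAt
        rw [(hd.congr_of_mem hψ hx).derivWithin (hKu x hx)]
        simp only [Function.comp_apply]
        ring
    have := (contDiffOn_succ_iff_derivWithin (n := k) hKu).2
      ⟨hdiff, fun h => by simp at h, key⟩
    exact_mod_cast this

/-- One-sided linearization of a smooth contraction at its fixed point `a`. -/
lemma exists_linearization {f : ℝ → ℝ} {a b ρ : ℝ} (hab : a < b)
    (hfK : MapsTo f (Icc a b) (Icc a b)) (hfa : f a = a) (hρ : ρ < 1)
    (hf : ContDiffOn ℝ ∞ f (Icc a b))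
    (hf' : ∀ x ∈ Icc a b, 0 < derivWithin f (Icc a b) x)
    (hf'ρ : ∀ x ∈ Icc a b, derivWithin f (Icc a b) x ≤ ρ) :
    ∃ h : ℝ → ℝ, h a = 0 ∧ HasStrictDerivAt h 1 a ∧ StrictMono h ∧
      (∀ x ∈ Icc a b, h (f x) = derivWithin f (Icc a b) a * h x) ∧
      ContDiffOn ℝ ∞ h (Ioo a b) ∧ ∀ x, 0 < deriv h x := by
  have hKu : UniqueDiffOn ℝ (Icc a b) := uniqueDiffOn_Icc hab
  have haK : a ∈ Icc a b := left_mem_Icc.2 hab.le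
  have hρ0 : 0 ≤ ρ := (hf' a haK).le.trans (hf'ρ a haK)
  set F := derivWithin f (Icc a b) with hF
  have hfd := (contDiffOn_infty_iff_derivWithin hKu).1 hf
  have hFc : ContDiffOn ℝ ∞ F (Icc a b) := hfd.2
  have hcρ : ∀ x ∈ Icc a b, |F x| ≤ ρ := fun x hx => by
    rw [abs_of_pos (hf' x hx)]; exact hf'ρ x hx
  set v : ℝ → ℝ := fun x => Real.log (F x) with hv
  have hvc : ContDiffOn ℝ ∞ v (Icc a b) := hFc.log fun x hx => (hf' x hx).ne'
  have hvd := (contDiffOn_infty_iff_derivWithin hKu).1 hvc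
  obtain ⟨hχc, hχ⟩ := exists_continuousOn_cohomological_eq isCompact_Icc hfK hρ0 hρ hcρ
    hf.continuousOn hFc.continuousOn hvd.2.continuousOn
  set χ : ℝ → ℝ := fun x => ∑' n, neumannTerm f F (derivWithin v (Icc a b)) n x with hχdef
  obtain ⟨D, -, hD⟩ := exists_abs_le_of_continuousOn isCompact_Icc hχc
  have hχs : ContDiffOn ℝ ∞ χ (Icc a b) := contDiffOn_infty.2 fun k =>
    contDiffOn_of_cohomological_eq hab hfK hρ0 hρ
      (fun x hx => (hcρ x hx).trans hρ.le) hf k F _ χ D hcρ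
      (contDiffOn_infty.1 hFc k) (contDiffOn_infty.1 hvd.2 k) hD hχ
  set X : ℝ → ℝ := IccExtend hab.le ((Icc a b).domRestrict χ) with hX
  have hXc : Continuous X := (continuousOn_iff_continuous_domRestrict.1 hχc).Icc_extend'
  have hXχ : ∀ x ∈ Icc a b, X x = χ x := fun x hx => IccExtend_of_mem hab.le _ hx
  set φ : ℝ → ℝ := fun x => ∫ t in a..x, X t with hφ
  have hφd : ∀ x, HasDerivAt φ (X x) x := fun x =>
    intervalIntegral.integral_hasDerivAt_right (hXc.intervalIntegrable _ _)
      hXc.aestronglyMeasurable.stronglyMeasurableAtFilter hXc.continuousAt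
  have hφa : φ a = 0 := intervalIntegral.integral_same
  have hφc : Continuous φ := continuous_iff_continuousAt.2 fun x => (hφd x).continuousAt
  have hec : Continuous fun x => Real.exp (φ x) := Real.continuous_exp.comp hφc
  set h : ℝ → ℝ := fun x => ∫ t in a..x, Real.exp (φ t) with hh
  have hhd : ∀ x, HasDerivAt h (Real.exp (φ x)) x := fun x =>
    intervalIntegral.integral_hasDerivAt_right (hec.intervalIntegrable _ _)
      hec.aestronglyMeasurable.stronglyMeasurableAtFilter hec.continuousAt
  have hderiv : deriv h = fun x => Real.exp (φ x) := funext fun x => (hhd x).deriv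
  have hha : h a = 0 := intervalIntegral.integral_same
  have hpos : ∀ x, 0 < deriv h x := fun x => by rw [hderiv]; exact Real.exp_pos _
  have hφf : ∀ x ∈ Icc a b, φ (f x) + v x = φ x + v a := by
    have hd : ∀ x ∈ Icc a b, HasDerivWithinAt (fun x => φ (f x) + v x - φ x) 0 (Icc a b) x := by
      intro x hx
      have := (((hφd (f x)).comp_hasDerivWithinAt x (hfd.1 x hx).hasDerivWithinAt).add
        (hvd.1 x hx).hasDerivWithinAt).sub (hφd x).hasDerivWithinAt
      refine this.congr_deriv ?_
      have e : χ x = F x * χ (f x) + derivWithin v (Icc a b) x := hχ x hx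
      rw [hXχ _ (hfK hx), hXχ x hx, e]
      ring
    intro x hx
    have := constant_of_derivWithin_zero (fun x hx => (hd x hx).differentiableWithinAt)
      (fun x hx => (hd x (Ico_subset_Icc_self hx)).derivWithin
        (hKu x (Ico_subset_Icc_self hx))) x hx
    simp only [hfa, hφa] at this
    linarith
  refine ⟨h, hha, ?_, strictMono_of_deriv_pos hpos, ?_, ?_, hpos⟩
  · have hC1 : ContDiff ℝ 1 h := contDiff_one_iff_deriv.2
      ⟨fun x => (hhd x).differentiableAt, by rw [hderiv]; exact hec⟩
    have := hC1.contDiffAt.hasStrictDerivAt (x := a) one_ne_zero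
    simpa [hderiv, hφa] using this
  · have hd : ∀ x ∈ Icc a b, HasDerivWithinAt (fun x => h (f x) - F a * h x) 0 (Icc a b) x := by
      intro x hx
      have := ((hhd (f x)).comp_hasDerivWithinAt x (hfd.1 x hx).hasDerivWithinAt).sub
        ((hhd x).const_mul (F a)).hasDerivWithinAt
      refine this.congr_deriv ?_
      have e := congrArg Real.exp (hφf x hx)
      rw [Real.exp_add, Real.exp_add, Real.exp_log (hf' x hx), Real.exp_log (hf' a haK)] at e
      change Real.exp (φ (f x)) * F x - F a * Real.exp (φ x) = 0
      linarith
    intro x hx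
    have := constant_of_derivWithin_zero (fun x hx => (hd x hx).differentiableWithinAt)
      (fun x hx => (hd x (Ico_subset_Icc_self hx)).derivWithin
        (hKu x (Ico_subset_Icc_self hx))) x hx
    simp only [hfa, hha] at this
    linarith
  · rw [contDiffOn_infty_iff_deriv_of_isOpen isOpen_Ioo]
    refine ⟨fun x _ => (hhd x).differentiableAt.differentiableWithinAt, ?_⟩
    rw [hderiv]
    refine ContDiffOn.exp ?_
    rw [contDiffOn_infty_iff_deriv_of_isOpen isOpen_Ioo]
    refine ⟨fun x _ => (hφd x).differentiableAt.differentiableWithinAt, ?_⟩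
    refine (hχs.mono Ioo_subset_Icc_self).congr fun x hx => ?_
    rw [(hφd x).deriv, hXχ x (Ioo_subset_Icc_self hx)]

lemma tendsto_div_pow_mul_sub_of_semiconj {f G A : ℝ → ℝ} {q r d : ℝ} {l : ℕ} {J : Set ℝ}
    (hl : l ≠ 0) (hJ : ∀ x ∈ J, q < x) (hfJ : MapsTo f J J) (hGJ : MapsTo G J J)
    (hGlt : ∀ x ∈ J, G x < x)
    (hflim : ∀ x ∈ J, Tendsto (fun n => f^[n] x) atTop (𝓝 q))
    (hrel : ∀ x ∈ J, f (G x) = G^[l] (f x)) (hA : ∀ x ∈ J, A (f x) = r * A x)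
    (hd : Tendsto (fun x => A (G x) - A x) (𝓝[>] q) (𝓝 d)) {x : ℝ} (hx : x ∈ J) :
    Tendsto (fun n : ℕ => (r / l) ^ n * (A (G x) - A x)) atTop (𝓝 d) := by
  have hfn : ∀ n : ℕ, MapsTo f^[n] J J := fun n => hfJ.iterate n
  have hGn : ∀ n : ℕ, MapsTo G^[n] J J := fun n => hGJ.iterate n
  have hGle : ∀ n : ℕ, ∀ y ∈ J, G^[n] y ≤ y := by
    intro n
    induction n with
    | zero => simp
    | succ n ih =>
      intro y hy
      rw [Function.iterate_succ_apply']
      exact (hGlt _ (hGn n hy)).le.trans (ih y hy)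
  have hrel1 : ∀ n : ℕ, ∀ y ∈ J, f (G^[n] y) = G^[l * n] (f y) := by
    intro n
    induction n with
    | zero => simp
    | succ n ih =>
      intro y hy
      rw [Function.iterate_succ_apply', hrel _ (hGn n hy), ih y hy, ← Function.iterate_add_apply]
      congr 1
      ring_nf
  have hrel2 : ∀ n : ℕ, f^[n] (G x) = G^[l ^ n] (f^[n] x) := by
    intro n
    induction n with
    | zero => simp
    | succ n ih =>
      rw [Function.iterate_succ_apply', ih, hrel1 _ _ (hfn n hx), Function.iterate_succ_apply',
        pow_succ, mul_comm]
  have hAn : ∀ n : ℕ, ∀ y ∈ J, A (f^[n] y) = r ^ n * A y := by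
    intro n
    induction n with
    | zero => simp
    | succ n ih =>
      intro y hy
      rw [Function.iterate_succ_apply', hA _ (hfn n hy), ih y hy]
      ring
  have hl0 : (0 : ℝ) < l := by exact_mod_cast Nat.pos_of_ne_zero hl
  rw [Metric.tendsto_atTop]
  intro ε hε
  rw [Metric.tendsto_nhds] at hd
  obtain ⟨η, hη, hηδ⟩ := mem_nhdsGT_iff_exists_Ioo_subset.1 (hd (ε / 2) (half_pos hε))
  obtain ⟨N, hN⟩ := eventually_atTop.1 ((hflim x hx).eventually (gt_mem_nhds hη))
  refine ⟨N, fun n hn => ?_⟩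
  set y := f^[n] x with hy
  have hyJ : y ∈ J := hfn n hx
  have hyη : y < η := hN n hn
  have hsum : r ^ n * (A (G x) - A x) =
      ∑ i ∈ Finset.range (l ^ n), (A (G (G^[i] y)) - A (G^[i] y)) := by
    have := Finset.sum_range_sub (fun i => A (G^[i] y)) (l ^ n)
    simp only [Function.iterate_succ_apply', Function.iterate_zero_apply] at this
    rw [this, ← hrel2, hAn n _ (hGJ hx), hy, hAn n _ hx]
    ring
  have hbound : |r ^ n * (A (G x) - A x) - (l : ℝ) ^ n * d| ≤ (l : ℝ) ^ n * (ε / 2) := by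
    have e : r ^ n * (A (G x) - A x) - (l : ℝ) ^ n * d =
        ∑ i ∈ Finset.range (l ^ n), (A (G (G^[i] y)) - A (G^[i] y) - d) := by
      rw [hsum, Finset.sum_sub_distrib (g := fun _ => d)]
      simp
    rw [e]
    refine (Finset.abs_sum_le_sum_abs _ _).trans ?_
    refine (Finset.sum_le_card_nsmul _ _ (ε / 2) fun i _ => ?_).trans (by simp)
    have := hηδ ⟨hJ _ (hGn i hyJ), (hGle i y hyJ).trans_lt hyη⟩
    exact le_of_lt this
  have hln : (0 : ℝ) < (l : ℝ) ^ n := by positivity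
  rw [Real.dist_eq]
  have e : (r / l) ^ n * (A (G x) - A x) - d =
      (r ^ n * (A (G x) - A x) - (l : ℝ) ^ n * d) / (l : ℝ) ^ n := by
    rw [div_pow]; field_simp
  rw [e, abs_div, abs_of_pos hln, div_lt_iff₀ hln]
  nlinarith

lemma eq_one_and_eq_of_tendsto_pow_mul {r c d : ℝ} (hd : d ≠ 0)
    (h : Tendsto (fun n : ℕ => r ^ n * c) atTop (𝓝 d)) : r = 1 ∧ c = d := by
  have h1 : Tendsto (fun n : ℕ => r ^ (n + 1) * c) atTop (𝓝 d) :=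
    h.comp (tendsto_add_atTop_nat 1)
  have h2 : Tendsto (fun n : ℕ => r ^ (n + 1) * c) atTop (𝓝 (r * d)) :=
    (h.const_mul r).congr fun n => by ring
  have hr : r = 1 := by
    have := tendsto_nhds_unique h2 h1
    exact mul_right_cancel₀ hd (by linarith)
  subst hr
  refine ⟨rfl, tendsto_nhds_unique ?_ h⟩
  simp

/-- If `G x - x ∼ p (x - q) ^ (s + 1)` then `h ^ (-s)` is asymptotically translated by `-s p`,
where `h` is a coordinate tangent to `x - q`. -/
lemma tendsto_inv_pow_sub {h G : ℝ → ℝ} {q p : ℝ} {s : ℕ} (hs : 1 ≤ s) (hq : h q = 0)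
    (hmono : StrictMono h) (hh : HasStrictDerivAt h 1 q) (hG : ∀ᶠ x in 𝓝[>] q, G x ∈ Ioo q x)
    (hp : Tendsto (fun x => (G x - x) / (x - q) ^ (s + 1)) (𝓝[>] q) (𝓝 p)) :
    Tendsto (fun x => (h (G x) ^ s)⁻¹ - (h x ^ s)⁻¹) (𝓝[>] q) (𝓝 (-(s * p))) := by
  have hid : Tendsto (fun x : ℝ => x) (𝓝[>] q) (𝓝 q) := tendsto_nhdsWithin_of_tendsto_nhds tendsto_id
  have hGq : Tendsto G (𝓝[>] q) (𝓝 q) :=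
    tendsto_of_tendsto_of_tendsto_of_le_of_le' tendsto_const_nhds hid
      (hG.mono fun x hx => hx.1.le) (hG.mono fun x hx => hx.2.le)
  have hequiv1 : Asymptotics.IsEquivalent (𝓝[>] q) (fun x => h (G x) - h x) (fun x => G x - x) := by
    have := hh.isLittleO.comp_tendsto (hGq.prodMk_nhds hid)
    simpa [Asymptotics.IsEquivalent, Function.comp_def, Pi.sub_def] using this
  have hequiv2 : Asymptotics.IsEquivalent (𝓝[>] q) h (fun x => x - q) := by
    have := hh.hasDerivAt.isLittleO.mono (nhdsWithin_le_nhds (s := Ioi q))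
    simpa [Asymptotics.IsEquivalent, Function.comp_def, Pi.sub_def, hq] using this
  have hT : Tendsto (fun x => (h (G x) - h x) / h x ^ (s + 1)) (𝓝[>] q) (𝓝 p) :=
    (hequiv1.div (hequiv2.pow (s + 1))).symm.tendsto_nhds hp
  have hh0 : Tendsto h (𝓝[>] q) (𝓝 0) := by
    have := hh.hasDerivAt.continuousAt.tendsto.comp hid
    rwa [hq] at this
  have hpos : ∀ᶠ x in 𝓝[>] q, 0 < h x ∧ 0 < h (G x) := by
    filter_upwards [hG, self_mem_nhdsWithin] with x hx hx'
    rw [← hq]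
    exact ⟨hmono hx', hmono hx.1⟩
  have hR : Tendsto (fun x => h (G x) / h x) (𝓝[>] q) (𝓝 1) := by
    have h1 : Tendsto (fun x => (h (G x) - h x) / h x ^ (s + 1) * h x ^ s + 1) (𝓝[>] q)
        (𝓝 (p * 0 ^ s + 1)) := (hT.mul (hh0.pow s)).add_const 1
    rw [zero_pow (by lia), mul_zero, zero_add] at h1
    refine h1.congr' ?_
    filter_upwards [hpos] with x hx
    have := hx.1.ne'
    field_simp
    ring
  have hS : Tendsto (fun x => -((h (G x) - h x) / h x ^ (s + 1) *
      (∑ i ∈ Finset.range s, (h (G x) / h x) ^ i) * ((h (G x) / h x) ^ s)⁻¹)) (𝓝[>] q)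
      (𝓝 (-(p * (∑ i ∈ Finset.range s, (1 : ℝ) ^ i) * ((1 : ℝ) ^ s)⁻¹))) :=
    ((hT.mul (tendsto_finsetSum _ fun i _ => hR.pow i)).mul
      ((hR.pow s).inv₀ (by simp))).neg
  have e : -(p * (∑ i ∈ Finset.range s, (1 : ℝ) ^ i) * ((1 : ℝ) ^ s)⁻¹) = -(s * p) := by
    simp [mul_comm]
  rw [e] at hS
  refine hS.congr' ?_
  filter_upwards [hpos] with x hx
  have hX := hx.1.ne'
  have hY := hx.2.ne'
  have hgeom := geom_sum_mul (h (G x) / h x) s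
  have e1 : (h (G x) - h x) / h x ^ (s + 1) = (h (G x) / h x - 1) * (h x ^ s)⁻¹ := by
    field_simp
    ring
  rw [e1]
  calc _ = -(((∑ i ∈ Finset.range s, (h (G x) / h x) ^ i) * (h (G x) / h x - 1)) * (h x ^ s)⁻¹ *
        ((h (G x) / h x) ^ s)⁻¹) := by ring
    _ = _ := by
      rw [hgeom, div_pow]
      field_simp
      ring

/-- `G` is either infinitely tangent to the identity on the right of `q`, or has a finite order
of tangency `s + 1` with `s ≥ 1`. -/
def HasTangencyOrder (G : ℝ → ℝ) (q : ℝ) : Prop :=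
  (∃ s : ℕ, 1 ≤ s ∧ ∃ p : ℝ, p ≠ 0 ∧
    Tendsto (fun x => (G x - x) / (x - q) ^ (s + 1)) (𝓝[>] q) (𝓝 p)) ∨
  ∀ s : ℕ, 1 ≤ s → Tendsto (fun x => (G x - x) / (x - q) ^ (s + 1)) (𝓝[>] q) (𝓝 0)

/-- In a linearizing coordinate `h` of `f`, some power `h ^ (-s)` is translated by `G`. -/
lemma exists_inv_pow_sub_eq {f G h : ℝ → ℝ} {q b μ : ℝ} {l : ℕ} (hqb : q < b)
    (hl : l ≠ 0) (hμ0 : 0 < μ) (hμ1 : μ < 1) (hfJ : MapsTo f (Ioo q b) (Ioo q b))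
    (hflim : ∀ x ∈ Ioo q b, Tendsto (fun n => f^[n] x) atTop (𝓝 q))
    (hG : ∀ x ∈ Ioo q b, G x ∈ Ioo q x)
    (hrel : ∀ x ∈ Ioo q b, f (G x) = G^[l] (f x)) (hq : h q = 0)
    (hmono : StrictMono h) (hh : HasStrictDerivAt h 1 q)
    (hhf : ∀ x ∈ Ioo q b, h (f x) = μ * h x) (hord : HasTangencyOrder G q) :
    ∃ s : ℕ, 1 ≤ s ∧ μ ^ s * l = 1 ∧ ∃ d : ℝ, 0 < d ∧
      ∀ x ∈ Ioo q b, (h (G x) ^ s)⁻¹ - (h x ^ s)⁻¹ = d := by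
  have hl0 : (0 : ℝ) < l := by exact_mod_cast Nat.pos_of_ne_zero hl
  have hGJ : MapsTo G (Ioo q b) (Ioo q b) := fun x hx =>
    ⟨(hG x hx).1, (hG x hx).2.trans hx.2⟩
  have hGev : ∀ᶠ x in 𝓝[>] q, G x ∈ Ioo q x := by
    filter_upwards [Ioo_mem_nhdsGT hqb] with x hx using hG x hx
  have hpos : ∀ x ∈ Ioo q b, ∀ s : ℕ, 1 ≤ s → 0 < (h (G x) ^ s)⁻¹ - (h x ^ s)⁻¹ := by
    intro x hx s hs
    have h1 : 0 < h (G x) := hq ▸ hmono (hG x hx).1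
    have h2 : h (G x) < h x := hmono (hG x hx).2
    rw [sub_pos]
    exact inv_strictAnti₀ (by positivity) (pow_lt_pow_left₀ h2 h1.le (by lia))
  have main : ∀ s : ℕ, 1 ≤ s → ∀ p : ℝ,
      Tendsto (fun x => (G x - x) / (x - q) ^ (s + 1)) (𝓝[>] q) (𝓝 p) → ∀ x ∈ Ioo q b,
      Tendsto (fun n : ℕ => ((μ ^ s)⁻¹ / l) ^ n * ((h (G x) ^ s)⁻¹ - (h x ^ s)⁻¹)) atTop
        (𝓝 (-(s * p))) := by
    intro s hs p hp x hx
    refine tendsto_div_pow_mul_sub_of_semiconj (A := fun x => (h x ^ s)⁻¹) hl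
      (fun x hx => hx.1) hfJ hGJ (fun x hx => (hG x hx).2) hflim hrel (fun y hy => ?_)
      (tendsto_inv_pow_sub hs hq hmono hh hGev hp) hx
    simp only [hhf y hy, mul_pow, mul_inv]
  obtain ⟨x₀, hx₀⟩ : (Ioo q b).Nonempty := nonempty_Ioo.2 hqb
  rcases hord with ⟨s, hs, p, hp0, hp⟩ | hflat
  · have hne : -((s : ℝ) * p) ≠ 0 := neg_ne_zero.2 (mul_ne_zero (by positivity) hp0)
    have h0 := eq_one_and_eq_of_tendsto_pow_mul hne (main s hs p hp x₀ hx₀)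
    refine ⟨s, hs, ?_, -(s * p), ?_, fun x hx =>
      (eq_one_and_eq_of_tendsto_pow_mul hne (main s hs p hp x hx)).2⟩
    · have := h0.1
      field_simp at this
      linarith
    · rw [← h0.2]
      exact hpos x₀ hx₀ s hs
  · exfalso
    obtain ⟨n, hn⟩ := exists_pow_lt_of_lt_one (inv_pos.2 hl0) hμ1
    have hsμ : μ ^ (n + 1) ≤ (l : ℝ)⁻¹ :=
      (pow_le_pow_of_le_one hμ0.le hμ1.le (Nat.le_succ n)).trans hn.le
    have hr : 1 ≤ (μ ^ (n + 1))⁻¹ / l := by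
      rw [le_div_iff₀ hl0, one_mul]
      exact (le_inv_comm₀ (by positivity) hl0).1 hsμ
    have hlim := main (n + 1) (by lia) 0 (hflat _ (by lia)) x₀ hx₀
    have hc := hpos x₀ hx₀ (n + 1) (by lia)
    have := ge_of_tendsto' hlim fun m => le_mul_of_one_le_left hc.le (one_le_pow₀ hr (n := m))
    simp at this
    linarith

lemma hasTangencyOrder_of_contDiffOn {g : ℝ → ℝ} {q q₁ : ℝ} (hq : q < q₁)
    (hg : ContDiffOn ℝ ∞ g (Ico q q₁)) (hgq : g q = q)
    (hg1 : derivWithin g (Ico q q₁) q = 1) : HasTangencyOrder g q := by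
  have hqS : q ∈ Ico q q₁ := left_mem_Ico.2 hq
  set D : ℕ → ℝ := fun i => iteratedDerivWithin i g (Ico q q₁) q with hD
  have htaylor : ∀ n : ℕ, 1 ≤ n → (∀ i, 2 ≤ i → i ≤ n → D i = 0) →
      ∀ x, taylorWithinEval g n (Ico q q₁) q x = x := by
    intro n hn
    induction n, hn using Nat.le_induction with
    | base =>
      intro _ x
      rw [taylorWithinEval_succ, taylor_within_zero_eval, hgq]
      simp [iteratedDerivWithin_one, hg1]
    | succ n hn ih =>
      intro hz x
      have h0 : iteratedDerivWithin (n + 1) g (Ico q q₁) q = 0 := hz (n + 1) (by lia) le_rfl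
      rw [taylorWithinEval_succ, ih (fun i hi hin => hz i hi (by lia)), h0, smul_zero, add_zero]
  have hlim : ∀ s : ℕ, 1 ≤ s → (∀ i, 2 ≤ i → i ≤ s → D i = 0) →
      Tendsto (fun x => (g x - x) / (x - q) ^ (s + 1)) (𝓝[>] q)
        (𝓝 (((s + 1 : ℝ) * (s.factorial : ℝ))⁻¹ * D (s + 1))) := by
    intro s hs hz
    have h1 := taylor_tendsto (n := s + 1) (convex_Ico q q₁) hqS
      (hg.of_le (by exact_mod_cast le_top))
    have hle : 𝓝[>] q ≤ 𝓝[Ico q q₁] q := by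
      rw [← nhdsWithin_Ioo_eq_nhdsGT hq]
      exact nhdsWithin_mono _ Ioo_subset_Ico_self
    have h2 := (h1.mono_left hle).add_const (((s + 1 : ℝ) * (s.factorial : ℝ))⁻¹ * D (s + 1))
    rw [zero_add] at h2
    refine h2.congr' ?_
    filter_upwards [self_mem_nhdsWithin] with x hx
    have hx0 : x - q ≠ 0 := (sub_pos.2 hx).ne'
    rw [taylorWithinEval_succ, htaylor s hs hz]
    simp only [smul_eq_mul, hD]
    field_simp
    ring
  by_cases hflat : ∀ i, 2 ≤ i → D i = 0
  · refine Or.inr fun s hs => ?_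
    simpa [hflat (s + 1) (by lia)] using hlim s hs fun i hi _ => hflat i hi
  · push Not at hflat
    classical
    obtain ⟨hk2, hkD⟩ := Nat.find_spec hflat
    have hmin := fun {m} => Nat.find_min (H := hflat) (m := m)
    set k := Nat.find hflat with hk
    obtain ⟨s, hks⟩ : ∃ s, k = s + 1 := ⟨k - 1, by lia⟩
    rw [hks] at hk2 hkD hmin
    refine Or.inl ⟨s, by lia, _, mul_ne_zero (by positivity) hkD, hlim s (by lia) ?_⟩
    intro i hi his
    by_contra hne
    exact hmin (m := i) (by lia) ⟨hi, hne⟩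

lemma HasTangencyOrder.of_rightInverse {g G : ℝ → ℝ} {q : ℝ} (h : HasTangencyOrder g q)
    (hgq : g q = q) (hg1 : HasDerivWithinAt g 1 (Ioi q) q)
    (hG : ∀ᶠ x in 𝓝[>] q, G x ∈ Ioo q x) (hgG : ∀ᶠ x in 𝓝[>] q, g (G x) = x) :
    HasTangencyOrder G q := by
  have hid : Tendsto (fun x : ℝ => x) (𝓝[>] q) (𝓝 q) :=
    tendsto_nhdsWithin_of_tendsto_nhds tendsto_id
  have hGq : Tendsto G (𝓝[>] q) (𝓝[>] q) := by
    refine tendsto_nhdsWithin_iff.2 ⟨?_, hG.mono fun x hx => hx.1⟩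
    exact tendsto_of_tendsto_of_tendsto_of_le_of_le' tendsto_const_nhds hid
      (hG.mono fun x hx => hx.1.le) (hG.mono fun x hx => hx.2.le)
  have hequiv : Asymptotics.IsEquivalent (𝓝[>] q) (fun x => g x - q) (fun x => x - q) := by
    have := hg1.isLittleO
    simpa [Asymptotics.IsEquivalent, Function.comp_def, Pi.sub_def, hgq] using this
  have key : ∀ s : ℕ, ∀ p : ℝ,
      Tendsto (fun x => (g x - x) / (x - q) ^ (s + 1)) (𝓝[>] q) (𝓝 p) →
      Tendsto (fun x => (G x - x) / (x - q) ^ (s + 1)) (𝓝[>] q) (𝓝 (-p)) := by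
    intro s p hp
    have h1 : Tendsto (fun x => (g x - x) / (g x - q) ^ (s + 1)) (𝓝[>] q) (𝓝 p) :=
      ((Asymptotics.IsEquivalent.refl (u := fun x => g x - x)).div
        (hequiv.pow (s + 1))).symm.tendsto_nhds hp
    refine (h1.comp hGq).neg.congr' ?_
    filter_upwards [hgG] with x hx
    simp only [Function.comp_apply, hx]
    ring
  rcases h with ⟨s, hs, p, hp0, hp⟩ | hflat
  · exact Or.inl ⟨s, hs, -p, neg_ne_zero.2 hp0, key s p hp⟩
  · exact Or.inr fun s hs => by simpa using key s 0 (hflat s hs)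

lemma contDiffAt_of_leftInverse {F G : ℝ → ℝ} {x : ℝ} (hF : ContDiffAt ℝ ∞ F x)
    (hF' : deriv F x ≠ 0) (h : ∀ᶠ y in 𝓝 x, G (F y) = y) : ContDiffAt ℝ ∞ G (F x) := by
  have hd : HasFDerivAt F
      ((ContinuousLinearEquiv.unitsEquivAut ℝ (Units.mk0 _ hF') : ℝ ≃L[ℝ] ℝ) : ℝ →L[ℝ] ℝ) x :=
    ((hF.differentiableAt (by simp)).hasDerivAt.hasFDerivAt).congr_fderiv (by ext; simp)
  have hn : (∞ : WithTop ℕ∞) ≠ 0 := by simp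
  exact (hF.to_localInverse hd hn).congr_of_eventuallyEq
    ((hF.hasStrictFDerivAt' hd hn).localInverse_unique h)

lemma tendsto_iterate_of_lt {G : ℝ → ℝ} {q q₁ : ℝ} (hG : ContinuousOn G (Ioo q q₁))
    (hGlt : ∀ x ∈ Ioo q q₁, G x ∈ Ioo q x) {x b : ℝ} (hx : x ∈ Ioo q q₁) (hb : q < b) :
    ∃ n, G^[n] x ∈ Ioo q b := by
  have hmaps : MapsTo G (Ioo q q₁) (Ioo q q₁) := fun y hy =>
    ⟨(hGlt y hy).1, (hGlt y hy).2.trans hy.2⟩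
  have hmem : ∀ n, G^[n] x ∈ Ioo q q₁ := fun n => hmaps.iterate n hx
  by_contra! hcon
  have hbn : ∀ n, b ≤ G^[n] x := fun n => not_lt.1 fun h => hcon n ⟨(hmem n).1, h⟩
  have hanti : Antitone fun n => G^[n] x := antitone_nat_of_succ_le fun n => by
    rw [Function.iterate_succ_apply']
    exact (hGlt _ (hmem n)).2.le
  obtain ⟨y, hy⟩ : ∃ y, Tendsto (fun n => G^[n] x) atTop (𝓝 y) :=
    ⟨_, tendsto_atTop_ciInf hanti ⟨b, by rintro _ ⟨n, rfl⟩; exact hbn n⟩⟩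
  have hby : b ≤ y := ge_of_tendsto' hy hbn
  have hyx : y ≤ x := le_of_tendsto' hy fun n => hanti (Nat.zero_le n)
  have hyS : y ∈ Ioo q q₁ := ⟨hb.trans_le hby, hyx.trans_lt hx.2⟩
  have h1 : Tendsto (fun n => G^[n + 1] x) atTop (𝓝 (G y)) := by
    simp only [Function.iterate_succ_apply']
    exact (hG.continuousAt (Ioo_mem_nhds hyS.1 hyS.2)).tendsto.comp hy
  have h2 := tendsto_nhds_unique h1 (hy.comp (tendsto_add_atTop_nat 1))
  exact absurd h2 (hGlt y hyS).2.ne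

/-- A conjugacy defined near the end `q` extends along the orbits of `G` to `(q, q₁)`. -/
lemma exists_global_conjugacy {f G α₀ : ℝ → ℝ} {q q₁ b : ℝ} {l : ℕ}
    (hqb : q < b) (hbq : b < q₁) (hGbij : BijOn G (Ioo q q₁) (Ioo q q₁))
    (hG : ContDiffOn ℝ ∞ G (Ioo q q₁)) (hG' : ∀ x ∈ Ioo q q₁, 0 < deriv G x)
    (hGlt : ∀ x ∈ Ioo q q₁, G x < x) (hf : MapsTo f (Ioo q q₁) (Ioo q q₁))
    (hfb : MapsTo f (Ioo q b) (Ioo q b)) (hrel : ∀ x ∈ Ioo q q₁, f (G x) = G^[l] (f x))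
    (hα₀ : ContDiffOn ℝ ∞ α₀ (Ioo q b)) (hα₀' : ∀ x ∈ Ioo q b, deriv α₀ x < 0)
    (hα₀G : ∀ x ∈ Ioo q b, α₀ (G x) = α₀ x + 1) (hα₀f : ∀ x ∈ Ioo q b, α₀ (f x) = l * α₀ x) :
    ∃ α : ℝ → ℝ, ContDiffOn ℝ ∞ α (Ioo q q₁) ∧ (∀ x ∈ Ioo q q₁, deriv α x < 0) ∧
      BijOn α (Ioo q q₁) univ ∧ (∀ x ∈ Ioo q q₁, α (G x) = α x + 1) ∧
      ∀ x ∈ Ioo q q₁, α (f x) = l * α x := by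
  have hGmem : ∀ x ∈ Ioo q q₁, G x ∈ Ioo q x := fun x hx => ⟨(hGbij.mapsTo hx).1, hGlt x hx⟩
  have hGb : MapsTo G (Ioo q b) (Ioo q b) := fun x hx => by
    have := hGmem x ⟨hx.1, hx.2.trans hbq⟩
    exact ⟨this.1, this.2.trans hx.2⟩
  have hGn : ∀ n : ℕ, MapsTo G^[n] (Ioo q q₁) (Ioo q q₁) := fun n => hGbij.mapsTo.iterate n
  have hGnb : ∀ n : ℕ, MapsTo G^[n] (Ioo q b) (Ioo q b) := fun n => hGb.iterate n
  have hex : ∀ x ∈ Ioo q q₁, ∃ n, G^[n] x ∈ Ioo q b := fun x hx =>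
    tendsto_iterate_of_lt hG.continuousOn hGmem hx hqb
  have hα₀n : ∀ n : ℕ, ∀ x ∈ Ioo q b, α₀ (G^[n] x) = α₀ x + n := by
    intro n
    induction n with
    | zero => simp
    | succ n ih =>
      intro x hx
      rw [Function.iterate_succ_apply', hα₀G _ (hGnb n hx), ih x hx]
      push_cast
      ring
  have hreln : ∀ n : ℕ, ∀ x ∈ Ioo q q₁, f (G^[n] x) = G^[l * n] (f x) := by
    intro n
    induction n with
    | zero => simp
    | succ n ih =>
      intro x hx
      rw [Function.iterate_succ_apply', hrel _ (hGn n hx), ih x hx, ← Function.iterate_add_apply]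
      congr 1
      ring_nf
  choose! N hN using hex
  set α : ℝ → ℝ := fun x => α₀ (G^[N x] x) - N x with hα
  have hαeq : ∀ n : ℕ, ∀ x ∈ Ioo q q₁, G^[n] x ∈ Ioo q b → α x = α₀ (G^[n] x) - n := by
    intro n x hx hn
    have h1 := hα₀n n _ (hN x hx)
    have h2 := hα₀n (N x) _ hn
    rw [← Function.iterate_add_apply] at h1 h2
    rw [add_comm, h1] at h2
    simp only [hα]
    linarith
  have hsmooth : ∀ n : ℕ, ∀ x ∈ Ioo q q₁, ContDiffAt ℝ ∞ G^[n] x ∧ 0 < deriv G^[n] x := by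
    intro n
    induction n with
    | zero => intro x _; simpa using contDiffAt_id
    | succ n ih =>
      intro x hx
      have hy := hGn n hx
      have hGy : ContDiffAt ℝ ∞ G (G^[n] x) := hG.contDiffAt (Ioo_mem_nhds hy.1 hy.2)
      obtain ⟨h1, h2⟩ := ih x hx
      rw [Function.iterate_succ']
      refine ⟨hGy.comp x h1, ?_⟩
      rw [deriv_comp x (hGy.differentiableAt (by simp)) (h1.differentiableAt (by simp))]
      exact mul_pos (hG' _ hy) h2
  have hαev : ∀ x ∈ Ioo q q₁, α =ᶠ[𝓝 x] fun y => α₀ (G^[N x] y) - N x := by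
    intro x hx
    have h1 := (hsmooth (N x) x hx).1.continuousAt.preimage_mem_nhds
      (Ioo_mem_nhds (hN x hx).1 (hN x hx).2)
    filter_upwards [h1, Ioo_mem_nhds hx.1 hx.2] with y hy hyS using hαeq _ y hyS hy
  have hα₀at : ∀ y ∈ Ioo q b, ContDiffAt ℝ ∞ α₀ y := fun y hy =>
    hα₀.contDiffAt (Ioo_mem_nhds hy.1 hy.2)
  have hαsmooth : ContDiffOn ℝ ∞ α (Ioo q q₁) := fun x hx =>
    ((((hα₀at _ (hN x hx)).comp x (hsmooth (N x) x hx).1).sub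
      contDiffAt_const).congr_of_eventuallyEq (hαev x hx)).contDiffWithinAt
  have hαderiv : ∀ x ∈ Ioo q q₁, deriv α x < 0 := by
    intro x hx
    obtain ⟨h1, h2⟩ := hsmooth (N x) x hx
    rw [(hαev x hx).deriv_eq, deriv_sub_const]
    change deriv (α₀ ∘ G^[N x]) x < 0
    rw [deriv_comp x ((hα₀at _ (hN x hx)).differentiableAt (by simp))
      (h1.differentiableAt (by simp))]
    exact mul_neg_of_neg_of_pos (hα₀' _ (hN x hx)) h2
  have hαG : ∀ x ∈ Ioo q q₁, α (G x) = α x + 1 := by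
    intro x hx
    have h1 : G^[N x] (G x) ∈ Ioo q b := by
      rw [← Function.iterate_succ_apply, Function.iterate_succ_apply']
      exact hGb (hN x hx)
    rw [hαeq (N x) (G x) (hGbij.mapsTo hx) h1, ← Function.iterate_succ_apply,
      Function.iterate_succ_apply', hα₀G _ (hN x hx)]
    simp only [hα]
    ring
  have hanti : StrictAntiOn α (Ioo q q₁) :=
    strictAntiOn_of_deriv_neg (convex_Ioo q q₁) hαsmooth.continuousOn
      (by rw [interior_Ioo]; exact hαderiv)
  refine ⟨α, hαsmooth, hαderiv, ⟨mapsTo_univ _ _, hanti.injOn, ?_⟩, hαG, ?_⟩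
  · intro z _
    obtain ⟨x₀, hx₀⟩ : (Ioo q q₁).Nonempty := nonempty_Ioo.2 (hqb.trans hbq)
    have hup : ∀ n : ℕ, ∃ y ∈ Ioo q q₁, α y = α x₀ + n := by
      intro n
      induction n with
      | zero => exact ⟨x₀, hx₀, by simp⟩
      | succ n ih =>
        obtain ⟨y, hy, hyn⟩ := ih
        exact ⟨G y, hGbij.mapsTo hy, by rw [hαG y hy, hyn]; push_cast; ring⟩
    have hdown : ∀ n : ℕ, ∃ y ∈ Ioo q q₁, α y = α x₀ - n := by
      intro n
      induction n with
      | zero => exact ⟨x₀, hx₀, by simp⟩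
      | succ n ih =>
        obtain ⟨y, hy, hyn⟩ := ih
        obtain ⟨w, hw, rfl⟩ := hGbij.surjOn hy
        refine ⟨w, hw, ?_⟩
        rw [hαG w hw] at hyn
        push_cast
        linarith
    obtain ⟨n, hn⟩ := exists_nat_ge |z - α x₀|
    obtain ⟨hn1, hn2⟩ := abs_le.1 hn
    obtain ⟨y₁, hy₁, e₁⟩ := hup n
    obtain ⟨y₂, hy₂, e₂⟩ := hdown n
    exact (isPreconnected_Ioo.image α hαsmooth.continuousOn).ordConnected.out
      (mem_image_of_mem α hy₂) (mem_image_of_mem α hy₁) ⟨by linarith, by linarith⟩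
  · intro x hx
    have h1 := hN x hx
    have h2 : G^[l * N x] (f x) ∈ Ioo q b := by
      rw [← hreln _ x hx]; exact hfb h1
    rw [hαeq _ (f x) (hf hx) h2, ← hreln _ x hx, hα₀f _ h1]
    simp only [hα]
    push_cast
    ring

lemma exists_contraction_interval {f : ℝ → ℝ} {q q₁ : ℝ} (hq : q < q₁)
    (hf : IsCrDiffeoOnIco ∞ f q q₁) (hfq : f q = q) (hf'q : derivWithin f (Ico q q₁) q < 1) :
    ∃ b ∈ Ioo q q₁, ∃ ρ < 1, ∀ x ∈ Icc q b,
      derivWithin f (Icc q b) x = derivWithin f (Ico q q₁) x ∧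
      derivWithin f (Icc q b) x ≤ ρ ∧ f x - q ≤ ρ * (x - q) := by
  obtain ⟨hbij, hC, hpos⟩ := hf
  have hu : UniqueDiffOn ℝ (Ico q q₁) := uniqueDiffOn_Ico q q₁
  have hqS : q ∈ Ico q q₁ := left_mem_Ico.2 hq
  obtain ⟨ρ, hρ, hρ1⟩ := exists_between hf'q
  have hFc : ContinuousOn (derivWithin f (Ico q q₁)) (Ico q q₁) :=
    hC.continuousOn_derivWithin hu (by simp)
  have hev : ∀ᶠ x in 𝓝[≥] q, derivWithin f (Ico q q₁) x < ρ := by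
    rw [← nhdsWithin_Ico_eq_nhdsGE hq]
    exact (hFc q hqS).eventually (gt_mem_nhds hρ)
  obtain ⟨u, hu', hus⟩ := mem_nhdsGE_iff_exists_Icc_subset.1 hev
  obtain ⟨b, hqb, hb⟩ := exists_between (lt_min hu' hq)
  obtain ⟨hbu, hbq⟩ := lt_min_iff.1 hb
  have hsub : Icc q b ⊆ Ico q q₁ := fun x hx => ⟨hx.1, hx.2.trans_lt hbq⟩
  have hKu : UniqueDiffOn ℝ (Icc q b) := uniqueDiffOn_Icc hqb
  have hfd : DifferentiableOn ℝ f (Ico q q₁) := hC.differentiableOn (by simp)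
  have heq : ∀ x ∈ Icc q b, derivWithin f (Icc q b) x = derivWithin f (Ico q q₁) x :=
    fun x hx => derivWithin_subset hsub (hKu x hx) (hfd x (hsub hx))
  have hle : ∀ x ∈ Icc q b, derivWithin f (Icc q b) x ≤ ρ := fun x hx => by
    rw [heq x hx]
    exact le_of_lt (hus ⟨hx.1, hx.2.trans hbu.le⟩)
  refine ⟨b, ⟨hqb, hbq⟩, ρ, hρ1, fun x hx => ⟨heq x hx, hle x hx, ?_⟩⟩
  have hqK : q ∈ Icc q b := left_mem_Icc.2 hqb.le
  have h1 := (convex_Icc q b).norm_image_sub_le_of_norm_derivWithin_le (C := ρ) (hfd.mono hsub)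
    (fun y hy => by
      rw [Real.norm_eq_abs, abs_of_pos (by rw [heq y hy]; exact hpos y (hsub hy))]
      exact hle y hy) hqK hx
  rw [hfq, Real.norm_eq_abs, Real.norm_eq_abs, abs_of_nonneg (sub_nonneg.2 hx.1)] at h1
  exact (le_abs_self _).trans h1

lemma IsCrDiffeoOnIco.bijOn_Ioo {r : WithTop ℕ∞} {f : ℝ → ℝ} {q q₁ : ℝ}
    (hf : IsCrDiffeoOnIco r f q q₁) (hq : q < q₁) (hfq : f q = q) :
    BijOn f (Ioo q q₁) (Ioo q q₁) := by
  obtain ⟨hbij, -, -⟩ := hf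
  have hqS : q ∈ Ico q q₁ := left_mem_Ico.2 hq
  refine ⟨fun x hx => ?_, hbij.injOn.mono Ioo_subset_Ico_self, fun y hy => ?_⟩
  · have h1 := hbij.mapsTo (Ioo_subset_Ico_self hx)
    refine ⟨lt_of_le_of_ne h1.1 fun h => hx.1.ne' ?_, h1.2⟩
    exact hbij.injOn (Ioo_subset_Ico_self hx) hqS (by rw [hfq, ← h])
  · obtain ⟨x, hx, rfl⟩ := hbij.surjOn (Ioo_subset_Ico_self hy)
    refine ⟨x, ⟨lt_of_le_of_ne hx.1 ?_, hx.2⟩, rfl⟩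
    rintro rfl
    exact hy.1.ne' hfq

lemma IsCrDiffeoOnIco.deriv_pos {r : WithTop ℕ∞} {f : ℝ → ℝ} {q q₁ : ℝ}
    (hf : IsCrDiffeoOnIco r f q q₁) {x : ℝ} (hx : x ∈ Ioo q q₁) : 0 < deriv f x := by
  rw [← derivWithin_of_mem_nhds (Ico_mem_nhds hx.1 hx.2)]
  exact hf.2.2 x (Ioo_subset_Ico_self hx)

lemma exists_conjugacy_of_lt {f G : ℝ → ℝ} {q q₁ : ℝ} {l : ℕ} (hl : 2 ≤ l) (hq : q < q₁)
    (hf : IsCrDiffeoOnIco ∞ f q q₁) (hfq : f q = q) (hf'q : derivWithin f (Ico q q₁) q < 1)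
    (hGbij : BijOn G (Ioo q q₁) (Ioo q q₁)) (hG : ContDiffOn ℝ ∞ G (Ioo q q₁))
    (hG' : ∀ x ∈ Ioo q q₁, 0 < deriv G x) (hGlt : ∀ x ∈ Ioo q q₁, G x < x)
    (hrel : ∀ x ∈ Ioo q q₁, f (G x) = G^[l] (f x)) (hord : HasTangencyOrder G q) :
    ∃ s : ℕ, 1 ≤ s ∧ derivWithin f (Ico q q₁) q ^ s * l = 1 ∧
      ∃ α : ℝ → ℝ, ContDiffOn ℝ ∞ α (Ioo q q₁) ∧ (∀ x ∈ Ioo q q₁, deriv α x < 0) ∧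
      BijOn α (Ioo q q₁) univ ∧ (∀ x ∈ Ioo q q₁, α (G x) = α x + 1) ∧
      ∀ x ∈ Ioo q q₁, α (f x) = l * α x := by
  obtain ⟨b, ⟨hqb, hbq⟩, ρ, hρ, hfb⟩ := exists_contraction_interval hq hf hfq hf'q
  have hfbij := hf.bijOn_Ioo hq hfq
  have hsub : Icc q b ⊆ Ico q q₁ := fun x hx => ⟨hx.1, hx.2.trans_lt hbq⟩
  have hJS : Ioo q b ⊆ Ioo q q₁ := Ioo_subset_Ioo_right hbq.le
  have hJK : Ioo q b ⊆ Icc q b := Ioo_subset_Icc_self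
  have hqK : q ∈ Icc q b := left_mem_Icc.2 hqb.le
  have hle : ∀ x ∈ Icc q b, f x ≤ x := fun x hx => by nlinarith [(hfb x hx).2.2, hx.1]
  have hfK : MapsTo f (Icc q b) (Icc q b) := fun x hx =>
    ⟨(hf.1.mapsTo (hsub hx)).1, (hle x hx).trans hx.2⟩
  have hfJ : MapsTo f (Ioo q b) (Ioo q b) := fun x hx =>
    ⟨(hfbij.mapsTo (hJS hx)).1, (hle x (hJK hx)).trans_lt hx.2⟩
  have hf'pos : ∀ x ∈ Icc q b, 0 < derivWithin f (Icc q b) x := fun x hx => by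
    rw [(hfb x hx).1]; exact hf.2.2 x (hsub hx)
  obtain ⟨h, hhq, hh1, hmono, hhf, hhs, hh'⟩ := exists_linearization hqb hfK hfq hρ
    (hf.2.1.mono hsub) hf'pos fun x hx => (hfb x hx).2.1
  rw [(hfb q hqK).1] at hhf
  set μ := derivWithin f (Ico q q₁) q with hμ
  have hρ0 : 0 ≤ ρ := (hf'pos q hqK).le.trans (hfb q hqK).2.1
  have hflim : ∀ x ∈ Ioo q b, Tendsto (fun n => f^[n] x) atTop (𝓝 q) := by
    intro x hx
    have hb : ∀ n : ℕ, f^[n] x ≤ q + ρ ^ n * (x - q) := by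
      intro n
      induction n with
      | zero => simp
      | succ n ih =>
        rw [Function.iterate_succ_apply', pow_succ]
        have := (hfb _ (hJK (hfJ.iterate n hx))).2.2
        nlinarith
    have hlim : Tendsto (fun n : ℕ => q + ρ ^ n * (x - q)) atTop (𝓝 q) := by
      simpa using ((tendsto_pow_atTop_nhds_zero_of_lt_one hρ0 hρ).mul_const (x - q)).const_add q
    exact tendsto_of_tendsto_of_tendsto_of_le_of_le tendsto_const_nhds hlim
      (fun n => (hfJ.iterate n hx).1.le) hb
  obtain ⟨s, hs, hsl, d, hd, hA⟩ := exists_inv_pow_sub_eq hqb (by lia)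
    (hf.2.2 q (left_mem_Ico.2 hq)) hf'q hfJ hflim
    (fun x hx => ⟨(hGbij.mapsTo (hJS hx)).1, hGlt x (hJS hx)⟩) (fun x hx => hrel x (hJS hx))
    hhq hmono hh1 (fun x hx => hhf x (hJK hx)) hord
  have hhpos : ∀ x ∈ Ioo q b, 0 < h x := fun x hx => hhq ▸ hmono hx.1
  refine ⟨s, hs, hsl, exists_global_conjugacy (α₀ := fun x => (h x ^ s)⁻¹ / d) hqb hbq hGbij hG hG'
    hGlt hfbij.mapsTo hfJ hrel ?_ ?_ ?_ ?_⟩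
  · exact ((hhs.pow s).inv fun x hx => (pow_pos (hhpos x hx) s).ne').div_const d
  · intro x hx
    have hx0 := hhpos x hx
    have hdiff : HasDerivAt h (deriv h x) x :=
      (differentiableAt_of_deriv_ne_zero (hh' x).ne').hasDerivAt
    have h1 := ((hdiff.fun_pow s).fun_inv (pow_pos hx0 s).ne').div_const d
    rw [h1.deriv]
    have := hh' x
    have hs0 : (0 : ℝ) < s := by exact_mod_cast hs
    refine div_neg_of_neg_of_pos (div_neg_of_neg_of_pos (neg_neg_of_pos ?_) (by positivity)) hd
    positivity
  · intro x hx
    have := hA x hx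
    field_simp at this ⊢
    linarith
  · intro x hx
    have hl' : (μ ^ s)⁻¹ = l := inv_eq_of_mul_eq_one_right hsl
    simp only [hhf x (hJK hx), mul_pow, mul_inv, hl']
    ring

lemma derivWithin_eq_one_of_semiconj {f g : ℝ → ℝ} {q q₁ : ℝ} {l : ℕ} (hl : 2 ≤ l) (hq : q < q₁)
    (hf : IsCrDiffeoOnIco ∞ f q q₁) (hg : IsCrDiffeoOnIco ∞ g q q₁)
    (hfq : f q = q) (hgq : g q = q) (hrel : ∀ x ∈ Ico q q₁, f (g x) = g^[l] (f x)) :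
    derivWithin g (Ico q q₁) q = 1 := by
  have hqS : q ∈ Ico q q₁ := left_mem_Ico.2 hq
  have hF := (hf.2.1.differentiableOn (by simp) q hqS).hasDerivWithinAt
  have hγ := (hg.2.1.differentiableOn (by simp) q hqS).hasDerivWithinAt
  have hFpos := hf.2.2 q hqS
  have hγpos := hg.2.2 q hqS
  set F := derivWithin f (Ico q q₁) q
  set γ := derivWithin g (Ico q q₁) q
  have h1 : HasDerivWithinAt (f ∘ g) (F * γ) (Ico q q₁) q :=
    HasDerivWithinAt.comp q (by rwa [hgq]) hγ hg.1.mapsTo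
  have hit : HasDerivWithinAt g^[l] (γ ^ l) (Ico q q₁) q :=
    HasDerivWithinAt.iterate q hγ hgq hg.1.mapsTo l
  have h2 : HasDerivWithinAt (g^[l] ∘ f) (γ ^ l * F) (Ico q q₁) q :=
    HasDerivWithinAt.comp q (by rwa [hfq]) hF hf.1.mapsTo
  have h3 : F * γ = γ ^ l * F := (uniqueDiffOn_Ico q q₁ q hqS).eq_deriv _ h1
    (h2.congr_of_mem hrel hqS)
  obtain ⟨m, rfl⟩ : ∃ m, l = m + 1 := ⟨l - 1, by lia⟩
  have h4 : γ ^ m = 1 := by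
    have : (F * γ) * γ ^ m = (F * γ) * 1 := by rw [pow_succ] at h3; linarith
    exact mul_left_cancel₀ (mul_pos hFpos hγpos).ne' this
  exact (pow_eq_one_iff_of_nonneg hγpos.le (by lia)).1 h4

lemma forall_lt_or_forall_gt_of_ne {g : ℝ → ℝ} {s : Set ℝ} (hs : IsPreconnected s)
    (hg : ContinuousOn g s) (hne : ∀ x ∈ s, g x ≠ x) :
    (∀ x ∈ s, g x < x) ∨ ∀ x ∈ s, x < g x := by
  by_contra! h
  obtain ⟨⟨x, hx, hxg⟩, y, hy, hyg⟩ := h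
  obtain ⟨z, hz, hz0⟩ := hs.intermediate_value₂ hy hx hg continuousOn_id hyg hxg
  exact hne z hz hz0

lemma exists_smooth_inverse {α : ℝ → ℝ} {q q₁ : ℝ} (hα : ContDiffOn ℝ ∞ α (Ioo q q₁))
    (hα' : ∀ x ∈ Ioo q q₁, deriv α x ≠ 0) (hbij : BijOn α (Ioo q q₁) univ) :
    ∃ β : ℝ → ℝ, ContDiff ℝ ∞ β ∧ (∀ y : ℝ, β y ∈ Ioo q q₁) ∧
      (∀ x ∈ Ioo q q₁, β (α x) = x) ∧ ∀ y : ℝ, α (β y) = y := by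
  have hinv := hbij.invOn_invFunOn
  have hmem : ∀ y, Function.invFunOn α (Ioo q q₁) y ∈ Ioo q q₁ := fun y =>
    Function.invFunOn_mem (hbij.surjOn (mem_univ y))
  refine ⟨Function.invFunOn α (Ioo q q₁), contDiff_iff_contDiffAt.2 fun y => ?_, hmem,
    fun x hx => hinv.1 hx, fun y => hinv.2 (mem_univ y)⟩
  have hx := hmem y
  have := contDiffAt_of_leftInverse (hα.contDiffAt (Ioo_mem_nhds hx.1 hx.2)) (hα' _ hx)
    (G := Function.invFunOn α (Ioo q q₁))
    (by filter_upwards [Ioo_mem_nhds hx.1 hx.2] with z hz using hinv.1 hz)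
  rwa [hinv.2 (mem_univ y)] at this

/-- Up to replacing `g` by its inverse (and the conjugacy by its opposite), `g` may be assumed to
move points towards `q`. -/
lemma exists_conjugacy {f g : ℝ → ℝ} {q q₁ : ℝ} {l : ℕ} (hl : 2 ≤ l) (hq : q < q₁)
    (hf : IsCrDiffeoOnIco ∞ f q q₁) (hg : IsCrDiffeoOnIco ∞ g q q₁) (hfq : f q = q)
    (hgq : g q = q) (hgfix : ∀ x ∈ Ioo q q₁, g x ≠ x) (hf'q : derivWithin f (Ico q q₁) q < 1)
    (hrel : ∀ x ∈ Ico q q₁, f (g x) = g^[l] (f x)) :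
    ∃ s : ℕ, 1 ≤ s ∧ derivWithin f (Ico q q₁) q ^ s * l = 1 ∧
      ∃ α : ℝ → ℝ, ContDiffOn ℝ ∞ α (Ioo q q₁) ∧ (∀ x ∈ Ioo q q₁, deriv α x ≠ 0) ∧
      BijOn α (Ioo q q₁) univ ∧ (∀ x ∈ Ioo q q₁, α (g x) = α x + 1) ∧
      ∀ x ∈ Ioo q q₁, α (f x) = l * α x := by
  have hg1 := derivWithin_eq_one_of_semiconj hl hq hf hg hfq hgq hrel
  have hord := hasTangencyOrder_of_contDiffOn hq hg.2.1 hgq hg1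
  have hfbij := hf.bijOn_Ioo hq hfq
  have hgbij := hg.bijOn_Ioo hq hgq
  have hgC : ContDiffOn ℝ ∞ g (Ioo q q₁) := hg.2.1.mono Ioo_subset_Ico_self
  have hgat : ∀ x ∈ Ioo q q₁, ContDiffAt ℝ ∞ g x := fun x hx =>
    hgC.contDiffAt (Ioo_mem_nhds hx.1 hx.2)
  rcases forall_lt_or_forall_gt_of_ne isPreconnected_Ioo hgC.continuousOn hgfix with hlt | hgt
  · obtain ⟨s, hs, hsl, α, h1, h2, h3⟩ := exists_conjugacy_of_lt hl hq hf hfq hf'q hgbij hgC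
      (fun x hx => hg.deriv_pos hx) hlt (fun x hx => hrel x (Ioo_subset_Ico_self hx)) hord
    exact ⟨s, hs, hsl, α, h1, fun x hx => (h2 x hx).ne, h3⟩
  · set G := Function.invFunOn g (Ioo q q₁) with hGdef
    have hinv : InvOn G g (Ioo q q₁) (Ioo q q₁) := hgbij.invOn_invFunOn
    have hGbij : BijOn G (Ioo q q₁) (Ioo q q₁) := hinv.symm.bijOn
      (fun x hx => Function.invFunOn_mem (hgbij.surjOn hx)) hgbij.mapsTo
    have hGat : ∀ x ∈ Ioo q q₁, ContDiffAt ℝ ∞ G x := by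
      intro x hx
      have hy := hGbij.mapsTo hx
      have := contDiffAt_of_leftInverse (G := G) (hgat _ hy) (hg.deriv_pos hy).ne'
        (by filter_upwards [Ioo_mem_nhds hy.1 hy.2] with z hz using hinv.1 hz)
      rwa [hinv.2 hx] at this
    have hGlt : ∀ x ∈ Ioo q q₁, G x < x := fun x hx => by
      simpa [hinv.2 hx] using hgt (G x) (hGbij.mapsTo hx)
    have hG' : ∀ x ∈ Ioo q q₁, 0 < deriv G x := by
      intro x hx
      have hy := hGbij.mapsTo hx
      have h1 := ((hgat _ hy).differentiableAt (by simp)).hasDerivAt.comp x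
        ((hGat x hx).differentiableAt (by simp)).hasDerivAt
      have h2 : g ∘ G =ᶠ[𝓝 x] id := by
        filter_upwards [Ioo_mem_nhds hx.1 hx.2] with z hz using hinv.2 hz
      have h3 : deriv g (G x) * deriv G x = 1 :=
        h1.unique ((hasDerivAt_id x).congr_of_eventuallyEq h2)
      exact pos_of_mul_pos_right (h3 ▸ one_pos) (hg.deriv_pos hy).le
    have hGrel : ∀ x ∈ Ioo q q₁, f (G x) = G^[l] (f x) := by
      have hcancel : ∀ n : ℕ, ∀ z ∈ Ioo q q₁, G^[n] (g^[n] z) = z := by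
        intro n
        induction n with
        | zero => simp
        | succ n ih =>
          intro z hz
          rw [Function.iterate_succ_apply, Function.iterate_succ_apply',
            hinv.1 (hgbij.mapsTo.iterate n hz), ih z hz]
      intro x hx
      have hy := hGbij.mapsTo hx
      have := hrel (G x) (Ioo_subset_Ico_self hy)
      rw [hinv.2 hx] at this
      rw [this, hcancel l _ (hfbij.mapsTo hy)]
    have hSmem : Ioo q q₁ ∈ 𝓝[>] q := Ioo_mem_nhdsGT hq
    have hgd : HasDerivWithinAt g 1 (Ioi q) q := by
      have h1 := (hg.2.1.differentiableOn (by simp) q (left_mem_Ico.2 hq)).hasDerivWithinAt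
      rw [hg1] at h1
      exact (h1.mono Ioo_subset_Ico_self).mono_of_mem_nhdsWithin hSmem
    have hGord : HasTangencyOrder G q := hord.of_rightInverse hgq hgd
      (by filter_upwards [hSmem] with x hx using ⟨(hGbij.mapsTo hx).1, hGlt x hx⟩)
      (by filter_upwards [hSmem] with x hx using hinv.2 hx)
    obtain ⟨s, hs, hsl, α, hα, hα', hαbij, hαG, hαf⟩ := exists_conjugacy_of_lt hl hq hf hfq hf'q
      hGbij (fun x hx => (hGat x hx).contDiffWithinAt) hG' hGlt hGrel hGord
    refine ⟨s, hs, hsl, fun x => -α x, hα.neg, fun x hx => ?_, ?_, fun x hx => ?_, fun x hx => ?_⟩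
    · rw [deriv.fun_neg]
      exact neg_ne_zero.2 (hα' x hx).ne
    · exact (Equiv.neg ℝ).bijective.bijOn_univ.comp hαbij
    · have := hαG (g x) (hgbij.mapsTo hx)
      rw [hinv.1 hx] at this
      linarith
    · change -α (f x) = l * -α x
      rw [hαf x hx]
      ring

/-- If `f, g` are `C^∞` diffeomorphisms of `[q, q₁)` fixing `q`, `g` has no interior fixed
point, `f′(q) < 1` and `f ∘ g = g^[λ] ∘ f`, then `f′(q) = (1/λ)^(1/s)` for some integer
`s ≥ 1`, and there is a smooth diffeomorphism `α : (q, q₁) → ℝ` conjugating `g` to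
`x ↦ x + 1` and `f` to `x ↦ λ x`. -/
theorem conjugate_to_affine_model
    (l : ℕ) (hl : 2 ≤ l) (q q₁ : ℝ) (hq : q < q₁) (f g : ℝ → ℝ)
    (hf : IsCrDiffeoOnIco ∞ f q q₁) (hg : IsCrDiffeoOnIco ∞ g q q₁)
    (hfq : f q = q) (hgq : g q = q)
    (hgfix : ∀ x ∈ Set.Ioo q q₁, g x ≠ x)
    (hf'q : derivWithin f (Set.Ico q q₁) q < 1)
    (hrel : ∀ x ∈ Set.Ico q q₁, f (g x) = g^[l] (f x)) :
    ∃ s : ℕ, 1 ≤ s ∧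
      derivWithin f (Set.Ico q q₁) q = ((1 : ℝ) / l) ^ ((1 : ℝ) / s) ∧
      ∃ α β : ℝ → ℝ,
        ContDiffOn ℝ ∞ α (Set.Ioo q q₁) ∧
        Set.BijOn α (Set.Ioo q q₁) Set.univ ∧
        ContDiff ℝ ∞ β ∧ (∀ y : ℝ, β y ∈ Set.Ioo q q₁) ∧
        (∀ x ∈ Set.Ioo q q₁, β (α x) = x) ∧ (∀ y : ℝ, α (β y) = y) ∧
        (∀ p ∈ Set.Ioo q q₁, α (g p) = α p + 1) ∧
        (∀ p ∈ Set.Ioo q q₁, α (f p) = (l : ℝ) * α p) := by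
  obtain ⟨s, hs, hsl, α, hα, hα', hαbij, hαg, hαf⟩ :=
    exists_conjugacy hl hq hf hg hfq hgq hgfix hf'q hrel
  obtain ⟨β, hβ, hβmem, hβα, hαβ⟩ := exists_smooth_inverse hα hα' hαbij
  refine ⟨s, hs, ?_, α, β, hα, hαbij, hβ, hβmem, hβα, hαβ, hαg, hαf⟩
  have hμ := hf.2.2 q (left_mem_Ico.2 hq)
  have hpow : derivWithin f (Ico q q₁) q ^ s = 1 / l :=
    eq_one_div_of_mul_eq_one_left hsl
  rw [← hpow, one_div, Real.pow_rpow_inv_natCast hμ.le (by lia)]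

end
end

section
/- Let λ ≥ 2 be an integer, let q < q₁ be reals, and let f, g be C^∞ diffeomorphisms of the half-open interval [q,q₁) fixing q, such that g has no fixed point in (q,q₁), f′(q) < 1, and f ∘ g = g^[λ] ∘ f on [q,q₁). Then there exist p₁ ∈ (q,q₁], an integer s ≥ 1, a sign o ∈ {−1, 1}, and a C^∞ diffeomorphism H from [q,p₁) onto [0,∞) with H(q) = 0 and positive derivative, such that, setting A(p) = o·H(p)^s, one has: A(f(p)) = A(p)/λ for every p ∈ [q,p₁) with f(p) ∈ [q,p₁), and A(g(p)) = A(p)/(1 − A(p)) for every p ∈ [q,p₁) with g(p) ∈ [q,p₁). Moreover f′(q) = (1/λ)^{1/s}. -/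
open Filter Set Topology
open scoped ContDiff

noncomputable section

/-- A continuous function on a compact interval has a primitive with prescribed initial value. -/
theorem exists_primitive_Icc {q b : ℝ} (hqb : q ≤ b) {v : ℝ → ℝ}
    (hv : ContinuousOn v (Icc q b)) (c : ℝ) :
    ∃ V : ℝ → ℝ, V q = c ∧ ∀ x ∈ Icc q b, HasDerivWithinAt V (v x) (Icc q b) x := by
  have hcont : Continuous (IccExtend hqb ((Icc q b).domRestrict v)) :=
    (continuousOn_iff_continuous_domRestrict.1 hv).Icc_extend'
  refine ⟨fun x => c + ∫ t in q..x, IccExtend hqb ((Icc q b).domRestrict v) t, by simp, ?_⟩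
  intro x hx
  have h := ((hcont.integral_hasStrictDerivAt q x).hasDerivAt.const_add c).hasDerivWithinAt
    (s := Icc q b)
  rwa [IccExtend_of_mem hqb _ hx] at h

theorem contDiffOn_succ_of_hasDerivWithinAt {n : ℕ} {q b : ℝ} (hqb : q < b) {V v : ℝ → ℝ}
    (h : ∀ x ∈ Icc q b, HasDerivWithinAt V (v x) (Icc q b) x)
    (hv : ContDiffOn ℝ n v (Icc q b)) : ContDiffOn ℝ (n + 1 : ℕ) V (Icc q b) := by
  have hU := uniqueDiffOn_Icc hqb
  push_cast
  refine (contDiffOn_succ_iff_derivWithin hU).2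
    ⟨fun x hx => (h x hx).differentiableWithinAt, by simp, ?_⟩
  exact hv.congr fun x hx => (h x hx).derivWithin (hU x hx)

theorem contDiffOn_infty_of_hasDerivWithinAt {q b : ℝ} (hqb : q < b) {V v : ℝ → ℝ}
    (h : ∀ x ∈ Icc q b, HasDerivWithinAt V (v x) (Icc q b) x)
    (hv : ContDiffOn ℝ ∞ v (Icc q b)) : ContDiffOn ℝ ∞ V (Icc q b) := by
  have hU := uniqueDiffOn_Icc hqb
  refine (contDiffOn_infty_iff_derivWithin hU).2
    ⟨fun x hx => (h x hx).differentiableWithinAt, ?_⟩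
  exact hv.congr fun x hx => (h x hx).derivWithin (hU x hx)

theorem eq_zero_of_hasDerivWithinAt_zero {q b : ℝ} {R : ℝ → ℝ} (h0 : R q = 0)
    (h : ∀ x ∈ Icc q b, HasDerivWithinAt R 0 (Icc q b) x) : ∀ x ∈ Icc q b, R x = 0 := by
  intro x hx
  rw [← h0]
  refine constant_of_has_deriv_right_zero (fun y hy => (h y hy).continuousWithinAt)
    (fun y hy => ?_) x hx
  exact (h y (Ico_subset_Icc_self hy)).mono_of_mem_nhdsWithin (Icc_mem_nhdsGE_of_mem hy)

/-- Continuous solutions of a contracting linear cohomological equation are unique. -/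
theorem cohomological_unique {q b ρ : ℝ} (hρ1 : ρ < 1) {f a w v₁ v₂ : ℝ → ℝ}
    (hm : MapsTo f (Icc q b) (Icc q b)) (ha : ∀ x ∈ Icc q b, |a x| ≤ ρ)
    (hv₁ : ContinuousOn v₁ (Icc q b)) (hv₂ : ContinuousOn v₂ (Icc q b))
    (h₁ : ∀ x ∈ Icc q b, v₁ x = w x + a x * v₁ (f x))
    (h₂ : ∀ x ∈ Icc q b, v₂ x = w x + a x * v₂ (f x)) : EqOn v₁ v₂ (Icc q b) := by
  intro x hx
  obtain ⟨y, hy, hmax⟩ := isCompact_Icc.exists_isMaxOn ⟨x, hx⟩ ((hv₁.sub hv₂).abs)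
  have hmax' : ∀ z ∈ Icc q b, |v₁ z - v₂ z| ≤ |v₁ y - v₂ y| := fun z hz => hmax hz
  have e : v₁ y - v₂ y = a y * (v₁ (f y) - v₂ (f y)) := by rw [h₁ y hy, h₂ y hy]; ring
  have h1 : |v₁ y - v₂ y| ≤ ρ * |v₁ y - v₂ y| := by
    calc |v₁ y - v₂ y| = |a y| * |v₁ (f y) - v₂ (f y)| := by rw [e, abs_mul]
      _ ≤ ρ * |v₁ y - v₂ y| :=
        mul_le_mul (ha y hy) (hmax' _ (hm hy)) (abs_nonneg _) ((abs_nonneg _).trans (ha y hy))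
  have h2 : |v₁ y - v₂ y| ≤ 0 := by nlinarith
  have h3 := (hmax' x hx).trans h2
  exact sub_eq_zero.1 (abs_nonpos_iff.1 h3)

theorem cohomological_exists_continuous {q b ρ : ℝ} (hqb : q ≤ b) (hρ0 : 0 ≤ ρ) (hρ1 : ρ < 1)
    {f a w : ℝ → ℝ} (hf : ContinuousOn f (Icc q b)) (hm : MapsTo f (Icc q b) (Icc q b))
    (hac : ContinuousOn a (Icc q b)) (hwc : ContinuousOn w (Icc q b))
    (ha : ∀ x ∈ Icc q b, |a x| ≤ ρ) :
    ∃ v : ℝ → ℝ, ContinuousOn v (Icc q b) ∧ ∀ x ∈ Icc q b, v x = w x + a x * v (f x) := by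
  let F : C(Icc q b, Icc q b) := ⟨hm.restrict, hf.mapsToRestrict hm⟩
  let A : C(Icc q b, ℝ) := ⟨_, continuousOn_iff_continuous_domRestrict.1 hac⟩
  let W : C(Icc q b, ℝ) := ⟨_, continuousOn_iff_continuous_domRestrict.1 hwc⟩
  let T : C(Icc q b, ℝ) → C(Icc q b, ℝ) := fun v => W + A * v.comp F
  have hT : ContractingWith ⟨ρ, hρ0⟩ T := by
    refine ⟨by exact_mod_cast hρ1, LipschitzWith.of_dist_le_mul fun u v => ?_⟩
    refine (ContinuousMap.dist_le (mul_nonneg hρ0 dist_nonneg)).2 fun x => ?_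
    have e : dist (T u x) (T v x) = |a x| * dist (u (F x)) (v (F x)) := by
      simp only [T, Real.dist_eq, ContinuousMap.add_apply, ContinuousMap.mul_apply,
        ContinuousMap.comp_apply, ← abs_mul]
      congr 1
      simp only [A, ContinuousMap.coe_mk, Set.domRestrict_apply]
      ring
    rw [e]
    exact mul_le_mul (ha x x.2) (ContinuousMap.dist_apply_le_dist _) dist_nonneg hρ0
  obtain ⟨v, hv⟩ : ∃ v, T v = v := ⟨_, hT.fixedPoint_isFixedPt⟩
  refine ⟨IccExtend hqb v, (v.continuous.Icc_extend').continuousOn, fun x hx => ?_⟩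
  rw [IccExtend_of_mem hqb _ hx, IccExtend_of_mem hqb _ (hm hx)]
  exact (DFunLike.congr_fun hv ⟨x, hx⟩).symm

/-- A continuous `δ` vanishes if it agrees with a contraction of `δ ∘ f` up to an error whose
derivative is controlled by `δ ∘ f`. -/
theorem eq_zero_of_volterra {q b ρ C : ℝ} (hρ1 : ρ < 1) {f a δ R R' : ℝ → ℝ}
    (hm : MapsTo f (Icc q b) (Icc q b)) (hfle : ∀ x ∈ Icc q b, f x ≤ x)
    (ha : ∀ x ∈ Icc q b, |a x| ≤ ρ) (hδ : ContinuousOn δ (Icc q b))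
    (hR : ∀ x ∈ Icc q b, δ x = a x * δ (f x) + R x) (hRq : R q = 0)
    (hR' : ∀ x ∈ Icc q b, HasDerivWithinAt R (R' x) (Icc q b) x)
    (hC : ∀ x ∈ Icc q b, |R' x| ≤ C * |δ (f x)|) (hC0 : 0 ≤ C) :
    ∀ x ∈ Icc q b, δ x = 0 := by
  intro x hx
  obtain ⟨L, hL0, hL⟩ : ∃ L : ℝ, 0 < L ∧ ρ + C / L < 1 := by
    refine ⟨(C + 1) / (1 - ρ), by apply div_pos <;> linarith, ?_⟩
    have h1 : (0 : ℝ) < 1 - ρ := by linarith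
    have : C / ((C + 1) / (1 - ρ)) = (1 - ρ) * (C / (C + 1)) := by field_simp
    rw [this]
    have : C / (C + 1) < 1 := by rw [div_lt_one] <;> linarith
    nlinarith
  obtain ⟨y, hy, hmax⟩ := isCompact_Icc.exists_isMaxOn ⟨x, hx⟩
    (f := fun z => |δ z| * Real.exp (-(L * (z - q))))
    (hδ.abs.mul (by fun_prop))
  set M := |δ y| * Real.exp (-(L * (y - q))) with hM
  have hM0 : 0 ≤ M := by positivity
  have hb : ∀ z ∈ Icc q b, |δ z| ≤ M * Real.exp (L * (z - q)) := by
    intro z hz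
    have h : |δ z| * Real.exp (-(L * (z - q))) ≤ M := hmax hz
    have := mul_le_mul_of_nonneg_right h (Real.exp_pos (L * (z - q))).le
    rwa [mul_assoc, ← Real.exp_add, neg_add_cancel, Real.exp_zero, mul_one] at this
  have hbf : ∀ z ∈ Icc q b, |δ (f z)| ≤ M * Real.exp (L * (z - q)) := by
    intro z hz
    refine (hb _ (hm hz)).trans ?_
    have := hfle z hz
    gcongr
  have hRb := image_norm_le_of_norm_deriv_right_le_deriv_boundary (f := R) (f' := R') (a := q)
    (b := b) (fun z hz => (hR' z hz).continuousWithinAt)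
    (fun z hz => (hR' z (Ico_subset_Icc_self hz)).mono_of_mem_nhdsWithin
      (Icc_mem_nhdsGE_of_mem hz))
    (B := fun z => C / L * (M * Real.exp (L * (z - q))))
    (B' := fun z => C * (M * Real.exp (L * (z - q))))
    (by rw [hRq, norm_zero]; positivity)
    (fun z => by
      have h1 : HasDerivAt (fun z : ℝ => L * (z - q)) L z := by
        simpa using ((hasDerivAt_id z).sub_const q).const_mul L
      refine ((h1.exp.const_mul M).const_mul (C / L)).congr_deriv ?_
      field_simp)
    (fun z hz => (hC z (Ico_subset_Icc_self hz)).trans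
      (mul_le_mul_of_nonneg_left (hbf z (Ico_subset_Icc_self hz)) hC0)) hy
  have hyM : |δ y| = M * Real.exp (L * (y - q)) := by
    rw [hM, mul_assoc, ← Real.exp_add, neg_add_cancel, Real.exp_zero, mul_one]
  set E := M * Real.exp (L * (y - q)) with hE
  have hE0 : 0 ≤ E := by positivity
  have h1 : E ≤ ρ * E + C / L * E := by
    calc E = |a y * δ (f y) + R y| := by rw [← hyM, ← hR y hy]
      _ ≤ |a y| * |δ (f y)| + |R y| := by rw [← abs_mul]; exact abs_add_le _ _
      _ ≤ ρ * E + C / L * E := add_le_add (mul_le_mul (ha y hy) (hbf y hy) (abs_nonneg _)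
            ((abs_nonneg _).trans (ha y hy))) hRb
  have hE1 : E = 0 := by nlinarith
  have hM1 : M = 0 := by
    rcases mul_eq_zero.1 hE1 with h | h
    · exact h
    · exact absurd h (Real.exp_pos _).ne'
  have := hb x hx
  rw [hM1, zero_mul] at this
  exact abs_nonpos_iff.1 this

/-- Finite regularity of the solution of a contracting linear cohomological equation. -/
theorem cohomological_exists_contDiffOn {q b ρ : ℝ} (hqb : q < b) (hρ0 : 0 ≤ ρ) (hρ1 : ρ < 1)
    {f : ℝ → ℝ} (hf : ContDiffOn ℝ ∞ f (Icc q b)) (hm : MapsTo f (Icc q b) (Icc q b))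
    (hfq : f q = q) (hfle : ∀ x ∈ Icc q b, f x ≤ x)
    (hf' : ∀ x ∈ Icc q b, |derivWithin f (Icc q b) x| ≤ 1) (r : ℕ) :
    ∀ a w : ℝ → ℝ, ContDiffOn ℝ r a (Icc q b) → ContDiffOn ℝ r w (Icc q b) →
      (∀ x ∈ Icc q b, |a x| ≤ ρ) →
      ∃ v : ℝ → ℝ, ContDiffOn ℝ r v (Icc q b) ∧ ∀ x ∈ Icc q b, v x = w x + a x * v (f x) := by
  have hU := uniqueDiffOn_Icc hqb
  have hqI : q ∈ Icc q b := left_mem_Icc.2 hqb.le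
  have hfn : ∀ n : ℕ, ContDiffOn ℝ n f (Icc q b) := contDiffOn_infty.1 hf
  have hdf : ∀ n : ℕ, ContDiffOn ℝ n (derivWithin f (Icc q b)) (Icc q b) :=
    contDiffOn_infty.1 ((contDiffOn_infty_iff_derivWithin hU).1 hf).2
  induction r with
  | zero =>
    intro a w ha hw hab
    obtain ⟨v, hv, hve⟩ := cohomological_exists_continuous hqb.le hρ0 hρ1 hf.continuousOn hm
      ha.continuousOn hw.continuousOn hab
    exact ⟨v, contDiffOn_zero.2 hv, hve⟩
  | succ r ih =>
    intro a w ha hw hab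
    obtain ⟨v, hv, hve⟩ := ih a w (ha.of_le (by exact_mod_cast r.le_succ))
      (hw.of_le (by exact_mod_cast r.le_succ)) hab
    have hda : ContDiffOn ℝ r (derivWithin a (Icc q b)) (Icc q b) :=
      ha.derivWithin hU (by push_cast; exact le_rfl)
    have hdw : ContDiffOn ℝ r (derivWithin w (Icc q b)) (Icc q b) :=
      hw.derivWithin hU (by push_cast; exact le_rfl)
    have hanz : ((r + 1 : ℕ) : WithTop ℕ∞) ≠ 0 := by
      exact_mod_cast Nat.succ_ne_zero r
    obtain ⟨u, hu, hue⟩ := ih (fun x => a x * derivWithin f (Icc q b) x)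
      (fun x => derivWithin w (Icc q b) x + derivWithin a (Icc q b) x * v (f x))
      ((ha.of_le (by exact_mod_cast r.le_succ)).mul (hdf r))
      (hdw.add (hda.mul (hv.comp (hfn r) hm)))
      (fun x hx => by
        rw [abs_mul]
        calc |a x| * |derivWithin f (Icc q b) x| ≤ ρ * 1 :=
              mul_le_mul (hab x hx) (hf' x hx) (abs_nonneg _) hρ0
          _ = ρ := mul_one ρ)
    obtain ⟨V, hVq, hV⟩ := exists_primitive_Icc hqb.le hu.continuousOn (v q)
    obtain ⟨C, hC⟩ := isCompact_Icc.exists_bound_of_continuousOn hda.continuousOn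
    have hfd : ∀ x ∈ Icc q b, HasDerivWithinAt f (derivWithin f (Icc q b) x) (Icc q b) x :=
      fun x hx => (((hfn 1).differentiableOn (by simp)) x hx).hasDerivWithinAt
    have had : ∀ x ∈ Icc q b, HasDerivWithinAt a (derivWithin a (Icc q b) x) (Icc q b) x :=
      fun x hx => ((ha.differentiableOn hanz) x hx).hasDerivWithinAt
    have hwd : ∀ x ∈ Icc q b, HasDerivWithinAt w (derivWithin w (Icc q b) x) (Icc q b) x :=
      fun x hx => ((hw.differentiableOn hanz) x hx).hasDerivWithinAt
    have hVc : ContinuousOn V (Icc q b) := fun x hx => (hV x hx).continuousWithinAt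
    have hzero := eq_zero_of_volterra (C := C) (f := f) (a := a) (δ := fun x => V x - v x)
      (R := fun x => V x - w x - a x * V (f x))
      (R' := fun x => derivWithin a (Icc q b) x * (v (f x) - V (f x)))
      hρ1 hm hfle hab (hVc.sub hv.continuousOn)
      (fun x hx => by rw [hve x hx]; ring)
      (by rw [hfq, hVq]; nth_rw 1 [hve q hqI]; rw [hfq]; ring)
      (fun x hx => by
        have h1 := ((hV x hx).sub (hwd x hx)).sub
          ((had x hx).mul ((hV (f x) (hm hx)).comp x (hfd x hx) hm))
        refine h1.congr_deriv ?_
        rw [hue x hx]; simp only [Function.comp_apply]; ring)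
      (fun x hx => by
        rw [abs_mul, abs_sub_comm (V (f x))]
        exact mul_le_mul_of_nonneg_right (hC x hx) (abs_nonneg _))
      ((norm_nonneg _).trans (hC q hqI))
    refine ⟨V, contDiffOn_succ_of_hasDerivWithinAt hqb hV hu, fun x hx => ?_⟩
    rw [sub_eq_zero.1 (hzero x hx), sub_eq_zero.1 (hzero _ (hm hx)), hve x hx]

theorem cohomological_exists_smooth {q b ρ : ℝ} (hqb : q < b) (hρ0 : 0 ≤ ρ) (hρ1 : ρ < 1)
    {f : ℝ → ℝ} (hf : ContDiffOn ℝ ∞ f (Icc q b)) (hm : MapsTo f (Icc q b) (Icc q b))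
    (hfq : f q = q) (hfle : ∀ x ∈ Icc q b, f x ≤ x)
    (hf' : ∀ x ∈ Icc q b, |derivWithin f (Icc q b) x| ≤ 1) {a w : ℝ → ℝ}
    (ha : ContDiffOn ℝ ∞ a (Icc q b)) (hw : ContDiffOn ℝ ∞ w (Icc q b))
    (hab : ∀ x ∈ Icc q b, |a x| ≤ ρ) :
    ∃ v : ℝ → ℝ, ContDiffOn ℝ ∞ v (Icc q b) ∧ ∀ x ∈ Icc q b, v x = w x + a x * v (f x) := by
  have key := fun r : ℕ => cohomological_exists_contDiffOn hqb hρ0 hρ1 hf hm hfq hfle hf' r a w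
    (contDiffOn_infty.1 ha r) (contDiffOn_infty.1 hw r) hab
  obtain ⟨v, hv, hve⟩ := key 0
  refine ⟨v, contDiffOn_infty.2 fun r => ?_, hve⟩
  obtain ⟨u, hu, hue⟩ := key r
  exact hu.congr (cohomological_unique hρ1 hm hab hv.continuousOn hu.continuousOn hve hue)

/-- Smooth linearization of a contraction on a one-sided neighbourhood of its fixed point. -/
theorem exists_linearization_Icc {q b ρ : ℝ} (hqb : q < b) (hρ1 : ρ < 1)
    {f : ℝ → ℝ} (hf : ContDiffOn ℝ ∞ f (Icc q b)) (hm : MapsTo f (Icc q b) (Icc q b))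
    (hfq : f q = q) (hfle : ∀ x ∈ Icc q b, f x ≤ x)
    (hpos : ∀ x ∈ Icc q b, 0 < derivWithin f (Icc q b) x)
    (hlt : ∀ x ∈ Icc q b, derivWithin f (Icc q b) x ≤ ρ) :
    ∃ H H' : ℝ → ℝ, H q = 0 ∧ ContDiffOn ℝ ∞ H (Icc q b) ∧
      (∀ x ∈ Icc q b, HasDerivWithinAt H (H' x) (Icc q b) x ∧ 0 < H' x) ∧
      ∀ x ∈ Icc q b, H (f x) = derivWithin f (Icc q b) q * H x := by
  have hU := uniqueDiffOn_Icc hqb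
  have hqI : q ∈ Icc q b := left_mem_Icc.2 hqb.le
  have hdf := ((contDiffOn_infty_iff_derivWithin hU).1 hf).2
  have hfd : ∀ x ∈ Icc q b, HasDerivWithinAt f (derivWithin f (Icc q b) x) (Icc q b) x :=
    fun x hx => ((contDiffOn_infty_iff_derivWithin hU).1 hf).1 x hx |>.hasDerivWithinAt
  set μ := derivWithin f (Icc q b) q with hμ
  have hμ0 : 0 < μ := hpos q hqI
  set φ : ℝ → ℝ := fun x => Real.log (derivWithin f (Icc q b) x) - Real.log μ with hφ
  have hφs : ContDiffOn ℝ ∞ φ (Icc q b) :=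
    (hdf.log fun x hx => (hpos x hx).ne').sub contDiffOn_const
  obtain ⟨hφd, hφ's⟩ := (contDiffOn_infty_iff_derivWithin hU).1 hφs
  have habs : ∀ x ∈ Icc q b, |derivWithin f (Icc q b) x| ≤ ρ := fun x hx => by
    rw [abs_of_pos (hpos x hx)]; exact hlt x hx
  obtain ⟨v, hv, hve⟩ := cohomological_exists_smooth hqb ((hpos q hqI).le.trans (hlt q hqI)) hρ1
    hf hm hfq hfle (fun x hx => (habs x hx).trans hρ1.le) hdf hφ's habs
  obtain ⟨ψ, hψq, hψ⟩ := exists_primitive_Icc hqb.le hv.continuousOn 0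
  have hψs := contDiffOn_infty_of_hasDerivWithinAt hqb hψ hv
  have hψe := eq_zero_of_hasDerivWithinAt_zero (q := q) (b := b)
    (R := fun x => ψ x - φ x - ψ (f x)) (by simp [hφ, hfq, hψq, ← hμ]) (fun x hx => by
      have h1 := ((hψ x hx).sub (hφd x hx).hasDerivWithinAt).sub
        ((hψ (f x) (hm hx)).comp x (hfd x hx) hm)
      refine h1.congr_deriv ?_
      rw [hve x hx]; ring)
  have hE : ContDiffOn ℝ ∞ (fun x => Real.exp (ψ x)) (Icc q b) := hψs.exp
  obtain ⟨H, hHq, hH⟩ := exists_primitive_Icc hqb.le hE.continuousOn 0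
  refine ⟨H, fun x => Real.exp (ψ x), hHq, contDiffOn_infty_of_hasDerivWithinAt hqb hH hE,
    fun x hx => ⟨hH x hx, Real.exp_pos _⟩, ?_⟩
  have hHe := eq_zero_of_hasDerivWithinAt_zero (q := q) (b := b)
    (R := fun x => H (f x) - μ * H x) (by simp [hfq, hHq]) (fun x hx => by
      have h1 := ((hH (f x) (hm hx)).comp x (hfd x hx) hm).sub ((hH x hx).const_mul μ)
      refine h1.congr_deriv ?_
      have h2 : ψ x = Real.log (derivWithin f (Icc q b) x) - Real.log μ + ψ (f x) := by
        have := hψe x hx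
        simp only [hφ] at this
        linarith
      rw [h2, Real.exp_add, Real.exp_sub, Real.exp_log (hpos x hx), Real.exp_log hμ0]
      field_simp
      ring)
  exact fun x hx => sub_eq_zero.1 (hHe x hx)

theorem IsCrDiffeoOnIco.hasDerivWithinAt {f : ℝ → ℝ} {q q₁ : ℝ}
    (hf : IsCrDiffeoOnIco ∞ f q q₁) {x : ℝ} (hx : x ∈ Ico q q₁) :
    HasDerivWithinAt f (derivWithin f (Ico q q₁) x) (Ico q q₁) x :=
  ((hf.2.1.differentiableOn (by simp)) x hx).hasDerivWithinAt

theorem strictMonoOn_Ico_of_derivWithin_pos {f : ℝ → ℝ} {q q₁ : ℝ}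
    (hc : ContinuousOn f (Ico q q₁)) (hd : ∀ x ∈ Ico q q₁, 0 < derivWithin f (Ico q q₁) x) :
    StrictMonoOn f (Ico q q₁) := by
  refine strictMonoOn_of_deriv_pos (convex_Ico q q₁) hc fun x hx => ?_
  rw [← derivWithin_of_mem_nhds (mem_interior_iff_mem_nhds.1 hx)]
  exact hd x (interior_subset hx)

theorem IsCrDiffeoOnIco.strictMonoOn {f : ℝ → ℝ} {q q₁ : ℝ}
    (hf : IsCrDiffeoOnIco ∞ f q q₁) : StrictMonoOn f (Ico q q₁) :=
  strictMonoOn_Ico_of_derivWithin_pos hf.2.1.continuousOn hf.2.2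

theorem IsCrDiffeoOnIco.iterate {f : ℝ → ℝ} {q q₁ : ℝ} (hf : IsCrDiffeoOnIco ∞ f q q₁) (n : ℕ) :
    IsCrDiffeoOnIco ∞ f^[n] q q₁ := by
  induction n with
  | zero =>
    refine ⟨bijOn_id _, contDiffOn_id, fun x hx => ?_⟩
    rw [Function.iterate_zero, derivWithin_id _ _ (uniqueDiffOn_Ico q q₁ x hx)]
    exact one_pos
  | succ n ih =>
    rw [Function.iterate_succ]
    refine ⟨ih.1.comp hf.1, ih.2.1.comp hf.2.1 hf.1.mapsTo, fun x hx => ?_⟩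
    rw [((ih.hasDerivWithinAt (hf.1.mapsTo hx)).comp x (hf.hasDerivWithinAt hx)
      hf.1.mapsTo).derivWithin (uniqueDiffOn_Ico q q₁ x hx)]
    exact mul_pos (ih.2.2 _ (hf.1.mapsTo hx)) (hf.2.2 x hx)

/-- A diffeomorphism with derivative less than one at its fixed point contracts a one-sided
neighbourhood of that point. -/
theorem IsCrDiffeoOnIco.exists_contracting_Icc {f : ℝ → ℝ} {q q₁ : ℝ} (hq : q < q₁)
    (hf : IsCrDiffeoOnIco ∞ f q q₁) (hfq : f q = q) (hf'q : derivWithin f (Ico q q₁) q < 1) :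
    ∃ b ρ : ℝ, q < b ∧ b < q₁ ∧ ρ < 1 ∧ ∀ x ∈ Icc q b, f x ≤ x ∧
      derivWithin f (Icc q b) x = derivWithin f (Ico q q₁) x ∧
      derivWithin f (Icc q b) x ≤ ρ := by
  obtain ⟨ρ, hρ, hρ1⟩ := exists_between hf'q
  have hcont := hf.2.1.continuousOn_derivWithin (uniqueDiffOn_Ico q q₁) (by simp)
  have hqI : q ∈ Ico q q₁ := left_mem_Ico.2 hq
  have hev : ∀ᶠ x in 𝓝[≥] q, derivWithin f (Ico q q₁) x < ρ ∧ x < q₁ := by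
    rw [← nhdsWithin_Ico_eq_nhdsGE hq]
    exact ((hcont q hqI).eventually_lt_const hρ).and
      (eventually_nhdsWithin_of_forall fun x hx => hx.2)
  obtain ⟨b, hb, hsub⟩ := (mem_nhdsGE_iff_exists_Icc_subset).1 hev
  have hbq : b < q₁ := (hsub (right_mem_Icc.2 (le_of_lt hb))).2
  have hII : Icc q b ⊆ Ico q q₁ := fun x hx => ⟨hx.1, hx.2.trans_lt hbq⟩
  have hd : ∀ x ∈ Icc q b, HasDerivWithinAt f (derivWithin f (Ico q q₁) x) (Icc q b) x :=
    fun x hx => (hf.hasDerivWithinAt (hII hx)).mono hII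
  have he : ∀ x ∈ Icc q b, derivWithin f (Icc q b) x = derivWithin f (Ico q q₁) x :=
    fun x hx => (hd x hx).derivWithin (uniqueDiffOn_Icc hb x hx)
  refine ⟨b, ρ, hb, hbq, hρ1, fun x hx => ⟨?_, he x hx, he x hx ▸ (hsub hx).1.le⟩⟩
  have h := (convex_Icc q b).norm_image_sub_le_of_norm_hasDerivWithin_le (C := 1) hd
    (fun y hy => by
      rw [Real.norm_eq_abs, abs_of_pos (hf.2.2 y (hII hy))]
      exact (hsub hy).1.le.trans hρ1.le) (left_mem_Icc.2 (le_of_lt hb)) hx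
  rw [hfq, Real.norm_eq_abs, Real.norm_eq_abs, abs_of_nonneg (sub_nonneg.2 hx.1), one_mul] at h
  linarith [le_abs_self (f x - q)]

/-- Smooth linearization of a diffeomorphism on the whole basin of an attracting fixed point. -/
theorem IsCrDiffeoOnIco.exists_linearization {f : ℝ → ℝ} {q q₁ : ℝ} (hq : q < q₁)
    (hf : IsCrDiffeoOnIco ∞ f q q₁) (hfq : f q = q) (hf'q : derivWithin f (Ico q q₁) q < 1) :
    ∃ p₁ ∈ Ioc q q₁, ∃ H : ℝ → ℝ, BijOn H (Ico q p₁) (Ici 0) ∧ ContDiffOn ℝ ∞ H (Ico q p₁) ∧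
      (∀ x ∈ Ico q p₁, 0 < derivWithin H (Ico q p₁) x) ∧ H q = 0 ∧
      ∀ x ∈ Ico q p₁, f x ∈ Ico q p₁ ∧ H (f x) = derivWithin f (Ico q q₁) q * H x := by
  obtain ⟨b, ρ, hqb, hbq, hρ1, hb⟩ := hf.exists_contracting_Icc hq hfq hf'q
  have hII : Icc q b ⊆ Ico q q₁ := fun x hx => ⟨hx.1, hx.2.trans_lt hbq⟩
  have hqI : q ∈ Ico q q₁ := left_mem_Ico.2 hq
  have hmI : MapsTo f (Icc q b) (Icc q b) :=
    fun x hx => ⟨(hf.1.mapsTo (hII hx)).1, (hb x hx).1.trans hx.2⟩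
  have hit : ∀ n, MapsTo f^[n] (Ico q q₁) (Ico q q₁) := fun n => (hf.iterate n).1.mapsTo
  obtain ⟨h, h', hhq, hhs, hhd, hhf⟩ := exists_linearization_Icc hqb hρ1 (hf.2.1.mono hII) hmI hfq
    (fun x hx => (hb x hx).1) (fun x hx => (hb x hx).2.1 ▸ hf.2.2 x (hII hx))
    (fun x hx => (hb x hx).2.2)
  rw [(hb q (left_mem_Icc.2 hqb.le)).2.1] at hhf
  set μ := derivWithin f (Ico q q₁) q with hμ
  have hμ0 : 0 < μ := hf.2.2 q hqI
  have hhit : ∀ n, ∀ x ∈ Icc q b, f^[n] x ∈ Icc q b ∧ h (f^[n] x) = μ ^ n * h x := by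
    intro n
    induction n with
    | zero => intro x hx; exact ⟨hx, by simp⟩
    | succ n ih =>
      intro x hx
      rw [Function.iterate_succ_apply']
      refine ⟨hmI (ih x hx).1, ?_⟩
      rw [hhf _ (ih x hx).1, (ih x hx).2, pow_succ]; ring
  set B : Set ℝ := {x | x ∈ Ico q q₁ ∧ ∃ n, f^[n] x < b} with hB
  have hqB : q ∈ B := ⟨hqI, 0, hqb⟩
  have hBbdd : BddAbove B := ⟨q₁, fun x hx => (hx : x ∈ B).1.2.le⟩
  have hopen : ∀ x ∈ B, ∃ y ∈ B, x < y := by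
    rintro x ⟨hx, n, hn⟩
    have h1 : ∀ᶠ y in 𝓝[Ico q q₁] x, f^[n] y < b :=
      ((hf.iterate n).2.1.continuousOn x hx).eventually_lt_const hn
    have hsub : Ioo x q₁ ⊆ Ico q q₁ := fun y hy => ⟨hx.1.trans hy.1.le, hy.2⟩
    have h2 : ∀ᶠ y in 𝓝[>] x, f^[n] y < b ∧ y ∈ Ico q q₁ ∧ x < y := by
      rw [← nhdsWithin_Ioo_eq_nhdsGT hx.2]
      exact (h1.filter_mono (nhdsWithin_mono _ hsub)).and
        (eventually_nhdsWithin_of_forall fun y hy => ⟨hsub hy, hy.1⟩)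
    obtain ⟨y, hy1, hy2, hy3⟩ := h2.exists
    exact ⟨y, ⟨hy2, n, hy1⟩, hy3⟩
  have hdown : ∀ x ∈ B, ∀ y ∈ Icc q x, y ∈ B := by
    rintro x ⟨hx, n, hn⟩ y hy
    have hy' : y ∈ Ico q q₁ := ⟨hy.1, hy.2.trans_lt hx.2⟩
    exact ⟨hy', n, ((hf.iterate n).strictMonoOn.monotoneOn hy' hx hy.2).trans_lt hn⟩
  have hBI : Ico q (sSup B) = B := by
    ext x
    constructor
    · intro hx
      obtain ⟨y, hy, hxy⟩ := exists_lt_of_lt_csSup ⟨q, hqB⟩ hx.2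
      exact hdown y hy x ⟨hx.1, hxy.le⟩
    · intro hx
      obtain ⟨y, hy, hxy⟩ := hopen x hx
      exact ⟨hx.1.1, hxy.trans_le (le_csSup hBbdd hy)⟩
  obtain ⟨p₁, hp₁⟩ : ∃ p, p = sSup B := ⟨_, rfl⟩
  rw [← hp₁] at hBI
  have hqp : q < p₁ := by
    have : q ∈ Ico q p₁ := hBI ▸ hqB
    exact this.2
  have hpq : p₁ ≤ q₁ := hp₁ ▸ csSup_le ⟨q, hqB⟩ fun x hx => hx.1.2.le
  have hpsub : Ico q p₁ ⊆ Ico q q₁ := Ico_subset_Ico_right hpq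
  have hU := uniqueDiffOn_Ico q p₁
  have hfB : ∀ x ∈ B, f x ∈ B := by
    rintro x ⟨hx, n, hn⟩
    refine ⟨hf.1.mapsTo hx, n, ?_⟩
    rw [← Function.iterate_succ_apply, Function.iterate_succ_apply']
    exact ((hb _ ⟨(hit n hx).1, hn.le⟩).1).trans_lt hn
  classical
  let H : ℝ → ℝ := fun x => if hx : ∃ n, f^[n] x < b then
    (μ ^ Nat.find hx)⁻¹ * h (f^[Nat.find hx] x) else 0
  have hH : ∀ n, ∀ x ∈ Ico q q₁, f^[n] x < b → H x = (μ ^ n)⁻¹ * h (f^[n] x) := by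
    intro n x hx hn
    have hex : ∃ n, f^[n] x < b := ⟨n, hn⟩
    simp only [H, dif_pos hex]
    obtain ⟨k, hk⟩ := Nat.exists_eq_add_of_le (Nat.find_min' hex hn)
    have h1 : f^[Nat.find hex] x ∈ Icc q b := ⟨(hit _ hx).1, (Nat.find_spec hex).le⟩
    have h2 : f^[n] x = f^[k] (f^[Nat.find hex] x) := by
      rw [← Function.iterate_add_apply, add_comm, ← hk]
    have h3 : μ ^ n = μ ^ Nat.find hex * μ ^ k := by rw [← pow_add, ← hk]
    rw [h2, (hhit k _ h1).2, h3]
    field_simp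
  have hHloc : ∀ n, ∀ x ∈ Ico q p₁, f^[n] x < b →
      ∀ᶠ y in 𝓝[Ico q p₁] x, H y = (μ ^ n)⁻¹ * h (f^[n] y) := by
    intro n x hx hn
    have h1 : ∀ᶠ y in 𝓝[Ico q p₁] x, f^[n] y < b :=
      (((hf.iterate n).2.1.continuousOn x (hpsub hx)).mono hpsub).eventually_lt_const hn
    filter_upwards [h1, self_mem_nhdsWithin] with y hy hyI
    exact hH n y (hpsub hyI) hy
  have hmaps : ∀ n, ∀ x ∈ Ico q p₁, f^[n] x < b → ∃ s ∈ 𝓝[Ico q p₁] x,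
      x ∈ s ∧ s ⊆ Ico q p₁ ∧ MapsTo f^[n] s (Icc q b) := by
    intro n x hx hn
    have h1 : ∀ᶠ y in 𝓝[Ico q p₁] x, f^[n] y < b :=
      (((hf.iterate n).2.1.continuousOn x (hpsub hx)).mono hpsub).eventually_lt_const hn
    exact ⟨{y | f^[n] y < b} ∩ Ico q p₁, inter_mem h1 self_mem_nhdsWithin, ⟨hn, hx⟩,
      inter_subset_right, fun y hy => ⟨(hit n (hpsub hy.2)).1, (le_of_lt hy.1)⟩⟩
  have hHs : ContDiffOn ℝ ∞ H (Ico q p₁) := by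
    intro x hx
    obtain ⟨n, hn⟩ : ∃ n, f^[n] x < b := (hBI ▸ hx : x ∈ B).2
    obtain ⟨s, hs, hxs, hsI, hms⟩ := hmaps n x hx hn
    have h1 : ContDiffWithinAt ℝ ∞ (fun y => (μ ^ n)⁻¹ * h (f^[n] y)) s x :=
      contDiffWithinAt_const.mul (((hhs _ (hms hxs)).comp x
        (((hf.iterate n).2.1 x (hpsub hx)).mono (hsI.trans hpsub)) hms))
    exact (h1.mono_of_mem_nhdsWithin hs).congr_of_eventuallyEq (hHloc n x hx hn)
      (hH n x (hpsub hx) hn)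
  have hHd : ∀ x ∈ Ico q p₁, 0 < derivWithin H (Ico q p₁) x := by
    intro x hx
    obtain ⟨n, hn⟩ : ∃ n, f^[n] x < b := (hBI ▸ hx : x ∈ B).2
    obtain ⟨s, hs, hxs, hsI, hms⟩ := hmaps n x hx hn
    have h1 := (((hhd _ (hms hxs)).1.comp x (((hf.iterate n).hasDerivWithinAt (hpsub hx)).mono
      (hsI.trans hpsub)) hms).const_mul (μ ^ n)⁻¹).mono_of_mem_nhdsWithin hs
    have h2 := h1.congr_of_eventuallyEq (hHloc n x hx hn) (hH n x (hpsub hx) hn)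
    rw [h2.derivWithin (hU x hx)]
    exact mul_pos (by positivity)
      (mul_pos (hhd _ (hms hxs)).2 ((hf.iterate n).2.2 x (hpsub hx)))
  have hHq : H q = 0 := by
    rw [hH 0 q hqI hqb]
    simp [hhq]
  have hHf : ∀ x ∈ Ico q p₁, f x ∈ Ico q p₁ ∧ H (f x) = μ * H x := by
    intro x hx
    have hxB : x ∈ B := hBI ▸ hx
    refine ⟨hBI ▸ hfB x hxB, ?_⟩
    obtain ⟨n, hn⟩ := hxB.2
    have h1 : f^[n] x ∈ Icc q b := ⟨(hit n (hpsub hx)).1, hn.le⟩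
    have h2 : f^[n] (f x) = f (f^[n] x) := by
      rw [← Function.iterate_succ_apply, Function.iterate_succ_apply']
    rw [hH n x (hpsub hx) hn, hH n (f x) (hf.1.mapsTo (hpsub hx))
      (by rw [h2]; exact (hb _ h1).1.trans_lt hn), h2, hhf _ h1]
    ring
  have hHm := strictMonoOn_Ico_of_derivWithin_pos hHs.continuousOn hHd
  have hHit : ∀ n, ∀ x ∈ Ico q p₁, H (f^[n] x) = μ ^ n * H x := by
    intro n
    induction n with
    | zero => intro x _; simp
    | succ n ih =>
      intro x hx
      rw [Function.iterate_succ_apply, ih _ (hHf x hx).1, (hHf x hx).2, pow_succ]; ring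
  refine ⟨p₁, ⟨hqp, hpq⟩, H, ⟨?_, hHm.injOn, ?_⟩, hHs, hHd, hHq, hHf⟩
  · intro x hx
    exact hHq ▸ hHm.monotoneOn ⟨le_rfl, hqp⟩ hx hx.1
  · intro y hy
    obtain ⟨x₀, hx₀⟩ := exists_between hqp
    have hx₀I : x₀ ∈ Ico q p₁ := ⟨hx₀.1.le, hx₀.2⟩
    have hpos : 0 < H x₀ := hHq ▸ hHm ⟨le_rfl, hqp⟩ hx₀I hx₀.1
    have ht : Tendsto (fun n : ℕ => μ ^ n * y) atTop (𝓝 0) := by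
      simpa using (tendsto_pow_atTop_nhds_zero_of_lt_one hμ0.le hf'q).mul_const y
    obtain ⟨n, hn⟩ := (ht.eventually_lt_const hpos).exists
    have hsubI : Icc q x₀ ⊆ Ico q p₁ := fun z hz => ⟨hz.1, hz.2.trans_lt hx₀.2⟩
    obtain ⟨z, hz, hzy⟩ := intermediate_value_Icc hx₀.1.le (hHs.continuousOn.mono hsubI)
      (show μ ^ n * y ∈ Icc (H q) (H x₀) from
        ⟨hHq ▸ mul_nonneg (by positivity) hy, hn.le⟩)
    obtain ⟨x, hx, hxz⟩ := (hf.iterate n).1.surjOn (hpsub (hsubI hz))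
    have hzB : z ∈ B := hBI ▸ hsubI hz
    have hxB : x ∈ B := by
      obtain ⟨m, hm⟩ := hzB.2
      exact ⟨hx, m + n, by rwa [Function.iterate_add_apply, hxz]⟩
    have hxI : x ∈ Ico q p₁ := hBI ▸ hxB
    refine ⟨x, hxI, ?_⟩
    have := hHit n x hxI
    rw [hxz, hzy] at this
    exact (mul_left_cancel₀ (pow_pos hμ0 n).ne' this).symm

section Renormalization

variable {K : ℝ → ℝ}

theorem iterate_pos_le (hK : ∀ x, 0 < x → 0 < K x ∧ K x < x) (n : ℕ) :
    ∀ x, 0 < x → 0 < K^[n] x ∧ K^[n] x ≤ x := by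
  induction n with
  | zero => exact fun x hx => ⟨hx, le_rfl⟩
  | succ n ih =>
    intro x hx
    rw [Function.iterate_succ_apply']
    have h := ih x hx
    exact ⟨(hK _ h.1).1, (hK _ h.1).2.le.trans h.2⟩

theorem iterate_pow_renormalization (hK : ∀ x, 0 < x → 0 < K x ∧ K x < x) {l : ℕ} {μ : ℝ}
    (hμ0 : 0 < μ) (hrel : ∀ x, 0 < x → μ * K x = K^[l] (μ * x)) (n : ℕ) :
    ∀ x, 0 < x → K^[l ^ n] (μ ^ n * x) = μ ^ n * K x := by
  have h1 : ∀ j x, 0 < x → K^[l * j] (μ * x) = μ * K^[j] x := by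
    intro j
    induction j with
    | zero => intro x _; simp
    | succ j ih =>
      intro x hx
      rw [Nat.mul_succ, Nat.add_comm, Function.iterate_add_apply, ih x hx,
        Function.iterate_succ_apply', hrel _ (iterate_pos_le hK j x hx).1]
  induction n with
  | zero => intro x _; simp
  | succ n ih =>
    intro x hx
    rw [pow_succ' l, pow_succ' μ, mul_assoc, h1 _ _ (by positivity), ih x hx, mul_assoc]

theorem abs_iterate_sub_le (hK : ∀ x, 0 < x → 0 < K x ∧ K x < x) {φ : ℝ → ℝ} {a ε y : ℝ}
    (hy : 0 < y) (h : ∀ z, 0 < z → z ≤ y → |φ (K z) - φ z - a| ≤ ε) (N : ℕ) :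
    |φ (K^[N] y) - φ y - N * a| ≤ N * ε := by
  induction N with
  | zero => simp
  | succ N ih =>
    have hN := iterate_pos_le hK N y hy
    rw [Function.iterate_succ_apply']
    have e : φ (K (K^[N] y)) - φ y - ((N + 1 : ℕ) : ℝ) * a =
        (φ (K^[N] y) - φ y - N * a) + (φ (K (K^[N] y)) - φ (K^[N] y) - a) := by
      push_cast; ring
    rw [e]
    refine (abs_add_le _ _).trans ?_
    have := h _ hN.1 hN.2
    push_cast
    linarith

/-- A map renormalized by an affine Baumslag–Solitar relation is not infinitely tangent to the
identity. -/
theorem not_flat_of_renormalization (hK : ∀ x, 0 < x → 0 < K x ∧ K x < x) {l : ℕ} {μ : ℝ}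
    (hμ0 : 0 < μ) (hμ1 : μ < 1) (hrel : ∀ x, 0 < x → μ * K x = K^[l] (μ * x)) :
    ¬ ∀ m : ℕ, (fun x => x - K x) =O[𝓝[>] 0] fun x : ℝ => x ^ m := by
  intro hflat
  obtain ⟨m, hm⟩ : ∃ m : ℕ, (l : ℝ) * μ ^ m < 1 := by
    have : Tendsto (fun m : ℕ => (l : ℝ) * μ ^ m) atTop (𝓝 0) := by
      simpa using (tendsto_pow_atTop_nhds_zero_of_lt_one hμ0.le hμ1).const_mul (l : ℝ)
    exact (this.eventually_lt_const one_pos).exists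
  obtain ⟨C, hC⟩ := (hflat (m + 1)).bound
  obtain ⟨η, hη0, hη⟩ := (mem_nhdsGT_iff_exists_Ioo_subset).1 hC
  have hC' : ∀ z, 0 < z → z < η → z - K z ≤ C * z ^ (m + 1) := by
    intro z hz hzη
    have : ‖z - K z‖ ≤ C * ‖z ^ (m + 1)‖ := hη ⟨hz, hzη⟩
    rw [Real.norm_eq_abs, Real.norm_eq_abs, abs_of_pos (sub_pos.2 (hK z hz).2),
      abs_of_pos (by positivity)] at this
    exact this
  have hη0' : (0 : ℝ) < η := hη0
  have hCpos : 0 < C := by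
    have h1 := hC' (η / 2) (by positivity) (by linarith)
    have h2 := (hK (η / 2) (by positivity)).2
    by_contra hneg
    have : C * (η / 2) ^ (m + 1) ≤ 0 := mul_nonpos_of_nonpos_of_nonneg (not_lt.1 hneg)
      (by positivity)
    linarith
  have hbound : ∀ n : ℕ, η / 2 - K (η / 2) ≤ C * (η / 2) ^ (m + 1) * (l * μ ^ m) ^ n := by
    intro n
    have hx : 0 < η / 2 := by positivity
    have hμn : 0 < μ ^ n := by positivity
    have hle : μ ^ n * (η / 2) ≤ η / 2 :=
      mul_le_of_le_one_left hx.le (pow_le_one₀ hμ0.le hμ1.le)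
    have h := abs_iterate_sub_le hK (φ := fun z => z) (a := 0)
      (ε := C * (μ ^ n * (η / 2)) ^ (m + 1)) (y := μ ^ n * (η / 2)) (by positivity)
      (fun z hz hzy => by
        rw [sub_zero, abs_sub_comm, abs_of_pos (sub_pos.2 (hK z hz).2)]
        refine (hC' z hz (by linarith)).trans ?_
        gcongr) (l ^ n)
    rw [iterate_pow_renormalization hK hμ0 hrel n _ hx] at h
    have h2 := (neg_le_abs _).trans h
    push_cast at h2
    have h3 : μ ^ n * (η / 2 - K (η / 2)) ≤
        μ ^ n * (C * (η / 2) ^ (m + 1) * (l * μ ^ m) ^ n) := by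
      calc μ ^ n * (η / 2 - K (η / 2)) ≤ l ^ n * (C * (μ ^ n * (η / 2)) ^ (m + 1)) := by
            linarith
        _ = _ := by ring
    exact le_of_mul_le_mul_left h3 hμn
  have hlim : Tendsto (fun n : ℕ => C * (η / 2) ^ (m + 1) * (l * μ ^ m) ^ n) atTop (𝓝 0) := by
    simpa using (tendsto_pow_atTop_nhds_zero_of_lt_one (by positivity) hm).const_mul
      (C * (η / 2) ^ (m + 1))
  have := ge_of_tendsto' hlim hbound
  have := (hK (η / 2) (by positivity)).2
  linarith

theorem tendsto_inv_pow_sub_s6 {s : ℕ} {c : ℝ} (hs : 1 ≤ s)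
    (hK : ∀ x, 0 < x → 0 < K x ∧ K x < x)
    (hlim : Tendsto (fun x => (x - K x) / x ^ (s + 1)) (𝓝[>] 0) (𝓝 c)) :
    Tendsto (fun x => (K x ^ s)⁻¹ - (x ^ s)⁻¹) (𝓝[>] 0) (𝓝 (s * c)) := by
  have hx0 : Tendsto (fun x : ℝ => x) (𝓝[>] 0) (𝓝 0) := tendsto_nhdsWithin_of_tendsto_nhds tendsto_id
  have ht : Tendsto (fun x => K x / x) (𝓝[>] 0) (𝓝 1) := by
    have h1 : Tendsto (fun x => 1 - (x - K x) / x ^ (s + 1) * x ^ s) (𝓝[>] 0) (𝓝 (1 - c * 0 ^ s)) :=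
      (hlim.mul (hx0.pow s)).const_sub 1
    rw [zero_pow (by omega), mul_zero, sub_zero] at h1
    refine h1.congr' ?_
    filter_upwards [self_mem_nhdsWithin] with x hx
    have hx' : (0 : ℝ) < x := hx
    field_simp
    ring
  have h2 : Tendsto (fun x => (x - K x) / x ^ (s + 1) *
      (((K x / x) ^ s)⁻¹ * ∑ i ∈ Finset.range s, (K x / x) ^ i)) (𝓝[>] 0)
      (𝓝 (c * (((1 : ℝ) ^ s)⁻¹ * ∑ i ∈ Finset.range s, (1 : ℝ) ^ i))) :=
    hlim.mul (((ht.pow s).inv₀ (by simp)).mul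
      (tendsto_finsetSum _ fun i _ => ht.pow i))
  simp only [one_pow, inv_one, Finset.sum_const, Finset.card_range, nsmul_eq_mul, mul_one,
    one_mul] at h2
  rw [mul_comm]
  refine h2.congr' ?_
  filter_upwards [self_mem_nhdsWithin] with x hx
  have hx' : (0 : ℝ) < x := hx
  have hKx := (hK x hx').1
  have hg := mul_neg_geom_sum (K x / x) s
  have e1 : x - K x = x * (1 - K x / x) := by field_simp
  have e2 : x * (1 - K x / x) / x ^ (s + 1) *
      (((K x / x) ^ s)⁻¹ * ∑ i ∈ Finset.range s, (K x / x) ^ i) =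
      (x ^ s)⁻¹ * ((K x / x) ^ s)⁻¹ *
        ((1 - K x / x) * ∑ i ∈ Finset.range s, (K x / x) ^ i) := by
    rw [pow_succ]; field_simp
  rw [e1, e2, hg, div_pow]
  field_simp

/-- In the coordinate `x ↦ x ^ (-s)`, a map renormalized by a linear contraction is an exact
translation. -/
theorem inv_pow_translation_of_renormalization {l : ℕ} (hl : 2 ≤ l) {s : ℕ} {c μ : ℝ} (hs : 1 ≤ s)
    (hc : c ≠ 0) (hμ0 : 0 < μ) (hμ1 : μ < 1) (hK : ∀ x, 0 < x → 0 < K x ∧ K x < x)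
    (hrel : ∀ x, 0 < x → μ * K x = K^[l] (μ * x))
    (hlim : Tendsto (fun x => (x - K x) / x ^ (s + 1)) (𝓝[>] 0) (𝓝 c)) :
    ∃ a : ℝ, 0 < a ∧ μ ^ s = 1 / l ∧ ∀ x, 0 < x → (K x ^ s)⁻¹ = (x ^ s)⁻¹ + a := by
  have hl0 : (0 : ℝ) < l := by positivity
  obtain ⟨a, ha⟩ : ∃ a, a = s * c := ⟨_, rfl⟩
  have ha0 : a ≠ 0 := ha ▸ mul_ne_zero (by positivity) hc
  have hlim' := tendsto_inv_pow_sub_s6 hs hK hlim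
  rw [← ha] at hlim'
  have hδ : ∀ ε > 0, ∃ η > 0, ∀ z, 0 < z → z < η →
      |(K z ^ s)⁻¹ - (z ^ s)⁻¹ - a| ≤ ε := by
    intro ε hε
    have h1 : ∀ᶠ x in 𝓝[>] (0 : ℝ), |(K x ^ s)⁻¹ - (x ^ s)⁻¹ - a| ≤ ε :=
      ((Metric.tendsto_nhds.1 hlim') ε hε).mono fun x hx => le_of_lt hx
    obtain ⟨η, hη0, hη⟩ := (mem_nhdsGT_iff_exists_Ioo_subset).1 h1
    exact ⟨η, hη0, fun z hz hzη => hη ⟨hz, hzη⟩⟩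
  have hμs : μ ^ s = 1 / l := by
    have e1 : Tendsto (fun x => (μ ^ s)⁻¹ * ((K x ^ s)⁻¹ - (x ^ s)⁻¹)) (𝓝[>] 0)
        (𝓝 ((μ ^ s)⁻¹ * a)) := hlim'.const_mul _
    have e2 : Tendsto (fun x => (μ ^ s)⁻¹ * ((K x ^ s)⁻¹ - (x ^ s)⁻¹)) (𝓝[>] 0)
        (𝓝 (l * a)) := by
      refine Metric.tendsto_nhds.2 fun ε hε => ?_
      obtain ⟨η, hη0, hη⟩ := hδ (ε / (2 * l)) (by positivity)
      filter_upwards [Ioo_mem_nhdsGT hη0] with x hx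
      have hμx : 0 < μ * x := mul_pos hμ0 hx.1
      have hμx' : μ * x ≤ x := mul_le_of_le_one_left hx.1.le hμ1.le
      have h := abs_iterate_sub_le hK (φ := fun z => (z ^ s)⁻¹) hμx
        (fun z hz hzy => hη z hz (by linarith [hx.2])) l
      rw [← hrel x hx.1] at h
      rw [Real.dist_eq]
      have e3 : (μ ^ s)⁻¹ * ((K x ^ s)⁻¹ - (x ^ s)⁻¹) =
          ((μ * K x) ^ s)⁻¹ - ((μ * x) ^ s)⁻¹ := by
        rw [mul_pow, mul_pow, mul_inv, mul_inv]; ring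
      rw [e3]
      refine h.trans_lt ?_
      have : (l : ℝ) * (ε / (2 * l)) = ε / 2 := by field_simp
      rw [this]; linarith
    have e4 := mul_right_cancel₀ ha0 (tendsto_nhds_unique e1 e2)
    rw [← inv_inv (μ ^ s), e4, one_div]
  have htrans : ∀ x, 0 < x → (K x ^ s)⁻¹ = (x ^ s)⁻¹ + a := by
    intro x hx
    have hle : ∀ ε > 0, |(K x ^ s)⁻¹ - (x ^ s)⁻¹ - a| ≤ ε := by
      intro ε hε
      obtain ⟨η, hη0, hη⟩ := hδ ε hε
      have ht : Tendsto (fun n : ℕ => μ ^ n * x) atTop (𝓝 0) := by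
        simpa using (tendsto_pow_atTop_nhds_zero_of_lt_one hμ0.le hμ1).mul_const x
      obtain ⟨n, hn⟩ := (ht.eventually_lt_const hη0).exists
      have h := abs_iterate_sub_le hK (φ := fun z => (z ^ s)⁻¹) (y := μ ^ n * x) (by positivity)
        (fun z hz hzy => hη z hz (by linarith)) (l ^ n)
      rw [iterate_pow_renormalization hK hμ0 hrel n x hx] at h
      have hμns : (μ ^ n) ^ s = ((l : ℝ) ^ n)⁻¹ := by
        rw [← pow_mul, mul_comm, pow_mul, hμs, one_div, inv_pow]
      have e3 : ((μ ^ n * K x) ^ s)⁻¹ - ((μ ^ n * x) ^ s)⁻¹ - ((l ^ n : ℕ) : ℝ) * a =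
          (l : ℝ) ^ n * ((K x ^ s)⁻¹ - (x ^ s)⁻¹ - a) := by
        rw [mul_pow, mul_pow, mul_inv, mul_inv, hμns, inv_inv]; push_cast; ring
      simp only [e3] at h
      rw [abs_mul, abs_of_pos (by positivity)] at h
      push_cast at h
      exact le_of_mul_le_mul_left h (by positivity)
    have h0 : |(K x ^ s)⁻¹ - (x ^ s)⁻¹ - a| ≤ 0 :=
      le_of_forall_pos_le_add fun ε hε => by rw [zero_add]; exact hle ε hε
    linarith [abs_nonpos_iff.1 h0]
  refine ⟨a, ?_, hμs, htrans⟩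
  have h1 := htrans 1 one_pos
  have hK1 := hK 1 one_pos
  have h2 : K 1 ^ s < 1 := pow_lt_one₀ hK1.1.le hK1.2 (by omega)
  have h3 : 1 < (K 1 ^ s)⁻¹ := (one_lt_inv₀ (pow_pos hK1.1 s)).2 h2
  rw [h1, one_pow, inv_one] at h3
  linarith

end Renormalization

theorem taylorWithinEval_eq_zero {D : ℝ → ℝ} {S : Set ℝ} {q : ℝ} (n : ℕ)
    (h : ∀ k ≤ n, iteratedDerivWithin k D S q = 0) (x : ℝ) : taylorWithinEval D n S q x = 0 := by
  induction n with
  | zero => simpa using h 0 le_rfl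
  | succ n ih =>
    rw [taylorWithinEval_succ, ih fun k hk => h k (hk.trans n.le_succ), h _ le_rfl]
    simp

/-- A smooth function vanishing to second order at the left end point of an interval either has
a nonzero leading Taylor term there, or is flat. -/
theorem exists_leading_term_or_flat {D : ℝ → ℝ} {q q₁ : ℝ} (hq : q < q₁)
    (hD : ContDiffOn ℝ ∞ D (Ico q q₁)) (h0 : D q = 0) (h1 : derivWithin D (Ico q q₁) q = 0) :
    (∃ s : ℕ, 1 ≤ s ∧ ∃ c : ℝ, c ≠ 0 ∧
      Tendsto (fun x => D x / (x - q) ^ (s + 1)) (𝓝[>] q) (𝓝 c)) ∨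
    ∀ m : ℕ, D =O[𝓝[>] q] fun x => (x - q) ^ m := by
  have hqI : q ∈ Ico q q₁ := left_mem_Ico.2 hq
  have hfil : 𝓝[>] q ≤ 𝓝[Ico q q₁] q := by
    rw [nhdsWithin_Ico_eq_nhdsGE hq]
    exact nhdsWithin_mono _ Ioi_subset_Ici_self
  have hT := fun n : ℕ =>
    (taylor_isLittleO (convex_Ico q q₁) hqI (contDiffOn_infty.1 hD n)).mono hfil
  by_cases hex : ∃ n, iteratedDerivWithin n D (Ico q q₁) q ≠ 0
  · left
    classical
    have hmin : ∀ k < Nat.find hex, iteratedDerivWithin k D (Ico q q₁) q = 0 :=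
      fun k hk => not_not.1 (Nat.find_min hex hk)
    have hspec := Nat.find_spec hex
    obtain ⟨n, hn⟩ : ∃ n, n = Nat.find hex := ⟨_, rfl⟩
    rw [← hn] at hspec hmin
    match n with
    | 0 => exact absurd (by simpa using h0) hspec
    | 1 => exact absurd (by rw [iteratedDerivWithin_one]; exact h1) hspec
    | s + 2 =>
      refine ⟨s + 1, by omega, _, mul_ne_zero
        (inv_ne_zero (show ((s + 1 : ℕ) + 1 : ℝ) * ((s + 1).factorial : ℝ) ≠ 0 by positivity))
        hspec, ?_⟩
      have hlit := (hT (s + 2)).tendsto_div_nhds_zero.add_const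
        ((((s + 1 : ℕ) + 1 : ℝ) * ((s + 1).factorial : ℝ))⁻¹ *
          iteratedDerivWithin (s + 2) D (Ico q q₁) q)
      rw [zero_add] at hlit
      refine hlit.congr' ?_
      filter_upwards [self_mem_nhdsWithin] with x hx
      have hx' : x - q ≠ 0 := (sub_pos.2 hx).ne'
      rw [taylorWithinEval_succ,
        taylorWithinEval_eq_zero (s + 1) (fun k hk => hmin k (by omega)), zero_add, smul_eq_mul]
      field_simp
      ring
  · right
    intro m
    have hz : ∀ k, iteratedDerivWithin k D (Ico q q₁) q = 0 :=
      fun k => not_not.1 fun h => hex ⟨k, h⟩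
    have h := (hT m).isBigO
    simpa only [taylorWithinEval_eq_zero m fun k _ => hz k, sub_zero] using h

theorem tendsto_slope_of_contDiffOn {H k : ℝ → ℝ} {q p₁ : ℝ} (hq : q < p₁)
    (hH : ContDiffOn ℝ ∞ H (Ico q p₁)) (hk : ∀ x ∈ Ioo q p₁, q ≤ k x ∧ k x < x) :
    Tendsto (fun x => (H x - H (k x)) / (x - k x)) (𝓝[>] q)
      (𝓝 (derivWithin H (Ico q p₁) q)) := by
  have hU := uniqueDiffOn_Ico q p₁
  have hcont := hH.continuousOn_derivWithin hU (by simp)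
  have hmvt : ∀ x ∈ Ioo q p₁, ∃ ξ ∈ Ioo (k x) x,
      derivWithin H (Ico q p₁) ξ = (H x - H (k x)) / (x - k x) := by
    intro x hx
    refine exists_hasDerivAt_eq_slope H _ (hk x hx).2
      (hH.continuousOn.mono fun y hy => ⟨(hk x hx).1.trans hy.1, hy.2.trans_lt hx.2⟩)
      fun y hy => ?_
    have hy' : y ∈ Ioo q p₁ := ⟨(hk x hx).1.trans_lt hy.1, hy.2.trans hx.2⟩
    exact ((hH.differentiableOn (by simp) y (Ioo_subset_Ico_self hy')).hasDerivWithinAt).hasDerivAt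
      (mem_of_superset (Ioo_mem_nhds hy'.1 hy'.2) Ioo_subset_Ico_self)
  choose! ξ hξ hξe using hmvt
  have hIoo := Ioo_mem_nhdsGT hq
  have hx0 : Tendsto (fun x : ℝ => x) (𝓝[>] q) (𝓝 q) :=
    tendsto_nhdsWithin_of_tendsto_nhds tendsto_id
  have hξt : Tendsto ξ (𝓝[>] q) (𝓝[Ico q p₁] q) := by
    refine tendsto_nhdsWithin_iff.2 ⟨tendsto_of_tendsto_of_tendsto_of_le_of_le'
      tendsto_const_nhds hx0 ?_ ?_, ?_⟩
    all_goals filter_upwards [hIoo] with x hx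
    · exact (hk x hx).1.trans (hξ x hx).1.le
    · exact (hξ x hx).2.le
    · exact ⟨(hk x hx).1.trans (hξ x hx).1.le, (hξ x hx).2.trans hx.2⟩
  refine ((hcont q (left_mem_Ico.2 hq)).tendsto.comp hξt).congr' ?_
  filter_upwards [hIoo] with x hx
  exact hξe x hx

theorem tendsto_div_of_contDiffOn {H : ℝ → ℝ} {q p₁ : ℝ} (hq : q < p₁)
    (hH : ContDiffOn ℝ ∞ H (Ico q p₁)) :
    Tendsto (fun x => (H x - H q) / (x - q)) (𝓝[>] q) (𝓝 (derivWithin H (Ico q p₁) q)) :=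
  tendsto_slope_of_contDiffOn (k := fun _ => q) hq hH fun _ hx => ⟨le_rfl, hx.1⟩

/-- If `H` linearizes `f` and `k` satisfies a Baumslag–Solitar relation with `f`, then `k` is a
translation in a negative power of the coordinate `H`. -/
theorem exists_translation_coordinate {l : ℕ} (hl : 2 ≤ l) {q p₁ μ : ℝ} (hq : q < p₁)
    {f k H : ℝ → ℝ} (hμ0 : 0 < μ) (hμ1 : μ < 1)
    (hHb : BijOn H (Ico q p₁) (Ici 0)) (hHs : ContDiffOn ℝ ∞ H (Ico q p₁))
    (hHd : ∀ x ∈ Ico q p₁, 0 < derivWithin H (Ico q p₁) x) (hHq : H q = 0)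
    (hHf : ∀ x ∈ Ico q p₁, f x ∈ Ico q p₁ ∧ H (f x) = μ * H x)
    (hk : ∀ x ∈ Ioo q p₁, q < k x ∧ k x < x)
    (hrel : ∀ x ∈ Ioo q p₁, f (k x) = k^[l] (f x))
    (hasymp : (∃ s : ℕ, 1 ≤ s ∧ ∃ c : ℝ, c ≠ 0 ∧
        Tendsto (fun x => (x - k x) / (x - q) ^ (s + 1)) (𝓝[>] q) (𝓝 c)) ∨
      ∀ m : ℕ, (fun x => x - k x) =O[𝓝[>] q] fun x => (x - q) ^ m) :
    ∃ s : ℕ, 1 ≤ s ∧ ∃ a : ℝ, 0 < a ∧ μ ^ s = 1 / l ∧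
      ∀ x ∈ Ioo q p₁, (H (k x) ^ s)⁻¹ = (H x ^ s)⁻¹ + a := by
  have hqI : q ∈ Ico q p₁ := left_mem_Ico.2 hq
  have hmono := strictMonoOn_Ico_of_derivWithin_pos hHs.continuousOn hHd
  have hIoo := Ioo_mem_nhdsGT hq
  have hHpos : ∀ x ∈ Ioo q p₁, 0 < H x :=
    fun x hx => hHq ▸ hmono hqI (Ioo_subset_Ico_self hx) hx.1
  set P : ℝ → ℝ := Function.invFunOn H (Ico q p₁) with hP
  have hPH : ∀ x ∈ Ico q p₁, P (H x) = x := fun x hx => hHb.invOn_invFunOn.1 hx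
  have hPmem : ∀ y, 0 < y → P y ∈ Ioo q p₁ ∧ H (P y) = y := by
    intro y hy
    have hy' : y ∈ Ici (0 : ℝ) := le_of_lt hy
    have h1 : P y ∈ Ico q p₁ := hHb.surjOn.mapsTo_invFunOn hy'
    have h2 : H (P y) = y := hHb.invOn_invFunOn.2 hy'
    refine ⟨⟨lt_of_le_of_ne h1.1 fun h => ?_, h1.2⟩, h2⟩
    rw [← h, hHq] at h2
    exact hy.ne h2
  have hkm : ∀ x ∈ Ioo q p₁, k x ∈ Ioo q p₁ :=
    fun x hx => ⟨(hk x hx).1, (hk x hx).2.trans hx.2⟩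
  set K : ℝ → ℝ := fun y => H (k (P y)) with hKdef
  have hK : ∀ y, 0 < y → 0 < K y ∧ K y < y := by
    intro y hy
    obtain ⟨h1, h2⟩ := hPmem y hy
    refine ⟨hHpos _ (hkm _ h1), ?_⟩
    have := hmono (Ioo_subset_Ico_self (hkm _ h1)) (Ioo_subset_Ico_self h1) (hk _ h1).2
    rwa [h2] at this
  have hKH : ∀ x ∈ Ioo q p₁, K (H x) = H (k x) := by
    intro x hx
    simp only [hKdef, hPH x (Ioo_subset_Ico_self hx)]
  have hKit : ∀ n, ∀ x ∈ Ioo q p₁, K^[n] (H x) = H (k^[n] x) := by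
    intro n
    induction n with
    | zero => intro x _; rfl
    | succ n ih =>
      intro x hx
      rw [Function.iterate_succ_apply, Function.iterate_succ_apply, hKH x hx, ih _ (hkm x hx)]
  have hKrel : ∀ y, 0 < y → μ * K y = K^[l] (μ * y) := by
    intro y hy
    obtain ⟨h1, h2⟩ := hPmem y hy
    have h3 := hHf _ (Ioo_subset_Ico_self h1)
    rw [h2] at h3
    have h4 : f (P y) ∈ Ioo q p₁ := by
      refine ⟨lt_of_le_of_ne h3.1.1 fun h => ?_, h3.1.2⟩
      have h5 := h3.2
      rw [← h, hHq] at h5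
      exact (mul_pos hμ0 hy).ne h5
    rw [← h3.2, hKit l _ h4, ← hrel _ h1, (hHf _ (Ioo_subset_Ico_self (hkm _ h1))).2]
  have hPt : Tendsto P (𝓝[>] 0) (𝓝[>] q) := by
    refine tendsto_nhdsWithin_iff.2 ⟨tendsto_order.2 ⟨fun x hx => ?_, fun x hx => ?_⟩, ?_⟩
    · filter_upwards [self_mem_nhdsWithin] with y hy
      exact hx.trans (hPmem y hy).1.1
    · obtain ⟨z, hz1, hz2⟩ := exists_between (lt_min hx hq)
      have hz : z ∈ Ioo q p₁ := ⟨hz1, hz2.trans_le (min_le_right _ _)⟩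
      filter_upwards [Ioo_mem_nhdsGT (hHpos z hz)] with y hy
      obtain ⟨h1, h2⟩ := hPmem y hy.1
      have h3 : H (P y) < H z := h2.symm ▸ hy.2
      exact ((hmono.lt_iff_lt (Ioo_subset_Ico_self h1) (Ioo_subset_Ico_self hz)).1 h3).trans
        (hz2.trans_le (min_le_left _ _))
    · filter_upwards [self_mem_nhdsWithin] with y hy
      exact (hPmem y hy).1.1
  set h₀ := derivWithin H (Ico q p₁) q with hh₀
  have hh₀pos : 0 < h₀ := hHd q hqI
  have hslope := tendsto_slope_of_contDiffOn hq hHs fun x hx => ⟨(hk x hx).1.le, (hk x hx).2⟩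
  have hdiv := tendsto_div_of_contDiffOn hq hHs
  simp only [hHq, sub_zero] at hdiv
  have hdivinv : Tendsto (fun x => (x - q) / H x) (𝓝[>] q) (𝓝 h₀⁻¹) := by
    refine (hdiv.inv₀ hh₀pos.ne').congr fun x => ?_
    rw [inv_div]
  rcases hasymp with ⟨s, hs, c, hc, hlim⟩ | hflat
  · have hlimK : Tendsto (fun y => (y - K y) / y ^ (s + 1)) (𝓝[>] 0)
        (𝓝 (h₀ * c * h₀⁻¹ ^ (s + 1))) := by
      refine (((hslope.mul hlim).mul (hdivinv.pow (s + 1))).comp hPt).congr' ?_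
      filter_upwards [self_mem_nhdsWithin] with y hy
      obtain ⟨h1, h2⟩ := hPmem y hy
      have e1 : P y - k (P y) ≠ 0 := (sub_pos.2 (hk _ h1).2).ne'
      have e2 : P y - q ≠ 0 := (sub_pos.2 h1.1).ne'
      have e3 : y ≠ 0 := ne_of_gt hy
      simp only [Function.comp_apply, h2, div_pow, hKdef]
      field_simp
    obtain ⟨a, ha, hμs, htr⟩ := inv_pow_translation_of_renormalization hl hs
      (by positivity : h₀ * c * h₀⁻¹ ^ (s + 1) ≠ 0) hμ0 hμ1 hK hKrel hlimK
    refine ⟨s, hs, a, ha, hμs, fun x hx => ?_⟩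
    rw [← hKH x hx]
    exact htr _ (hHpos x hx)
  · refine absurd (fun m => ?_) (not_flat_of_renormalization hK hμ0 hμ1 hKrel)
    have h1 : (fun x => H x - H (k x)) =O[𝓝[>] q] fun x => x - k x := by
      refine Asymptotics.isBigO_of_div_tendsto_nhds ?_ _ hslope
      filter_upwards [hIoo] with x hx h
      exact absurd h (sub_pos.2 (hk x hx).2).ne'
    have h2 : (fun x => x - q) =O[𝓝[>] q] H := by
      refine Asymptotics.isBigO_of_div_tendsto_nhds ?_ _ hdivinv
      filter_upwards [hIoo] with x hx h
      exact absurd h (hHpos x hx).ne'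
    refine (((h1.trans (hflat m)).trans (h2.pow m)).comp_tendsto hPt).congr' ?_ ?_
    all_goals
      filter_upwards [self_mem_nhdsWithin] with y hy
      simp only [Function.comp_apply, (hPmem y hy).2, hKdef]

/-- The Baumslag–Solitar relation forces `g` to be tangent to the identity at the common fixed
point. -/
theorem derivWithin_eq_one_of_relation {l : ℕ} (hl : 2 ≤ l) {q q₁ : ℝ} (hq : q < q₁)
    {f g : ℝ → ℝ} (hf : IsCrDiffeoOnIco ∞ f q q₁) (hg : IsCrDiffeoOnIco ∞ g q q₁)
    (hfq : f q = q) (hgq : g q = q) (hrel : ∀ x ∈ Ico q q₁, f (g x) = g^[l] (f x)) :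
    derivWithin g (Ico q q₁) q = 1 := by
  have hqI : q ∈ Ico q q₁ := left_mem_Ico.2 hq
  have hμ := hf.2.2 q hqI
  have hβ := hg.2.2 q hqI
  have hF := hf.hasDerivWithinAt hqI
  have hG := hg.hasDerivWithinAt hqI
  set μ := derivWithin f (Ico q q₁) q
  set β := derivWithin g (Ico q q₁) q
  have h1 : HasDerivWithinAt (f ∘ g) (μ * β) (Ico q q₁) q :=
    HasDerivWithinAt.comp q (by rwa [hgq]) hG hg.1.mapsTo
  have hGl : HasDerivWithinAt g^[l] (β ^ l) (Ico q q₁) q := hG.iterate q hgq hg.1.mapsTo l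
  have h2 : HasDerivWithinAt (g^[l] ∘ f) (β ^ l * μ) (Ico q q₁) q :=
    HasDerivWithinAt.comp q (by rwa [hfq]) hF hf.1.mapsTo
  have h3 : HasDerivWithinAt (f ∘ g) (β ^ l * μ) (Ico q q₁) q :=
    h2.congr hrel (hrel q hqI)
  have hu := uniqueDiffOn_Ico q q₁ q hqI
  have h4 : μ * β = β ^ l * μ := (h1.derivWithin hu).symm.trans (h3.derivWithin hu)
  obtain ⟨m, rfl⟩ : ∃ m, l = m + 1 := ⟨l - 1, by omega⟩
  have h5 : β ^ m = 1 := by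
    rw [pow_succ] at h4
    exact mul_right_cancel₀ (mul_pos hμ hβ).ne' (by linarith)
  exact (pow_eq_one_iff_of_nonneg hβ.le (by omega)).1 h5

/-- The leading term (or flatness) of `g - id` is inherited by `id - k`, for `k` a right inverse
of a map `g` tangent to the identity. -/
theorem leading_term_or_flat_of_rightInverse {g k : ℝ → ℝ} {q q₁ : ℝ} (hq : q < q₁)
    (hg : ContDiffOn ℝ ∞ g (Ico q q₁)) (hgq : g q = q) (hg1 : derivWithin g (Ico q q₁) q = 1)
    (hk : ∀ x ∈ Ioo q q₁, q < k x ∧ k x < x ∧ g (k x) = x)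
    (hasymp : (∃ s : ℕ, 1 ≤ s ∧ ∃ c : ℝ, c ≠ 0 ∧
        Tendsto (fun x => (g x - x) / (x - q) ^ (s + 1)) (𝓝[>] q) (𝓝 c)) ∨
      ∀ m : ℕ, (fun x => g x - x) =O[𝓝[>] q] fun x => (x - q) ^ m) :
    (∃ s : ℕ, 1 ≤ s ∧ ∃ c : ℝ, c ≠ 0 ∧
        Tendsto (fun x => (x - k x) / (x - q) ^ (s + 1)) (𝓝[>] q) (𝓝 c)) ∨
      ∀ m : ℕ, (fun x => x - k x) =O[𝓝[>] q] fun x => (x - q) ^ m := by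
  have hIoo := Ioo_mem_nhdsGT hq
  have hkt : Tendsto k (𝓝[>] q) (𝓝[>] q) := by
    refine tendsto_nhdsWithin_iff.2 ⟨?_, ?_⟩
    · refine tendsto_of_tendsto_of_tendsto_of_le_of_le' tendsto_const_nhds
        (tendsto_id.mono_left nhdsWithin_le_nhds) ?_ ?_
      · filter_upwards [hIoo] with x hx using (hk x hx).1.le
      · filter_upwards [hIoo] with x hx using (hk x hx).2.1.le
    · filter_upwards [hIoo] with x hx using (hk x hx).1
  have hdiv := (tendsto_div_of_contDiffOn hq hg).comp hkt
  rw [hg1, hgq] at hdiv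
  have hratio : Tendsto (fun x => (k x - q) / (x - q)) (𝓝[>] q) (𝓝 1) := by
    have := hdiv.inv₀ one_ne_zero
    rw [inv_one] at this
    refine this.congr' ?_
    filter_upwards [hIoo] with x hx
    simp [(hk x hx).2.2]
  rcases hasymp with ⟨s, hs, c, hc, hlim⟩ | hflat
  · refine .inl ⟨s, hs, c, hc, ?_⟩
    have := (hlim.comp hkt).mul (hratio.pow (s + 1))
    rw [one_pow, mul_one] at this
    refine this.congr' ?_
    filter_upwards [hIoo] with x hx
    have h1 : k x - q ≠ 0 := (sub_pos.2 (hk x hx).1).ne'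
    have h2 : x - q ≠ 0 := (sub_pos.2 hx.1).ne'
    simp only [Function.comp, (hk x hx).2.2, div_pow]
    field_simp
  · refine .inr fun m => ?_
    have h1 := (hflat m).comp_tendsto hkt
    refine (h1.trans (?_ : _ =O[𝓝[>] q] fun x => (x - q) ^ m)).congr' ?_ EventuallyEq.rfl
    · refine Asymptotics.IsBigO.of_bound 1 ?_
      filter_upwards [hIoo] with x hx
      have h2 : 0 < k x - q := sub_pos.2 (hk x hx).1
      simp only [Function.comp, norm_pow, Real.norm_eq_abs, one_mul]
      rw [abs_of_pos h2, abs_of_pos (sub_pos.2 hx.1)]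
      exact pow_le_pow_left₀ h2.le (by linarith [(hk x hx).2.1]) m
    · filter_upwards [hIoo] with x hx
      simp [(hk x hx).2.2]

theorem lt_or_gt_of_forall_ne {g : ℝ → ℝ} {q q₁ : ℝ} (hg : ContinuousOn g (Ioo q q₁))
    (hfix : ∀ x ∈ Ioo q q₁, g x ≠ x) :
    (∀ x ∈ Ioo q q₁, g x < x) ∨ ∀ x ∈ Ioo q q₁, x < g x := by
  by_contra! h
  obtain ⟨⟨x, hx, hxg⟩, y, hy, hyg⟩ := h
  obtain ⟨z, hz, hzg⟩ := isPreconnected_Ioo.intermediate_value₂ hy hx hg continuousOn_id hyg hxg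
  exact hfix z hz hzg

theorem iterate_leftInverse_apply_of_mapsTo {α : Type*} {g k : α → α} {S : Set α}
    (hg : MapsTo g S S) (hkg : ∀ x ∈ S, k (g x) = x) (n : ℕ) : ∀ x ∈ S, k^[n] (g^[n] x) = x := by
  induction n with
  | zero => exact fun _ _ => rfl
  | succ n ih =>
    intro x hx
    rw [Function.iterate_succ_apply, Function.iterate_succ_apply', hkg _ (hg.iterate n hx),
      ih x hx]

/-- In a coordinate linearizing `f`, the map `g` is a translation of a negative power of that
coordinate. -/
theorem exists_translation_of_relation {l : ℕ} (hl : 2 ≤ l) {q q₁ p₁ : ℝ} (hq : q < q₁)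
    {f g H : ℝ → ℝ} (hf : IsCrDiffeoOnIco ∞ f q q₁) (hg : IsCrDiffeoOnIco ∞ g q q₁)
    (hfq : f q = q) (hgq : g q = q) (hgfix : ∀ x ∈ Ioo q q₁, g x ≠ x)
    (hf'q : derivWithin f (Ico q q₁) q < 1)
    (hrel : ∀ x ∈ Ico q q₁, f (g x) = g^[l] (f x)) (hp₁ : p₁ ∈ Ioc q q₁)
    (hHb : BijOn H (Ico q p₁) (Ici 0)) (hHs : ContDiffOn ℝ ∞ H (Ico q p₁))
    (hHd : ∀ x ∈ Ico q p₁, 0 < derivWithin H (Ico q p₁) x) (hHq : H q = 0)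
    (hHf : ∀ x ∈ Ico q p₁,
      f x ∈ Ico q p₁ ∧ H (f x) = derivWithin f (Ico q q₁) q * H x) :
    ∃ s : ℕ, 1 ≤ s ∧ ∃ a : ℝ, 0 < a ∧ derivWithin f (Ico q q₁) q ^ s = 1 / l ∧
      ∃ o : ℝ, (o = 1 ∨ o = -1) ∧
        ∀ x ∈ Ioo q p₁, g x ∈ Ioo q p₁ → (H (g x) ^ s)⁻¹ = (H x ^ s)⁻¹ - o * a := by
  have hqI : q ∈ Ico q q₁ := left_mem_Ico.2 hq
  have hμ := hf.2.2 q hqI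
  have hg1 := derivWithin_eq_one_of_relation hl hq hf hg hfq hgq hrel
  have hsub : Ioo q p₁ ⊆ Ioo q q₁ := Ioo_subset_Ioo_right hp₁.2
  have hgpos : ∀ x ∈ Ioo q q₁, q < g x := fun x hx => by
    simpa only [hgq] using hg.strictMonoOn hqI (Ioo_subset_Ico_self hx) hx.1
  have hasymp := exists_leading_term_or_flat (D := fun x => g x - x) hq
    (hg.2.1.sub contDiffOn_id) (by simp [hgq]) (by
      have := ((hg.hasDerivWithinAt hqI).sub (hasDerivWithinAt_id q _)).derivWithin
        (uniqueDiffOn_Ico q q₁ q hqI)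
      rw [hg1, sub_self] at this
      exact this)
  rcases lt_or_gt_of_forall_ne (hg.2.1.continuousOn.mono Ioo_subset_Ico_self) hgfix with
    hlt | hgt
  · obtain ⟨s, hs, a, ha, hμs, htr⟩ := exists_translation_coordinate hl hp₁.1 hμ hf'q hHb hHs hHd
      hHq hHf (fun x hx => ⟨hgpos x (hsub hx), hlt x (hsub hx)⟩)
      (fun x hx => hrel x (Ioo_subset_Ico_self (hsub hx))) (by
        rcases hasymp with ⟨s, hs, c, hc, hlim⟩ | hflat
        · refine .inl ⟨s, hs, -c, neg_ne_zero.2 hc, hlim.neg.congr fun x => ?_⟩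
          rw [← neg_div, neg_sub]
        · refine .inr fun m => ((hflat m).neg_left).congr_left fun x => neg_sub _ _)
    refine ⟨s, hs, a, ha, hμs, -1, .inr rfl, fun x hx _ => ?_⟩
    rw [htr x hx]
    ring
  · set k := Function.invFunOn g (Ico q q₁)
    have hkg : ∀ x ∈ Ico q q₁, k (g x) = x := fun x hx => hg.1.invOn_invFunOn.1 hx
    have hgk : ∀ x ∈ Ico q q₁, g (k x) = x := fun x hx => hg.1.invOn_invFunOn.2 hx
    have hkmem : ∀ x ∈ Ico q q₁, k x ∈ Ico q q₁ := fun x hx =>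
      hg.1.surjOn.mapsTo_invFunOn hx
    have hk : ∀ x ∈ Ioo q q₁, q < k x ∧ k x < x ∧ g (k x) = x := by
      intro x hx
      have hxI := Ioo_subset_Ico_self hx
      have hlt : q < k x := by
        refine (hkmem x hxI).1.lt_of_ne fun h => hx.1.ne ?_
        rw [← hgk x hxI, ← h, hgq]
      have := hgt (k x) ⟨hlt, (hkmem x hxI).2⟩
      rw [hgk x hxI] at this
      exact ⟨hlt, this, hgk x hxI⟩
    obtain ⟨s, hs, a, ha, hμs, htr⟩ := exists_translation_coordinate hl hp₁.1 hμ hf'q hHb hHs hHd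
      hHq hHf (fun x hx => ⟨(hk x (hsub hx)).1, (hk x (hsub hx)).2.1⟩)
      (fun x hx => by
        have hxI := Ioo_subset_Ico_self (hsub hx)
        have h := hrel (k x) (hkmem x hxI)
        rw [hgk x hxI] at h
        rw [h, iterate_leftInverse_apply_of_mapsTo hg.1.mapsTo hkg l _ (hf.1.mapsTo (hkmem x hxI))])
      (leading_term_or_flat_of_rightInverse hq hg.2.1 hgq hg1 hk hasymp)
    refine ⟨s, hs, a, ha, hμs, 1, .inl rfl, fun x hx hgx => ?_⟩
    have := htr (g x) hgx
    rw [hkg x (Ioo_subset_Ico_self (hsub hx))] at this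
    rw [this]
    ring

/-- Local normal form near the common fixed point: there exist `p₁ ∈ (q, q₁]`, an integer
`s ≥ 1`, a sign `o ∈ {±1}` and a smooth diffeomorphism `H : [q, p₁) → [0, ∞)` with
`H(q) = 0`, such that `A = o·H^s` satisfies `A ∘ f = A/λ` and `A ∘ g = A/(1-A)`;
moreover `f′(q) = (1/λ)^(1/s)`. -/
theorem local_normal_form_at_fixed_point
    (l : ℕ) (hl : 2 ≤ l) (q q₁ : ℝ) (hq : q < q₁) (f g : ℝ → ℝ)
    (hf : IsCrDiffeoOnIco ∞ f q q₁) (hg : IsCrDiffeoOnIco ∞ g q q₁)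
    (hfq : f q = q) (hgq : g q = q)
    (hgfix : ∀ x ∈ Set.Ioo q q₁, g x ≠ x)
    (hf'q : derivWithin f (Set.Ico q q₁) q < 1)
    (hrel : ∀ x ∈ Set.Ico q q₁, f (g x) = g^[l] (f x)) :
    ∃ p₁ ∈ Set.Ioc q q₁, ∃ s : ℕ, 1 ≤ s ∧ ∃ o : ℝ, (o = 1 ∨ o = -1) ∧
      ∃ H : ℝ → ℝ,
        Set.BijOn H (Set.Ico q p₁) (Set.Ici 0) ∧
        ContDiffOn ℝ ∞ H (Set.Ico q p₁) ∧
        (∀ x ∈ Set.Ico q p₁, 0 < derivWithin H (Set.Ico q p₁) x) ∧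
        H q = 0 ∧
        (∀ p ∈ Set.Ico q p₁, f p ∈ Set.Ico q p₁ →
          o * H (f p) ^ s = (o * H p ^ s) / l) ∧
        (∀ p ∈ Set.Ico q p₁, g p ∈ Set.Ico q p₁ →
          o * H (g p) ^ s = (o * H p ^ s) / (1 - o * H p ^ s)) ∧
        derivWithin f (Set.Ico q q₁) q = ((1 : ℝ) / l) ^ ((1 : ℝ) / s) := by
  have hqI : q ∈ Ico q q₁ := left_mem_Ico.2 hq
  have hμ := hf.2.2 q hqI
  obtain ⟨p₁, hp₁, H, hHb, hHs, hHd, hHq, hHf⟩ := hf.exists_linearization hq hfq hf'q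
  obtain ⟨s, hs, a, ha, hμs, o, ho, hgH⟩ := exists_translation_of_relation hl hq hf hg hfq hgq
    hgfix hf'q hrel hp₁ hHb hHs hHd hHq hHf
  have hs0 : s ≠ 0 := by omega
  have hmono := strictMonoOn_Ico_of_derivWithin_pos hHs.continuousOn hHd
  have hHpos : ∀ x ∈ Ioo q p₁, 0 < H x :=
    fun x hx => hHq ▸ hmono (left_mem_Ico.2 hp₁.1) (Ioo_subset_Ico_self hx) hx.1
  set μ := derivWithin f (Ico q q₁) q
  set t : ℝ := a ^ ((s : ℝ)⁻¹)
  have ht : 0 < t := Real.rpow_pos_of_pos ha _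
  have hts : t ^ s = a := Real.rpow_inv_natCast_pow ha.le hs0
  have hscale : BijOn (fun y => t * y) (Ici 0) (Ici 0) := by
    refine ⟨fun y hy => mul_nonneg ht.le hy, (mul_right_injective₀ ht.ne').injOn, fun y hy =>
      ⟨y / t, div_nonneg hy ht.le, ?_⟩⟩
    exact mul_div_cancel₀ y ht.ne'
  refine ⟨p₁, hp₁, s, hs, o, ho, fun x => t * H x, hscale.comp hHb, contDiffOn_const.mul hHs,
    fun x hx => ?_, by simp [hHq], fun x hx _ => ?_, fun x hx hgx => ?_, ?_⟩
  · have h := ((hHs.differentiableOn (by simp) x hx).hasDerivWithinAt.const_mul t).derivWithin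
      (uniqueDiffOn_Ico q p₁ x hx)
    rw [h]
    exact mul_pos ht (hHd x hx)
  · simp only [(hHf x hx).2, mul_pow, hμs]
    ring
  · rcases hx.1.eq_or_lt with rfl | hqx
    · simp [hgq, hHq, hs0]
    · have hxI : x ∈ Ioo q p₁ := ⟨hqx, hx.2⟩
      have hqg : q < g x := by
        simpa only [hgq] using hg.strictMonoOn hqI ⟨hx.1, hx.2.trans_le hp₁.2⟩ hqx
      have hgI : g x ∈ Ioo q p₁ := ⟨hqg, hgx.2⟩
      have h := hgH x hxI hgI
      have hu : 0 < H x ^ s := pow_pos (hHpos x hxI) s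
      have hv : 0 < H (g x) ^ s := pow_pos (hHpos _ hgI) s
      simp only [mul_pow, hts]
      set u := H x ^ s
      set v := H (g x) ^ s
      have huv : u = v * (1 - o * (a * u)) := by
        field_simp at h
        linear_combination h
      have hne : 1 - o * (a * u) ≠ 0 := fun h0 => hu.ne' (by rw [huv, h0, mul_zero])
      rw [eq_div_iff hne]
      linear_combination -(o * a) * huv
  · rw [← hμs, one_div, Real.pow_rpow_inv_natCast hμ.le hs0]

end
end
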